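/- Let F be an infinite field with char(F) = 3 and let u ∈ M_F be a linear combination of words containing no occurrence of x_1 or x_1^T. Let U ∈ M_3(R) be the 3×3 matrix obtained from u by substituting the generic matrix X_k for x_k and X_kᵀ for x_k^T for each k. Then the invariant tr(U X_1²) ∈ R^{O(3)} is decomposable (lies in the square of the ideal of R^{O(3)} generated by all homogeneous invariants of positive degree) if and only if u = 0 in A_{3,d}. -/

import Mathlib

open FreeAlgebra MulOpposite

/-- The alphabet: `(k, false)` is the letter `x_{k+1}`, `(k, true)` is `x_{k+1}ᵀ`. -/
abbrev Ltr (d : ℕ) := Fin d × Bool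

/-- The free (unital) associative algebra on the `2d` letters.  The free non-unital
algebra `M_F` sits inside it as the span of the nonempty words. -/
abbrev FA (F : Type) [Field F] (d : ℕ) := FreeAlgebra F (Ltr d)

variable (F : Type) [Field F] (d : ℕ)

/-- The word in the free algebra corresponding to a list of letters
(the empty list gives `1`, the unit). -/
def wordOf (l : List (Ltr d)) : FA F d := (l.map (FreeAlgebra.ι F)).prod

/-- The transpose: the linear anti-automorphism with `x ↦ xᵀ`, `xᵀ ↦ x`. -/
def tp (a : FA F d) : FA F d :=
  ((FreeAlgebra.lift F fun p : Ltr d => op (FreeAlgebra.ι F (p.1, !p.2))) a).unop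

/-- `ā = a - aᵀ`. -/
def bar (a : FA F d) : FA F d := a - tp F d a

/-- `T(a,b,c) = a b̄ c̄ + b̄ aᵀ c̄ + b̄ c̄ a`. -/
def Trel (a b c : FA F d) : FA F d :=
  a * bar F d b * bar F d c + bar F d b * tp F d a * bar F d c + bar F d b * bar F d c * a

/-- The copy of the free non-unital algebra `M_F`, i.e. the span of the nonempty words. -/
def MFsub : Submodule F (FA F d) :=
  Submodule.span F {w | ∃ l : List (Ltr d), l ≠ [] ∧ w = wordOf F d l}

/-- The two-sided ideal such that `A_{3,d} = M_F / (idealA ∩ M_F)`: it is generated by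
`a³` for `a ∈ M_F` together with `T(a,b,c)` for `a, b, c ∈ M_F`.  (Since all generators lie in
`M_F`, its intersection with `M_F` is exactly the two-sided ideal of the non-unital algebra
`M_F` generated by these elements; in fact it is contained in `M_F`.)
An element `u ∈ M_F` is zero in `A_{3,d}` iff `u ∈ idealA F d`. -/
def idealA : TwoSidedIdeal (FA F d) :=
  TwoSidedIdeal.span
    ({x | ∃ a ∈ MFsub F d, x = a ^ 3} ∪
     {x | ∃ a ∈ MFsub F d, ∃ b ∈ MFsub F d, ∃ c ∈ MFsub F d, x = Trel F d a b c})

open Matrix MvPolynomial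

/-- The polynomial ring `R = F[x_{ij}(k)]`, `1 ≤ i,j ≤ 3`, `1 ≤ k ≤ d`. -/
abbrev Rpoly (F : Type) [Field F] (d : ℕ) := MvPolynomial (Fin 3 × Fin 3 × Fin d) F

variable (F : Type) [Field F] (d : ℕ)

/-- The `k`-th generic 3×3 matrix `X_k`. -/
noncomputable def genMat (k : Fin d) : Matrix (Fin 3) (Fin 3) (Rpoly F d) :=
  Matrix.of fun i j => MvPolynomial.X (i, j, k)

/-- The action of `g` on `R` by simultaneous conjugation: entries of `X_k` are replaced
by the entries of `gᵀ X_k g`. -/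
noncomputable def actHom (g : Matrix (Fin 3) (Fin 3) F) : Rpoly F d →ₐ[F] Rpoly F d :=
  MvPolynomial.aeval fun p : Fin 3 × Fin 3 × Fin d =>
    ((g.map (algebraMap F (Rpoly F d)))ᵀ * genMat F d p.2.2 *
      g.map (algebraMap F (Rpoly F d))) p.1 p.2.1

/-- The algebra `R^{O(3)}` of invariants of the orthogonal group. -/
noncomputable def invAlg : Subalgebra F (Rpoly F d) where
  carrier := {f | ∀ g : Matrix (Fin 3) (Fin 3) F, gᵀ * g = 1 → actHom F d g f = f}
  mul_mem' := by
    intro a b ha hb g hg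
    rw [_root_.map_mul, ha g hg, hb g hg]
  add_mem' := by
    intro a b ha hb g hg
    rw [_root_.map_add, ha g hg, hb g hg]
  one_mem' := by
    intro g hg
    exact map_one _
  algebraMap_mem' := by
    intro r g hg
    exact (actHom F d g).commutes r

/-- The ideal of `R^{O(3)}` generated by all homogeneous invariants of positive degree. -/
noncomputable def plusIdeal : Ideal (invAlg F d) :=
  Ideal.span {f | ∃ n : ℕ, 0 < n ∧ MvPolynomial.IsHomogeneous (f : Rpoly F d) n}

/-- The set of decomposable invariants: elements of `R^{O(3)}` lying in the square of the
ideal generated by all homogeneous invariants of positive degree. -/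
noncomputable def decompSet : Set (Rpoly F d) :=
  Subtype.val '' ((plusIdeal F d ^ 2 : Ideal (invAlg F d)) : Set (invAlg F d))

/-- Substitution of the generic matrices: `x_k ↦ X_k`, `x_kᵀ ↦ X_kᵀ`. -/
noncomputable def evMat : FA F d →ₐ[F] Matrix (Fin 3) (Fin 3) (Rpoly F d) :=
  FreeAlgebra.lift F fun p : Ltr d => if p.2 then (genMat F d p.1)ᵀ else genMat F d p.1

set_option linter.all false
open Function (update update_of_ne)
open Submodule (subset_span span_le span_induction span smul_mem)
open Finset (mem_insert)
open Fin (sum_univ_three)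
open List (count_pos_iff)
open Equiv (Perm)
open Matrix (mul_apply trace)
open MvPolynomial (constantCoeff)
theorem uN {α : Type*} {β : α → Type*} [DecidableEq α] {a a' : α} (h : a' ≠ a) (v : β a') (f : ∀ a, β a) : update f a' v a = f a := update_of_ne h.symm v f
section FFT
variable {K : Type} [Field K] {P : Type} [DecidableEq P]
def fB (x y : Fin 3 → K) : K := -(x 0 * y 2 + x 2 * y 0 + x 1 * y 1)
def fTri (x y z : Fin 3 → K) : K :=
  x 0 * (y 1 * z 2 - y 2 * z 1) - x 1 * (y 0 * z 2 - y 2 * z 0) + x 2 * (y 0 * z 1 - y 1 * z 0)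
def fQ2 (x y : Fin 3 → K) : K := x 1 * y 2 - x 2 * y 1
def fU (t : K) (x : Fin 3 → K) : Fin 3 → K := ![x 0 + t * x 1 + t ^ 2 * x 2, x 1 - t * x 2, x 2]
def fT (t : K) (x : Fin 3 → K) : Fin 3 → K := ![t * x 0, x 1, t⁻¹ * x 2]
def fW (x : Fin 3 → K) : Fin 3 → K := ![x 2, - x 1, x 0]
def fL (t : K) (x : Fin 3 → K) : Fin 3 → K := ![x 0, x 1 - t * x 0, x 2 + t * x 1 + t ^ 2 * x 0]
def fe : Fin 3 → K := ![1, 0, 0]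
def fh : Fin 3 → K := ![0, 1, 0]
def ff : Fin 3 → K := ![0, 0, 1]
structure IsML (S : Finset P) (φ : (P → Fin 3 → K) → K) : Prop where
  indep : ∀ p ∉ S, ∀ v x, φ (update v p x) = φ v
  lin : ∀ p ∈ S, ∀ v x y (c : K), φ (update v p (c • x + y)) =
    c * φ (update v p x) + φ (update v p y)
def UInv (φ : (P → Fin 3 → K) → K) : Prop := ∀ t v, φ (fun p => fU t (v p)) = φ v
def TWt (k : ℕ) (φ : (P → Fin 3 → K) → K) : Prop :=
  ∀ t, t ≠ 0 → ∀ v, t ^ k * φ (fun p => fT t (v p)) = φ v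
inductive Mon : Finset P → ℕ → ((P → Fin 3 → K) → K) → Prop
  | one : Mon ∅ 0 (fun _ => 1)
  | dot {S k m} (p q : P) (S' : Finset P) (hS : S' = insert p (insert q S))
      (hpq : p ≠ q) (hp : p ∉ S) (hq : q ∉ S) (h : Mon S k m) :
      Mon S' k (fun v => fB (v p) (v q) * m v)
  | tri {S k m} (p q r : P) (S' : Finset P) (hS : S' = insert p (insert q (insert r S)))
      (hpq : p ≠ q) (hpr : p ≠ r) (hqr : q ≠ r) (hp : p ∉ S) (hq : q ∉ S) (hr : r ∉ S)
      (h : Mon S k m) :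
      Mon S' k (fun v => fTri (v p) (v q) (v r) * m v)
  | q1 {S k m} (p : P) (S' : Finset P) (hS : S' = insert p S) (hp : p ∉ S) (h : Mon S k m) :
      Mon S' (k + 1) (fun v => v p 2 * m v)
  | q2 {S k m} (p q : P) (S' : Finset P) (hS : S' = insert p (insert q S))
      (hpq : p ≠ q) (hp : p ∉ S) (hq : q ∉ S) (h : Mon S k m) :
      Mon S' (k + 1) (fun v => fQ2 (v p) (v q) * m v)
def MonSpan (S : Finset P) (k : ℕ) : Submodule K ((P → Fin 3 → K) → K) :=
  span K {m | Mon S k m}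
theorem Mon.indep {S : Finset P} {k} {m : (P → Fin 3 → K) → K} (h : Mon S k m) :
    ∀ p ∉ S, ∀ v x, m (update v p x) = m v := by
  induction h with
  | one => intros; rfl
  | dot p q S' hS hpq hp hq h ih =>
    subst hS; intro r hr v x
    simp only [mem_insert, not_or] at hr
    simp [uN hr.1, uN hr.2.1,
      ih r hr.2.2]
  | tri p q r S' hS hpq hpr hqr hp hq hr h ih =>
    subst hS; intro s hs v x
    simp only [mem_insert, not_or] at hs
    simp [uN hs.1, uN hs.2.1,
      uN hs.2.2.1, ih s hs.2.2.2]
  | q1 p S' hS hp h ih =>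
    subst hS; intro r hr v x
    simp only [mem_insert, not_or] at hr
    simp [uN hr.1, ih r hr.2]
  | q2 p q S' hS hpq hp hq h ih =>
    subst hS; intro r hr v x
    simp only [mem_insert, not_or] at hr
    simp [uN hr.1, uN hr.2.1,
      ih r hr.2.2]
theorem Mon.lin {S : Finset P} {k} {m : (P → Fin 3 → K) → K} (h : Mon S k m) :
    ∀ p ∈ S, ∀ v x y (c : K), m (update v p (c • x + y)) =
    c * m (update v p x) + m (update v p y) := by
  induction h with
  | one => intro p hp; simp at hp
  | dot p q S' hS hpq hp hq h ih =>
    subst hS; intro r hr v x y c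
    by_cases h1 : r = p
    · subst h1
      simp [update_of_ne hpq.symm, h.indep r hp, fB]; ring
    by_cases h2 : r = q
    · subst h2
      simp [update_of_ne hpq, h.indep r hq, fB]; ring
    simp only [mem_insert, h1, h2, false_or] at hr
    simp only [uN h1, uN h2,
      ih r hr v x y c]; ring
  | tri p q r S' hS hpq hpr hqr hp hq hr h ih =>
    subst hS; intro s hs v x y c
    by_cases h1 : s = p
    · subst h1
      simp [update_of_ne hpq.symm, update_of_ne hpr.symm, h.indep s hp, fTri]
      ring
    by_cases h2 : s = q
    · subst h2
      simp [update_of_ne hpq, update_of_ne hqr.symm, h.indep s hq, fTri]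
      ring
    by_cases h3 : s = r
    · subst h3
      simp [update_of_ne hpr, update_of_ne hqr, h.indep s hr, fTri]
      ring
    simp only [mem_insert, h1, h2, h3, false_or] at hs
    simp only [uN h1, uN h2,
      uN h3, ih s hs v x y c]; ring
  | q1 p S' hS hp h ih =>
    subst hS; intro r hr v x y c
    by_cases h1 : r = p
    · subst h1
      simp [h.indep r hp]; ring
    simp only [mem_insert, h1, false_or] at hr
    simp only [uN h1, ih r hr v x y c]; ring
  | q2 p q S' hS hpq hp hq h ih =>
    subst hS; intro r hr v x y c
    by_cases h1 : r = p
    · subst h1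
      simp [update_of_ne hpq.symm, h.indep r hp, fQ2]; ring
    by_cases h2 : r = q
    · subst h2
      simp [update_of_ne hpq, h.indep r hq, fQ2]; ring
    simp only [mem_insert, h1, h2, false_or] at hr
    simp only [uN h1, uN h2,
      ih r hr v x y c]; ring
theorem Mon.isML {S : Finset P} {k} {m : (P → Fin 3 → K) → K} (h : Mon S k m) : IsML S m :=
  ⟨h.indep, h.lin⟩
theorem Mon.uInv (h3 : (3 : K) = 0) {S : Finset P} {k} {m : (P → Fin 3 → K) → K}
    (h : Mon S k m) : UInv m := by
  induction h with
  | one => intro t v; rfl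
  | dot p q S' hS hpq hp hq h ih =>
    intro t v
    simp only [ih t v]; congr 1
    simp [fB, fU]; linear_combination -t ^ 2 * v p 2 * v q 2 * h3
  | tri p q r S' hS hpq hpr hqr hp hq hr h ih =>
    intro t v
    simp only [ih t v]; congr 1
    simp [fTri, fU]; ring
  | q1 p S' hS hp h ih =>
    intro t v
    simp only [ih t v]; congr 1
  | q2 p q S' hS hpq hp hq h ih =>
    intro t v
    simp only [ih t v]; congr 1
    simp [fQ2, fU]; ring
theorem Mon.tWt {S : Finset P} {k} {m : (P → Fin 3 → K) → K}
    (h : Mon S k m) : TWt k m := by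
  induction h with
  | one => intro t ht v; simp
  | dot p q S' hS hpq hp hq h ih =>
    intro t ht v
    simp only [← ih t ht v]
    have : fB (fT t (v p)) (fT t (v q)) = fB (v p) (v q) := by
      simp [fB, fT]; field_simp
    rw [this]; ring
  | tri p q r S' hS hpq hpr hqr hp hq hr h ih =>
    intro t ht v
    simp only [← ih t ht v]
    have : fTri (fT t (v p)) (fT t (v q)) (fT t (v r)) = fTri (v p) (v q) (v r) := by
      simp [fTri, fT]; field_simp
    rw [this]; ring
  | q1 p S' hS hp h ih =>
    intro t ht v
    simp only [← ih t ht v]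
    simp [fT]; field_simp; ring
  | q2 p q S' hS hpq hp hq h ih =>
    intro t ht v
    simp only [← ih t ht v]
    have : t * fQ2 (fT t (v p)) (fT t (v q)) = fQ2 (v p) (v q) := by
      simp [fQ2, fT]; field_simp
    rw [← this]; ring
theorem isML_sub {S : Finset P} {φ ψ : (P → Fin 3 → K) → K} (h1 : IsML S φ) (h2 : IsML S ψ) :
    IsML S (φ - ψ) := by
  constructor
  · intro p hp v x; simp [h1.indep p hp, h2.indep p hp]
  · intro p hp v x y c; simp [h1.lin p hp, h2.lin p hp]; ring
theorem uInv_sub {φ ψ : (P → Fin 3 → K) → K} (h1 : UInv φ) (h2 : UInv ψ) :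
    UInv (φ - ψ) := by
  intro t v; simp [h1 t v, h2 t v]
theorem tWt_sub {k} {φ ψ : (P → Fin 3 → K) → K} (h1 : TWt k φ) (h2 : TWt k ψ) :
    TWt k (φ - ψ) := by
  intro t ht v; simp [← h1 t ht v, ← h2 t ht v]; ring
theorem monSpan_props (h3 : (3 : K) = 0) {S : Finset P} {k} {φ : (P → Fin 3 → K) → K}
    (h : φ ∈ MonSpan S k) : IsML S φ ∧ UInv φ ∧ TWt k φ := by
  induction h using span_induction with
  | mem m hm => exact ⟨hm.isML, hm.uInv h3, hm.tWt⟩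
  | zero =>
    refine ⟨⟨?_, ?_⟩, ?_, ?_⟩
    · intros; rfl
    · intros; simp
    · intro t v; rfl
    · intro t ht v; simp
  | add x y _ _ hx hy =>
    refine ⟨⟨?_, ?_⟩, ?_, ?_⟩
    · intro p hp v z; simp [hx.1.indep p hp, hy.1.indep p hp]
    · intro p hp v z w c; simp [hx.1.lin p hp, hy.1.lin p hp]; ring
    · intro t v; simp [hx.2.1 t v, hy.2.1 t v]
    · intro t ht v; simp [← hx.2.2 t ht v, ← hy.2.2 t ht v]; ring
  | smul a x _ hx =>
    refine ⟨⟨?_, ?_⟩, ?_, ?_⟩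
    · intro p hp v z; simp [hx.1.indep p hp]
    · intro p hp v z w c; simp [hx.1.lin p hp]; ring
    · intro t v; simp [hx.2.1 t v]
    · intro t ht v; simp [← hx.2.2 t ht v]; ring
theorem monSpan_map {S S' : Finset P} {k k' : ℕ} (g : (P → Fin 3 → K) → K)
    (hg : ∀ m, Mon S k m → (fun v => g v * m v) ∈ MonSpan (K := K) S' k')
    {φ : (P → Fin 3 → K) → K} (h : φ ∈ MonSpan S k) : (fun v => g v * φ v) ∈ MonSpan S' k' := by
  induction h using span_induction with
  | mem m hm => exact hg m hm
  | zero => convert Submodule.zero_mem _; simp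
  | add x y _ _ hx hy => convert Submodule.add_mem _ hx hy using 1; ext v; simp; ring
  | smul a x _ hx => convert smul_mem _ a hx using 1; ext v; simp; ring
theorem Mon.lift1 {S : Finset P} {k} {m : (P → Fin 3 → K) → K} (h : Mon S (k + 1) m)
    (a : P) (ha : a ∉ S) :
    ∃ ψ ∈ MonSpan (K := K) (insert a S) k, ∀ v, ψ (update v a fe) = m v := by
  generalize hk : k + 1 = k' at h
  induction h generalizing k with
  | one => omega
  | @dot S k1 m p q S' hS hpq hp hq h ih =>
    subst hS
    simp only [mem_insert, not_or] at ha
    obtain ⟨ψ, hψ, he⟩ := ih ha.2.2 hk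
    refine ⟨fun v => fB (v p) (v q) * ψ v, ?_, ?_⟩
    · refine monSpan_map (fun v => fB (v p) (v q)) ?_ hψ
      intro m' hm'
      refine subset_span (Mon.dot p q _ ?_ hpq ?_ ?_ hm')
      · ext x; simp only [mem_insert]; tauto
      · simp [hp, Ne.symm ha.1]
      · simp [hq, Ne.symm ha.2.1]
    · intro v
      simp [uN ha.1, uN ha.2.1, he]
  | @tri S k1 m p q r S' hS hpq hpr hqr hp hq hr h ih =>
    subst hS
    simp only [mem_insert, not_or] at ha
    obtain ⟨ψ, hψ, he⟩ := ih ha.2.2.2 hk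
    refine ⟨fun v => fTri (v p) (v q) (v r) * ψ v, ?_, ?_⟩
    · refine monSpan_map (fun v => fTri (v p) (v q) (v r)) ?_ hψ
      intro m' hm'
      refine subset_span (Mon.tri p q r _ ?_ hpq hpr hqr ?_ ?_ ?_ hm')
      · ext x; simp only [mem_insert]; tauto
      · simp [hp, Ne.symm ha.1]
      · simp [hq, Ne.symm ha.2.1]
      · simp [hr, Ne.symm ha.2.2.1]
    · intro v
      simp [uN ha.1, uN ha.2.1,
        uN ha.2.2.1, he]
  | @q1 S k1 m p S' hS hp h ih =>
    subst hS
    simp only [mem_insert, not_or] at ha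
    have hk1 : k1 = k := by omega
    subst hk1
    refine ⟨-(fun v => fB (v a) (v p) * m v), ?_, ?_⟩
    · refine Submodule.neg_mem _ (subset_span (Mon.dot a p _ rfl ha.1 ha.2 hp h))
    · intro v
      simp [uN ha.1, fB, fe, h.indep a ha.2]
  | @q2 S k1 m p q S' hS hpq hp hq h ih =>
    subst hS
    simp only [mem_insert, not_or] at ha
    have hk1 : k1 = k := by omega
    subst hk1
    refine ⟨(fun v => fTri (v a) (v p) (v q) * m v), ?_, ?_⟩
    · exact (subset_span (Mon.tri a p q _ rfl ha.1 ha.2.1 hpq ha.2.2 hp hq h))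
    · intro v
      simp [uN ha.1, uN ha.2.1, fTri, fe,
        h.indep a ha.2.2, fQ2]
theorem Mon.lift2 {S : Finset P} {k} {m : (P → Fin 3 → K) → K} (h : Mon S (k + 1) m)
    (a : P) (ha : a ∉ S) :
    ∃ ψ ∈ MonSpan (K := K) (insert a S) (k + 1), (∀ v, ψ (update v a fe) = 0) ∧
      ∀ v, ψ (update v a fh) = m v := by
  generalize hk : k + 1 = k' at h ⊢
  induction h generalizing k with
  | one => omega
  | @dot S k1 m p q S' hS hpq hp hq h ih =>
    subst hS
    simp only [mem_insert, not_or] at ha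
    obtain ⟨ψ, hψ, he, hh⟩ := ih ha.2.2 hk
    refine ⟨fun v => fB (v p) (v q) * ψ v, ?_, ?_, ?_⟩
    · refine monSpan_map (fun v => fB (v p) (v q)) ?_ hψ
      intro m' hm'
      refine subset_span (Mon.dot p q _ ?_ hpq ?_ ?_ hm')
      · ext x; simp only [mem_insert]; tauto
      · simp [hp, Ne.symm ha.1]
      · simp [hq, Ne.symm ha.2.1]
    · intro v; simp [he]
    · intro v
      simp [uN ha.1, uN ha.2.1, hh]
  | @tri S k1 m p q r S' hS hpq hpr hqr hp hq hr h ih =>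
    subst hS
    simp only [mem_insert, not_or] at ha
    obtain ⟨ψ, hψ, he, hh⟩ := ih ha.2.2.2 hk
    refine ⟨fun v => fTri (v p) (v q) (v r) * ψ v, ?_, ?_, ?_⟩
    · refine monSpan_map (fun v => fTri (v p) (v q) (v r)) ?_ hψ
      intro m' hm'
      refine subset_span (Mon.tri p q r _ ?_ hpq hpr hqr ?_ ?_ ?_ hm')
      · ext x; simp only [mem_insert]; tauto
      · simp [hp, Ne.symm ha.1]
      · simp [hq, Ne.symm ha.2.1]
      · simp [hr, Ne.symm ha.2.2.1]
    · intro v; simp [he]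
    · intro v
      simp [uN ha.1, uN ha.2.1,
        uN ha.2.2.1, hh]
  | @q1 S k1 m p S' hS hp h ih =>
    subst hS
    simp only [mem_insert, not_or] at ha
    refine ⟨(fun v => fQ2 (v a) (v p) * m v), ?_, ?_, ?_⟩
    · exact subset_span (Mon.q2 a p _ rfl ha.1 ha.2 hp h)
    · intro v
      simp [uN ha.1, fQ2, fe]
    · intro v
      simp [uN ha.1, fQ2, fh, h.indep a ha.2]
  | @q2 S k1 m p q S' hS hpq hp hq h ih =>
    subst hS
    simp only [mem_insert, not_or] at ha
    refine ⟨(fun v => fB (v q) (v a) * (v p 2 * m v)) - (fun v => fB (v p) (v a) * (v q 2 * m v)),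
      ?_, ?_, ?_⟩
    · refine Submodule.sub_mem _ (subset_span ?_) (subset_span ?_)
      · refine Mon.dot q a _ ?_ (Ne.symm ha.2.1) ?_ ?_ (Mon.q1 p _ rfl hp h)
        · ext x; simp only [mem_insert]; tauto
        · simp [hq, hpq.symm]
        · simp [ha.1, ha.2.2]
      · refine Mon.dot p a _ ?_ (Ne.symm ha.1) ?_ ?_ (Mon.q1 q _ rfl hq h)
        · ext x; simp only [mem_insert]; tauto
        · simp [hp, hpq]
        · simp [ha.2.1, ha.2.2]
    · intro v
      simp [uN ha.1, uN ha.2.1, fB, fe]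
      ring
    · intro v
      simp [uN ha.1, uN ha.2.1, fB, fh,
        h.indep a ha.2.2, fQ2]
      ring
theorem monSpan_lift1 {S : Finset P} {k} {φ : (P → Fin 3 → K) → K} (h : φ ∈ MonSpan S (k + 1))
    (a : P) (ha : a ∉ S) :
    ∃ ψ ∈ MonSpan (K := K) (insert a S) k, ∀ v, ψ (update v a fe) = φ v := by
  induction h using span_induction with
  | mem m hm => exact Mon.lift1 hm a ha
  | zero => exact ⟨0, Submodule.zero_mem _, fun v => rfl⟩
  | add x y _ _ hx hy =>
    obtain ⟨f, hf, h1⟩ := hx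
    obtain ⟨g, hg, h2⟩ := hy
    exact ⟨f + g, Submodule.add_mem _ hf hg, fun v => by simp [h1, h2]⟩
  | smul c x _ hx =>
    obtain ⟨f, hf, h1⟩ := hx
    exact ⟨c • f, smul_mem _ c hf, fun v => by simp [h1]⟩
theorem monSpan_lift2 {S : Finset P} {k} {φ : (P → Fin 3 → K) → K} (h : φ ∈ MonSpan S (k + 1))
    (a : P) (ha : a ∉ S) :
    ∃ ψ ∈ MonSpan (K := K) (insert a S) (k + 1), (∀ v, ψ (update v a fe) = 0) ∧
      ∀ v, ψ (update v a fh) = φ v := by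
  induction h using span_induction with
  | mem m hm => exact Mon.lift2 hm a ha
  | zero => exact ⟨0, Submodule.zero_mem _, fun v => rfl, fun v => rfl⟩
  | add x y _ _ hx hy =>
    obtain ⟨f, hf, h1, h1'⟩ := hx
    obtain ⟨g, hg, h2, h2'⟩ := hy
    exact ⟨f + g, Submodule.add_mem _ hf hg, fun v => by simp [h1, h2],
      fun v => by simp [h1', h2']⟩
  | smul c x _ hx =>
    obtain ⟨f, hf, h1, h1'⟩ := hx
    exact ⟨c • f, smul_mem _ c hf, fun v => by simp [h1], fun v => by simp [h1']⟩
end FFT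
section FFT2
variable {K : Type} [Field K] {P : Type} [DecidableEq P]
theorem isML_upd {S : Finset P} {φ : (P → Fin 3 → K) → K} (h : IsML S φ) (a : P) (c : Fin 3 → K) :
    IsML (S.erase a) (fun v => φ (update v a c)) := by
  constructor
  · intro p hp v x
    by_cases hpa : p = a
    · subst hpa; simp
    · have : p ∉ S := fun h' => hp (Finset.mem_erase.2 ⟨hpa, h'⟩)
      simp only [Function.update_comm hpa, h.indep p this]
  · intro p hp v x y r
    obtain ⟨hpa, hp⟩ := Finset.mem_erase.1 hp
    simp only [Function.update_comm hpa, h.lin p hp]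
theorem isML_poly [Fintype P] {S : Finset P} {φ : (P → Fin 3 → K) → K} (h : IsML S φ)
    (x y z : P → Fin 3 → K) :
    ∃ Q : Polynomial K, ∀ s, φ (fun p => s • (s • z p + y p) + x p) = Q.eval s := by
  have key : ∀ T : Finset P, ∀ S φ, IsML (K := K) S φ → ∃ Q : Polynomial K, ∀ s : K,
      φ (fun p => if p ∈ T then s • (s • z p + y p) + x p else x p) = Q.eval s := by
    intro T
    induction T using Finset.induction_on with
    | empty => intro S φ h; exact ⟨Polynomial.C (φ x), fun s => by simp⟩
    | insert a T ha ih =>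
      intro S φ h
      obtain ⟨Q1, h1⟩ := ih _ _ (isML_upd h a (x a))
      obtain ⟨Q2, h2⟩ := ih _ _ (isML_upd h a (y a))
      obtain ⟨Q3, h3⟩ := ih _ _ (isML_upd h a (z a))
      have e : ∀ s : K, (fun p => if p ∈ insert a T then s • (s • z p + y p) + x p else x p) =
          update (fun p => if p ∈ T then s • (s • z p + y p) + x p else x p) a
            (s • (s • z a + y a) + x a) := by
        intro s; ext1 p
        by_cases hp : p = a
        · subst hp; simp
        · simp [update_of_ne hp, hp]
      by_cases haS : a ∈ S
      · refine ⟨Polynomial.X * (Polynomial.X * Q3 + Q2) + Q1, fun s => ?_⟩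
        rw [e, h.lin a haS, h.lin a haS]
        simp [← h1, ← h2, ← h3]
      · refine ⟨Q1, fun s => ?_⟩
        rw [e, h.indep a haS, ← h1, h.indep a haS]
  obtain ⟨Q, hQ⟩ := key Finset.univ S φ h
  exact ⟨Q, fun s => by rw [← hQ]; simp⟩
theorem poly_inv_const [Infinite K] (H G : Polynomial K)
    (h : ∀ s, s ≠ 0 → H.eval s = G.eval s⁻¹) (s : K) : H.eval s = H.eval 0 := by
  have hh : H * Polynomial.X ^ G.natDegree = G.reverse := by
    have : (H * Polynomial.X ^ G.natDegree - G.reverse) * Polynomial.X = 0 := by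
      apply Polynomial.funext
      intro s
      by_cases hs : s = 0
      · simp [hs]
      let _ := invertibleOfNonzero (inv_ne_zero hs)
      have e := Polynomial.eval₂_reverse_mul_pow (RingHom.id K) s⁻¹ G
      have e'' : Polynomial.eval s G.reverse * s⁻¹ ^ G.natDegree = Polynomial.eval s⁻¹ G := by
        simpa [Polynomial.eval₂_id] using e
      simp only [Polynomial.eval_mul, Polynomial.eval_sub, Polynomial.eval_pow, Polynomial.eval_X,
        h s hs, Polynomial.eval_zero, ← e'']
      have : s⁻¹ ^ G.natDegree * s ^ G.natDegree = 1 := by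
        rw [← mul_pow, inv_mul_cancel₀ hs, one_pow]
      rw [mul_assoc, this]; ring
    have := (mul_eq_zero.1 this).resolve_right Polynomial.X_ne_zero
    exact sub_eq_zero.1 this
  by_cases hH : H = 0
  · simp [hH]
  have hd := congrArg Polynomial.natDegree hh
  rw [Polynomial.natDegree_mul_X_pow _ hH] at hd
  have := Polynomial.reverse_natDegree_le G
  have h0 : H.natDegree = 0 := by omega
  rw [Polynomial.eq_C_of_natDegree_eq_zero h0]; simp
theorem lemmaZ [Infinite K] [Fintype P] (h3 : (3 : K) = 0) {S : Finset P}
    {φ : (P → Fin 3 → K) → K} (h : IsML S φ) (hU : UInv φ) (hT : TWt 0 φ) (s : K)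
    (v : P → Fin 3 → K) : φ (fun p => fL s (v p)) = φ v := by
  obtain ⟨H, hH⟩ := isML_poly h v (fun p => ![0, - v p 0, v p 1]) (fun p => ![0, 0, v p 0])
  obtain ⟨G, hG⟩ := isML_poly h (fun p => ![v p 2, - v p 1, v p 0])
    (fun p => ![0, v p 2, v p 1]) (fun p => ![0, 0, v p 2])
  have eH : ∀ s, φ (fun p => fL s (v p)) = H.eval s := by
    intro s
    rw [← hH]; congr 1; ext p i; fin_cases i <;> simp [fL] <;> ring
  have eG : ∀ s, φ (fun p => fW (fU s (v p))) = G.eval s := by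
    intro s
    rw [← hG]; congr 1; ext p i; fin_cases i <;> simp [fW, fU] <;> ring
  have := poly_inv_const H G (fun s hs => ?_) s
  · rw [eH, this, ← eH]; congr 1; ext p i; fin_cases i <;> simp [fL]
  rw [← eH, ← eG, ← hT (s⁻¹ ^ 2) (pow_ne_zero _ (inv_ne_zero hs)) (fun p => fW (fU s⁻¹ (v p))),
    ← hU s⁻¹ (fun p => fT (s⁻¹ ^ 2) (fW (fU s⁻¹ (v p))))]
  simp only [pow_zero, one_mul]
  congr 1; ext p i
  fin_cases i <;> simp [fL, fU, fT, fW] <;> field_simp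
  · linear_combination -v p 2 * h3
  · linear_combination s * v p 1 * h3
  · linear_combination (0 : K) * h3
theorem isML_decomp {S : Finset P} {φ : (P → Fin 3 → K) → K} (h : IsML S φ) (a : P) (ha : a ∈ S)
    (w : P → Fin 3 → K) (x : Fin 3 → K) :
    φ (update w a x) = x 0 * φ (update w a fe) +
      x 1 * φ (update w a fh) + x 2 * φ (update w a ff) := by
  have h0 : φ (update w a 0) = 0 := by
    have := h.lin a ha w 0 0 1; simp at this; exact this
  have e : x = x 0 • fe + (x 1 • fh + (x 2 • ff + 0)) := by
    ext i; fin_cases i <;> simp [fe, fh, ff]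
  conv_lhs => rw [e]
  rw [h.lin a ha, h.lin a ha, h.lin a ha, h0]; ring
theorem map_upd (g : (Fin 3 → K) → (Fin 3 → K)) (v : P → Fin 3 → K) (a : P) (c : Fin 3 → K) :
    (fun p => g (update v a c p)) = update (fun p => g (v p)) a (g c) := by
  ext1 p
  by_cases hp : p = a
  · subst hp; simp
  · simp [update_of_ne hp]
theorem fft_core [Infinite K] [Fintype P] (h3 : (3 : K) = 0) (S : Finset P) :
    ∀ (k : ℕ) (φ : (P → Fin 3 → K) → K), IsML S φ → UInv φ → TWt k φ → φ ∈ MonSpan S k := by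
  induction S using Finset.induction_on with
  | empty =>
    intro k φ h hU hT
    have hc : ∀ v, φ v = φ 0 := by
      intro v
      have key : ∀ T : Finset P, φ (fun p => if p ∈ T then v p else 0) = φ 0 := by
        intro T
        induction T using Finset.induction_on with
        | empty => simp; rfl
        | insert a T ha ih =>
          rw [← ih, ← h.indep a (by simp) (fun p => if p ∈ T then v p else 0) (v a)]
          congr 1; ext1 p
          by_cases hp : p = a
          · subst hp; simp
          · simp [update_of_ne hp, hp]
      simpa using key Finset.univ
    by_cases hk : k = 0
    · subst hk
      have : φ = φ 0 • (fun _ => 1) := by ext v; simp [hc v]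
      rw [this]
      exact smul_mem _ _ (subset_span Mon.one)
    · have h0 : φ = 0 := by
        by_contra hne
        have hne : φ 0 ≠ 0 := fun h => hne (by ext v; simp [hc v, h])
        have hone : ∀ t : K, t ≠ 0 → t ^ k = 1 := by
          intro t ht
          have := hT t ht 0
          rw [hc] at this
          exact mul_right_cancel₀ hne (by rw [this, one_mul])
        have hp : (Polynomial.X ^ k - 1 : Polynomial K) * Polynomial.X = 0 := by
          apply Polynomial.funext
          intro s
          by_cases hs : s = 0
          · simp [hs]
          · simp [hone s hs]
        have := (mul_eq_zero.1 hp).resolve_right Polynomial.X_ne_zero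
        exact Polynomial.X_pow_sub_C_ne_zero (Nat.pos_of_ne_zero hk) (1 : K) (by simpa using this)
      rw [h0]; exact Submodule.zero_mem _
  | insert a S ha ih =>
    intro k φ h hU hT
    have hmem : a ∈ insert a S := by simp
    have hML : ∀ {χ : (P → Fin 3 → K) → K}, IsML (insert a S) χ → ∀ c : Fin 3 → K,
        IsML S (fun v => χ (update v a c)) := by
      intro χ hχ c
      have := isML_upd hχ a c
      rwa [Finset.erase_insert ha] at this
    obtain ⟨ψ, hψ, hψe⟩ := monSpan_lift1 (ih (k + 1) _ (hML h fe) (by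
        intro t v
        simp only
        rw [← hU t (update v a fe), map_upd]
        congr 2; ext i; fin_cases i <;> simp [fU, fe]) (by
        intro t ht v
        simp only
        rw [← hT t ht (update v a fe), map_upd, isML_decomp h a hmem _ (fT t fe)]
        simp [fT, fe]; ring)) a ha
    obtain ⟨pM, pU, pT⟩ := monSpan_props h3 hψ
    suffices hs : φ - ψ ∈ MonSpan (K := K) (insert a S) k by
      have := Submodule.add_mem _ hs hψ; simpa using this
    have cM := isML_sub h pM
    have cU := uInv_sub hU pU
    have cT := tWt_sub hT pT
    have ce : ∀ v, (φ - ψ) (update v a fe) = 0 := by intro v; simp [hψe]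
    generalize φ - ψ = χ at cM cU cT ce ⊢
    clear hψ hψe pM pU pT h hU hT
    rcases k with _ | k
    · have hz : ∀ v, χ v = 0 := by
        have e1 : ∀ s v, - s * χ (update v a fh) +
            s ^ 2 * χ (update v a ff) = 0 := by
          intro s v
          have := lemmaZ h3 cM cU cT s (update (fun p => fL (-s) (v p)) a fe)
          rw [map_upd, ce] at this
          have e : (fun p => fL s (fL (-s) (v p))) = v := by
            ext p i; fin_cases i <;> simp [fL]
            linear_combination s ^ 2 * v p 0 * h3
          rw [e, isML_decomp cM a hmem, ce] at this
          simpa [fL, fe] using this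
        intro v
        have a1 := e1 1 v
        have a2 := e1 (-1) v
        have hh : χ (update v a fh) = 0 := by
          linear_combination -a2 + a1 + χ (update v a fh) * h3
        have hf : χ (update v a ff) = 0 := by
          linear_combination a1 + hh
        have := isML_decomp cM a hmem v (v a)
        rw [Function.update_eq_self] at this
        rw [this, hh, hf, ce]; simp
      have : χ = 0 := by ext v; exact hz v
      rw [this]; exact Submodule.zero_mem _
    · obtain ⟨ψ, hψ, hψe, hψh⟩ := monSpan_lift2 (ih (k + 1) _ (hML cM fh) (by
          intro t v
          simp only
          rw [← cU t (update v a fh), map_upd, isML_decomp cM a hmem _ (fU t fh), ce]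
          simp [fU, fh]) (by
          intro t ht v
          simp only
          rw [← cT t ht (update v a fh), map_upd, isML_decomp cM a hmem _ (fT t fh)]
          simp [fT, fh])) a ha
      obtain ⟨pM, pU, pT⟩ := monSpan_props h3 hψ
      suffices hs : χ - ψ ∈ MonSpan (K := K) (insert a S) (k + 1) by
        have := Submodule.add_mem _ hs hψ; simpa using this
      have dM := isML_sub cM pM
      have dU := uInv_sub cU pU
      have dT := tWt_sub cT pT
      have de : ∀ v, (χ - ψ) (update v a fe) = 0 := by intro v; simp [hψe, ce]
      have dh : ∀ v, (χ - ψ) (update v a fh) = 0 := by intro v; simp [hψh]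
      generalize χ - ψ = χ at dM dU dT de dh ⊢
      have key := ih k _ (hML dM ff) (by
          intro t v
          simp only
          rw [← dU t (update v a ff), map_upd, isML_decomp dM a hmem _ (fU t ff), de, dh]
          simp [fU, ff]) (by
          intro t ht v
          simp only
          rw [← dT t ht (update v a ff), map_upd, isML_decomp dM a hmem _ (fT t ff), de,
            dh]
          simp [fT, ff]; field_simp; ring)
      have e : χ = fun v => v a 2 * χ (update v a ff) := by
        ext v
        have := isML_decomp dM a hmem v (v a)
        rw [Function.update_eq_self, de, dh] at this
        rw [this]; simp
      rw [e]
      refine monSpan_map (fun v => v a 2) ?_ key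
      intro m hm
      exact subset_span (Mon.q1 a _ rfl ha hm)
end FFT2
section FFT3
variable {K : Type} [Field K] {P : Type} [DecidableEq P]
def IsMatch (S : Finset P) (σ : Perm P) : Prop :=
  (∀ p, σ (σ p) = p) ∧ ∀ p, σ p ≠ p ↔ p ∈ S
inductive DotM : Finset P → ((P → Fin 3 → K) → K) → Prop
  | one : DotM ∅ (fun _ => 1)
  | dot {S m} (p q : P) (S' : Finset P) (hS : S' = insert p (insert q S))
      (hpq : p ≠ q) (hp : p ∉ S) (hq : q ∉ S) (h : DotM S m) :
      DotM S' (fun v => fB (v p) (v q) * m v)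
def TriM (S' : Finset P) (f : (P → Fin 3 → K) → K) : Prop :=
  ∃ S m p q r, S' = insert p (insert q (insert r S)) ∧ p ≠ q ∧ p ≠ r ∧ q ≠ r ∧ p ∉ S ∧ q ∉ S ∧
    r ∉ S ∧ DotM S m ∧ f = fun v => fTri (v p) (v q) (v r) * m v
theorem span_map {A : Type*} (X Y : Set (A → K)) (g : A → K)
    (hg : ∀ m ∈ X, (fun v => g v * m v) ∈ span K Y)
    {φ : A → K} (h : φ ∈ span K X) : (fun v => g v * φ v) ∈ span K Y := by
  induction h using span_induction with
  | mem m hm => exact hg m hm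
  | zero => convert Submodule.zero_mem _; simp
  | add x y _ _ hx hy => convert Submodule.add_mem _ hx hy using 1; ext v; simp; ring
  | smul a x _ hx => convert smul_mem _ a hx using 1; ext v; simp; ring
theorem fTri_gram (x y z a b c : Fin 3 → K) : fTri x y z * fTri a b c =
    fB x a * (fB y b * fB z c) - fB x a * (fB y c * fB z b) - fB x b * (fB y a * fB z c) +
    fB x b * (fB y c * fB z a) + fB x c * (fB y a * fB z b) - fB x c * (fB y b * fB z a) := by
  simp only [fTri, fB]; ring
theorem dot3 {S : Finset P} {m : (P → Fin 3 → K) → K} (h : DotM S m) {p q r a b c : P}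
    (S' : Finset P)
    (hS : S' = insert p (insert q (insert r (insert a (insert b (insert c S))))))
    (hn : [p, q, r, a, b, c].Nodup) (hp : p ∉ S) (hq : q ∉ S) (hr : r ∉ S) (ha : a ∉ S)
    (hb : b ∉ S) (hc : c ∉ S) :
    DotM S' (fun v => fB (v p) (v a) * (fB (v q) (v b) * (fB (v r) (v c) * m v))) := by
  simp only [List.nodup_cons, List.mem_cons, List.not_mem_nil, or_false, not_or] at hn
  obtain ⟨h1, h2, h3, h4, h5, -⟩ := hn
  refine DotM.dot p a _ ?_ h1.2.2.1 ?_ ?_ (DotM.dot q b _ rfl h2.2.2.1 ?_ ?_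
    (DotM.dot r c _ rfl h3.2.2 hr hc h))
  · rw [hS]; ext x; simp only [mem_insert]; apply iff_of_eq; ac_rfl
  all_goals simp only [mem_insert, not_or]; grind
set_option maxHeartbeats 1000000 in
theorem mon_red {S : Finset P} {k} {m : (P → Fin 3 → K) → K} (h : Mon S k m) (hk : k = 0) :
    (Even S.card → m ∈ span K {f | DotM S f}) ∧
    (¬ Even S.card → m ∈ span K {f | TriM S f}) := by
  induction h with
  | one => exact ⟨fun _ => subset_span DotM.one, fun h => absurd (by simp) h⟩
  | @dot S k1 m p q S' hS hpq hp hq h ih =>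
    subst hS
    obtain ⟨i1, i2⟩ := ih hk
    have hc : (insert p (insert q S)).card = S.card + 2 := by
      rw [Finset.card_insert_of_notMem (by simp [hpq, hp]), Finset.card_insert_of_notMem hq]
    rw [hc]
    refine ⟨fun he => ?_, fun he => ?_⟩
    · refine span_map _ _ (fun v => fB (v p) (v q)) (fun f hf => ?_) (i1 (by simpa [Nat.even_add] using he))
      exact subset_span (DotM.dot p q _ rfl hpq hp hq hf)
    · refine span_map _ _ (fun v => fB (v p) (v q)) (fun f hf => ?_)
        (i2 (by simpa [Nat.even_add] using he))
      obtain ⟨T, n, a, b, c, hT, hab, hac, hbc, ha, hb, hcc, hn, rfl⟩ := hf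
      subst hT
      simp only [mem_insert, not_or] at hp hq
      refine subset_span ⟨_, _, a, b, c, ?_, hab, hac, hbc, ?_, ?_, ?_,
        DotM.dot p q _ rfl hpq hp.2.2.2 hq.2.2.2 hn, ?_⟩
      · ext x; simp only [mem_insert]; apply iff_of_eq; ac_rfl
      · simp only [mem_insert, not_or]; exact ⟨Ne.symm hp.1, Ne.symm hq.1, ha⟩
      · simp only [mem_insert, not_or]; exact ⟨Ne.symm hp.2.1, Ne.symm hq.2.1, hb⟩
      · simp only [mem_insert, not_or]; exact ⟨Ne.symm hp.2.2.1, Ne.symm hq.2.2.1, hcc⟩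
      · ext v; simp only; ring
  | @tri S k1 m p q r S' hS hpq hpr hqr hp hq hr h ih =>
    subst hS
    obtain ⟨i1, i2⟩ := ih hk
    have hc : (insert p (insert q (insert r S))).card = S.card + 3 := by
      rw [Finset.card_insert_of_notMem (by simp [hpq, hpr, hp]),
        Finset.card_insert_of_notMem (by simp [hqr, hq]), Finset.card_insert_of_notMem hr]
    rw [hc]
    refine ⟨fun he => ?_, fun he => ?_⟩
    · refine span_map _ _ (fun v => fTri (v p) (v q) (v r)) (fun f hf => ?_)
        (i2 (by simpa [Nat.even_add, (by decide : ¬ Even 3)] using he))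
      obtain ⟨T, n, a, b, c, hT, hab, hac, hbc, ha, hb, hcc, hn, rfl⟩ := hf
      subst hT
      simp only [mem_insert, not_or] at hp hq hr
      have H : ∀ a' b' c', [a', b', c'].Perm [a, b, c] →
          (fun v => fB (v p) (v a') * (fB (v q) (v b') * (fB (v r) (v c') * n v))) ∈
          span K {f | DotM (insert p (insert q (insert r (insert a (insert b
            (insert c T)))))) f} := by
        intro a' b' c' hperm
        have hmem : ∀ x, x ∈ [a', b', c'] ↔ x ∈ [a, b, c] := fun x => hperm.mem_iff
        simp only [List.mem_cons, List.not_mem_nil, or_false] at hmem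
        apply subset_span
        rw [Set.mem_setOf_eq]
        refine dot3 (p := p) (q := q) (r := r) (a := a') (b := b') (c := c') hn _ ?_ ?_ hp.2.2.2
          hq.2.2.2 hr.2.2.2 ?_ ?_ ?_
        · ext x; simp only [mem_insert]
          rw [show (x = a ∨ x = b ∨ x = c ∨ x ∈ T) ↔ (x = a ∨ x = b ∨ x = c) ∨ x ∈ T by
            simp only [or_assoc], ← hmem x]
          simp only [or_assoc]
        · refine ((List.Perm.append_left [p, q, r] hperm).nodup_iff).2 ?_
          simp only [List.cons_append, List.nil_append, List.nodup_cons, List.mem_cons,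
            List.not_mem_nil, or_false, not_or, List.nodup_nil, not_false_eq_true, and_true]
          exact ⟨⟨hpq, hpr, hp.1, hp.2.1, hp.2.2.1⟩, ⟨hqr, hq.1, hq.2.1, hq.2.2.1⟩,
            ⟨hr.1, hr.2.1, hr.2.2.1⟩, ⟨hab, hac⟩, hbc⟩
        · rcases (hmem a').1 (Or.inl rfl) with h | h | h <;> rw [h] <;> assumption
        · rcases (hmem b').1 (Or.inr (Or.inl rfl)) with h | h | h <;> rw [h] <;> assumption
        · rcases (hmem c').1 (Or.inr (Or.inr rfl)) with h | h | h <;> rw [h] <;> assumption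
      have e : (fun v => fTri (v p) (v q) (v r) * (fTri (v a) (v b) (v c) * n v)) =
          (fun v => fB (v p) (v a) * (fB (v q) (v b) * (fB (v r) (v c) * n v))) -
          (fun v => fB (v p) (v a) * (fB (v q) (v c) * (fB (v r) (v b) * n v))) -
          (fun v => fB (v p) (v b) * (fB (v q) (v a) * (fB (v r) (v c) * n v))) +
          (fun v => fB (v p) (v b) * (fB (v q) (v c) * (fB (v r) (v a) * n v))) +
          (fun v => fB (v p) (v c) * (fB (v q) (v a) * (fB (v r) (v b) * n v))) -
          (fun v => fB (v p) (v c) * (fB (v q) (v b) * (fB (v r) (v a) * n v))) := by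
        ext v
        rw [← mul_assoc, fTri_gram]
        simp only [Pi.add_apply, Pi.sub_apply]; ring
      rw [e]
      refine Submodule.sub_mem _ (Submodule.add_mem _ (Submodule.add_mem _ (Submodule.sub_mem _
        (Submodule.sub_mem _ (H _ _ _ ?_) (H _ _ _ ?_)) (H _ _ _ ?_)) (H _ _ _ ?_)) (H _ _ _ ?_))
        (H _ _ _ ?_) <;> (rw [List.perm_iff_count]; intro x; simp [List.count_cons]; try omega)
    · refine span_map _ _ (fun v => fTri (v p) (v q) (v r)) (fun f hf => ?_)
        (i1 (by simpa [Nat.even_add, (by decide : ¬ Even 3)] using he))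
      exact subset_span ⟨S, f, p, q, r, rfl, hpq, hpr, hqr, hp, hq, hr, hf, rfl⟩
  | q1 p S' hS hp h ih => omega
  | q2 p q S' hS hpq hp hq h ih => omega
def fN (x : Fin 3 → K) : Fin 3 → K := ![x 0 + x 1 - x 2, x 1 - x 0, -(x 0 + x 1 + x 2)]
def fM (x : Fin 3 → K) : Fin 3 → K := ![x 0 + x 1 - x 2, x 0 - x 1 - x 2, x 0 + x 2]
theorem DotM.eval [Fintype P] (h3 : (3 : K) = 0) {S : Finset P} {m : (P → Fin 3 → K) → K} (h : DotM S m) :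
    ∃ σ, IsMatch S σ ∧ ∀ c : P → Fin 3, m (fun p => fN (Pi.single (c p) 1)) =
      if ∀ p, c (σ p) = c p then 1 else 0 := by
  induction h with
  | one => exact ⟨1, ⟨by simp, by simp⟩, by simp⟩
  | @dot S m p q S' hS hpq hp hq h ih =>
    obtain ⟨σ, hσ, hc⟩ := ih
    have sp : σ p = p := by by_contra h; exact hp ((hσ.2 p).1 h)
    have sq : σ q = q := by by_contra h; exact hq ((hσ.2 q).1 h)
    have hne : ∀ x, x ≠ p → x ≠ q → σ x ≠ p ∧ σ x ≠ q := by
      intro x h1 h2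
      exact ⟨fun h => h1 (σ.injective (h.trans sp.symm)), fun h => h2 (σ.injective (h.trans sq.symm))⟩
    have ev : ∀ x, (Equiv.swap p q * σ) x = if x = p then q else if x = q then p else σ x := by
      intro x
      simp only [Perm.mul_apply]
      split_ifs with h1 h2
      · rw [h1, sp, Equiv.swap_apply_left]
      · rw [h2, sq, Equiv.swap_apply_right]
      · exact Equiv.swap_apply_of_ne_of_ne (hne x h1 h2).1 (hne x h1 h2).2
    refine ⟨Equiv.swap p q * σ, ⟨?_, ?_⟩, ?_⟩
    · intro x
      rw [ev, ev]
      have := hne x; have := hσ.1 x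
      split_ifs <;> grind
    · intro x
      rw [ev, hS]
      have := hσ.2 x
      simp only [mem_insert]
      split_ifs <;> grind
    · intro c
      simp only [hc]
      have e : fB (fN (Pi.single (c p) (1 : K))) (fN (Pi.single (c q) 1)) =
          if c p = c q then 1 else 0 := by
        generalize c p = i
        generalize c q = j
        fin_cases i <;> fin_cases j <;> simp [fB, fN] <;>
          first | linear_combination (0 : K) * h3 | linear_combination h3 | linear_combination -h3
      rw [e]
      have : (∀ x, c ((Equiv.swap p q * σ) x) = c x) ↔ (c p = c q ∧ ∀ x, c (σ x) = c x) := by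
        constructor
        · intro h
          refine ⟨by have := h p; rw [ev] at this; simpa using this.symm, fun x => ?_⟩
          have := h x; rw [ev] at this
          split_ifs at this with h1 h2
          · rw [h1, sp]
          · rw [h2, sq]
          · exact this
        · rintro ⟨h1, h2⟩ x
          rw [ev]; split_ifs with h3 h4
          · rw [h3, h1]
          · rw [h4, h1]
          · exact h2 x
      simp only [this]
      split_ifs <;> simp_all
open Matrix in
theorem fft [Infinite K] [Fintype P] (h3 : (3 : K) = 0) (S : Finset P) (hS : Even S.card)
    (φ : (P → Fin 3 → K) → K) (h : IsML S φ)
    (hO : ∀ g : Matrix (Fin 3) (Fin 3) K, gᵀ * g = 1 → ∀ v, φ (fun p => g *ᵥ v p) = φ v) :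
    ∃ a : Perm P → K, (∀ σ, a σ ≠ 0 → IsMatch S σ) ∧
      ∀ c : P → Fin 3, φ (fun p => Pi.single (c p) 1) =
        ∑ σ, a σ * if ∀ p, c (σ p) = c p then 1 else 0 := by
  have hMN : ∀ x : Fin 3 → K, fM (fN x) = x := by
    intro x; ext i; fin_cases i <;> simp [fM, fN]
    · linear_combination x 1 * h3
    · linear_combination x 0 * h3
    · linear_combination -x 2 * h3
  have hM : IsML S (fun v => φ (fun p => fM (v p))) := by
    constructor
    · intro p hp v x
      simp only [map_upd, h.indep p hp]
    · intro p hp v x y c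
      simp only [map_upd]
      rw [← h.lin p hp]; congr 2; ext i; fin_cases i <;> simp [fM] <;> ring
  have tr : ∀ A : Matrix (Fin 3) (Fin 3) K, Aᵀ * !![0,0,1;0,1,0;1,0,0] * A =
      !![0,0,1;0,1,0;1,0,0] → ∀ v : P → Fin 3 → K, φ (fun p => fM (A *ᵥ v p)) = φ (fun p => fM (v p)) := by
    intro A hA v
    let M : Matrix (Fin 3) (Fin 3) K := !![1,1,-1;1,-1,-1;1,0,1]
    let N : Matrix (Fin 3) (Fin 3) K := !![1,1,-1;-1,1,0;-1,-1,-1]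
    have hM : ∀ x, fM x = M *ᵥ x := by
      intro x; ext i; fin_cases i <;> simp [fM, M, Matrix.mulVec, dotProduct, sum_univ_three] <;> ring
    have e1 : M * N = 1 := by
      ext i j; fin_cases i <;> fin_cases j <;> simp [M, N, mul_apply, sum_univ_three] <;>
          first | linear_combination (0 : K) * h3 | linear_combination h3 | linear_combination -h3
    have e1' : N * M = 1 := by
      exact mul_eq_one_comm.1 e1
    have e2 : Mᵀ * M = -(!![0,0,1;0,1,0;1,0,0] : Matrix (Fin 3) (Fin 3) K) := by
      ext i j; fin_cases i <;> fin_cases j <;> simp [M, mul_apply, sum_univ_three] <;>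
          first | linear_combination (0 : K) * h3 | linear_combination h3 | linear_combination -h3
    have hg : (M * A * N)ᵀ * (M * A * N) = 1 := by
      calc (M * A * N)ᵀ * (M * A * N) = Nᵀ * (Aᵀ * (Mᵀ * M) * A) * N := by
            simp only [Matrix.transpose_mul, Matrix.mul_assoc]
        _ = Nᵀ * (Mᵀ * M) * N := by rw [e2, Matrix.mul_neg, Matrix.neg_mul, hA]
        _ = (M * N)ᵀ * (M * N) := by simp only [Matrix.transpose_mul, Matrix.mul_assoc]
        _ = 1 := by rw [e1]; simp
    have := hO _ hg (fun p => fM (v p))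
    rw [← this]; congr 1; ext1 p
    simp only [hM, Matrix.mulVec_mulVec]
    rw [Matrix.mul_assoc, Matrix.mul_assoc, e1', Matrix.mul_one]
  have hU : UInv (fun v => φ (fun p => fM (v p))) := by
    intro t v
    have := tr !![1, t, t ^ 2; 0, 1, -t; 0, 0, 1] ?_ v
    · simp only
      rw [← this]; congr 2; ext1 p; congr 1
      ext i; fin_cases i <;> simp [fU, Matrix.mulVec, dotProduct, sum_univ_three] <;> ring
    · ext i j; fin_cases i <;> fin_cases j <;> simp [mul_apply, sum_univ_three] <;>
          first | linear_combination (0 : K) * h3 | linear_combination t ^ 2 * h3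
  have hT : TWt 0 (fun v => φ (fun p => fM (v p))) := by
    intro t ht v
    have := tr !![t, 0, 0; 0, 1, 0; 0, 0, t⁻¹] ?_ v
    · simp only [pow_zero, one_mul]
      rw [← this]; congr 2; ext1 p; congr 1
      ext i; fin_cases i <;> simp [fT, Matrix.mulVec, dotProduct, sum_univ_three]
    · ext i j; fin_cases i <;> fin_cases j <;>
        simp [mul_apply, sum_univ_three, ht]
  have key := fft_core h3 S 0 _ hM hU hT
  have key2 : (fun v => φ (fun p => fM (v p))) ∈ span K {f | DotM (K := K) S f} := by
    refine (span_le.2 ?_) key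
    intro m hm
    exact (mon_red hm rfl).1 hS
  have fin : ∀ ψ ∈ span K {f | DotM (K := K) S f},
      ∃ a : Perm P → K, (∀ σ, a σ ≠ 0 → IsMatch S σ) ∧
      ∀ c : P → Fin 3, ψ (fun p => fN (Pi.single (c p) 1)) =
        ∑ σ, a σ * if ∀ p, c (σ p) = c p then 1 else 0 := by
    intro ψ hψ
    induction hψ using span_induction with
    | mem m hm =>
      obtain ⟨σ, h1, h2⟩ := DotM.eval h3 hm
      refine ⟨fun τ => if τ = σ then 1 else 0, ?_, ?_⟩
      · intro τ hτ
        by_cases h : τ = σ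
        · rwa [h]
        · simp [h] at hτ
      · intro c; rw [h2]
        simp only [ite_mul, one_mul, zero_mul, Finset.sum_ite_eq', Finset.mem_univ, if_true]
    | zero => exact ⟨0, by simp, by simp⟩
    | add x y _ _ hx hy =>
      obtain ⟨a, h1, h2⟩ := hx
      obtain ⟨b, h3, h4⟩ := hy
      refine ⟨a + b, ?_, ?_⟩
      · intro σ hσ
        by_cases h : a σ = 0
        · exact h3 σ (by simpa [h] using hσ)
        · exact h1 σ h
      · intro c
        simp only [Pi.add_apply, h2, h4, add_mul, Finset.sum_add_distrib]
    | smul r x _ hx =>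
      obtain ⟨a, h1, h2⟩ := hx
      refine ⟨r • a, ?_, ?_⟩
      · intro σ hσ; exact h1 σ (fun h => hσ (by simp [h]))
      · intro c
        simp only [Pi.smul_apply, smul_eq_mul, h2, Finset.mul_sum, mul_assoc]
  obtain ⟨a, h1, h2⟩ := fin _ key2
  refine ⟨a, h1, fun c => ?_⟩
  rw [← h2 c]; congr 1; ext1 p; rw [hMN]
end FFT3
section SFT
variable {K : Type} [Field K] {P : Type} [DecidableEq P] [Fintype P]
noncomputable def rew (σ : Perm P) (i : Fin 4 ↪ P) (π : Perm (Fin 4)) : Perm P :=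
  π.viaEmbedding (i.trans σ.toEmbedding) * σ * (π.viaEmbedding (i.trans σ.toEmbedding))⁻¹
theorem via_j (σ : Perm P) (i : Fin 4 ↪ P) (π : Perm (Fin 4)) (a) :
    π.viaEmbedding (i.trans σ.toEmbedding) (σ (i a)) = σ (i (π a)) :=
  Perm.viaEmbedding_apply π (i.trans σ.toEmbedding) a
theorem via_o (σ : Perm P) (i : Fin 4 ↪ P) (π : Perm (Fin 4)) (p)
    (h : ∀ a, p ≠ σ (i a)) :
    π.viaEmbedding (i.trans σ.toEmbedding) p = p :=
  Perm.viaEmbedding_apply_of_notMem π (i.trans σ.toEmbedding) p (by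
    rintro ⟨a, rfl⟩; exact h a rfl)
variable {σ : Perm P} (hσ : ∀ p, σ (σ p) = p) {i : Fin 4 ↪ P} (hi : ∀ a b, i a ≠ σ (i b))
  (π : Perm (Fin 4))
include hσ hi
theorem rew_i (a) : rew σ i π (i a) = σ (i (π a)) := by
  have : (π.viaEmbedding (i.trans σ.toEmbedding))⁻¹ (i a) = i a := by
    rw [Perm.inv_eq_iff_eq, via_o]; exact hi a
  simp only [rew, Perm.mul_apply, this, via_j]
theorem rew_j (a) : rew σ i π (σ (i (π a))) = i a := by
  have : (π.viaEmbedding (i.trans σ.toEmbedding))⁻¹ (σ (i (π a))) = σ (i a) := by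
    rw [Perm.inv_eq_iff_eq, via_j]
  simp only [rew, Perm.mul_apply, this, hσ]
  exact via_o _ _ _ _ (hi a)
theorem rew_o (p) (h1 : ∀ a, p ≠ i a) (h2 : ∀ a, p ≠ σ (i a)) : rew σ i π p = σ p := by
  have : (π.viaEmbedding (i.trans σ.toEmbedding))⁻¹ p = p := by
    rw [Perm.inv_eq_iff_eq, via_o _ _ _ _ h2]
  simp only [rew, Perm.mul_apply, this]
  exact via_o _ _ _ _ (fun a h => h1 a (σ.injective h))
theorem rew_cases (p) : (∃ a, p = i a) ∨ (∃ a, p = σ (i (π a))) ∨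
    ((∀ a, p ≠ i a) ∧ ∀ a, p ≠ σ (i a)) := by
  by_cases h1 : ∃ a, p = i a
  · exact Or.inl h1
  by_cases h2 : ∃ a, p = σ (i a)
  · obtain ⟨a, ha⟩ := h2
    exact Or.inr (Or.inl ⟨π.symm a, by simpa using ha⟩)
  · push Not at h1 h2; exact Or.inr (Or.inr ⟨h1, h2⟩)
theorem rew_match (hσ' : ∀ p, σ p ≠ p) : IsMatch Finset.univ (rew σ i π) := by
  refine ⟨fun p => ?_, fun p => ⟨fun _ => by simp, fun _ => ?_⟩⟩
  · rcases rew_cases hσ hi π p with ⟨a, rfl⟩ | ⟨a, rfl⟩ | ⟨h1, h2⟩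
    · rw [rew_i hσ hi, rew_j hσ hi]
    · rw [rew_j hσ hi, rew_i hσ hi]
    · rw [rew_o hσ hi π p h1 h2, rew_o hσ hi, hσ]
      · intro a h; exact h2 a (by rw [← h, hσ])
      · intro a h; exact h1 a (σ.injective h)
  · rcases rew_cases hσ hi π p with ⟨a, rfl⟩ | ⟨a, rfl⟩ | ⟨h1, h2⟩
    · rw [rew_i hσ hi]; exact (hi _ _).symm
    · rw [rew_j hσ hi]; exact hi _ _
    · rw [rew_o hσ hi π p h1 h2]; exact hσ' p
theorem rew_mono (c : P → Fin 3) : (∀ p, c (rew σ i π p) = c p) ↔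
    ((∀ a, c (i a) = c (σ (i (π a)))) ∧ ∀ p, (∀ a, p ≠ i a) → (∀ a, p ≠ σ (i a)) →
      c (σ p) = c p) := by
  constructor
  · intro h
    refine ⟨fun a => ?_, fun p h1 h2 => ?_⟩
    · rw [← rew_i hσ hi, h]
    · rw [← rew_o hσ hi π p h1 h2, h]
  · rintro ⟨h1, h2⟩ p
    rcases rew_cases hσ hi π p with ⟨a, rfl⟩ | ⟨a, rfl⟩ | ⟨h3, h4⟩
    · rw [rew_i hσ hi, h1]
    · rw [rew_j hσ hi, h1]
    · rw [rew_o hσ hi π p h3 h4, h2 p h3 h4]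
theorem gram_delta (h2 : (2 : K) ≠ 0) (c : P → Fin 3) :
    ∑ π : Perm (Fin 4), ((Perm.sign π : ℤ) : K) *
      (if ∀ p, c (rew σ i π p) = c p then 1 else 0) = 0 := by
  obtain ⟨a, b, hab, hc⟩ := Fintype.exists_ne_map_eq_of_card_lt (fun a => c (i a)) (by simp)
  have key : ∑ π : Perm (Fin 4), ((Perm.sign π : ℤ) : K) *
      (if ∀ p, c (rew σ i π p) = c p then 1 else 0) =
      -∑ π : Perm (Fin 4), ((Perm.sign π : ℤ) : K) *
      (if ∀ p, c (rew σ i π p) = c p then 1 else 0) := by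
    rw [← Finset.sum_neg_distrib]
    refine Fintype.sum_equiv (Equiv.mulRight (Equiv.swap a b)) _ _ (fun π => ?_)
    have e : (∀ p, c (rew σ i (π * Equiv.swap a b) p) = c p) ↔ ∀ p, c (rew σ i π p) = c p := by
      rw [rew_mono hσ hi, rew_mono hσ hi]
      refine and_congr_left fun _ => ?_
      have sw : ∀ x, c (i (Equiv.swap a b x)) = c (i x) := by
        intro x
        rcases eq_or_ne x a with rfl | h1
        · rw [Equiv.swap_apply_left]; exact hc.symm
        rcases eq_or_ne x b with rfl | h2
        · rw [Equiv.swap_apply_right]; exact hc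
        rw [Equiv.swap_apply_of_ne_of_ne h1 h2]
      constructor
      · intro h x
        have := h (Equiv.swap a b x)
        rw [sw] at this; simpa using this
      · intro h x
        rw [← sw]; exact h _
    simp only [Equiv.coe_mulRight, e, Perm.sign_mul, Perm.sign_swap hab]
    split_ifs <;> simp
  have := eq_neg_iff_add_eq_zero.1 key
  rw [← two_mul] at this
  exact (mul_eq_zero.1 this).resolve_left h2
end SFT
section SFT2
variable {K : Type} [Field K] {P : Type} [DecidableEq P] [Fintype P]
def Chn (r : P → ℕ) (σ : Perm P) (a b : P) : Prop :=
  r a < r b ∧ r (σ a) < r (σ b) ∧ r a < r (σ a) ∧ r b < r (σ b)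
def Good (r : P → ℕ) (σ : Perm P) : Prop :=
  ¬ ∃ a b c d, Chn r σ a b ∧ Chn r σ b c ∧ Chn r σ c d
def LexLt (r : P → ℕ) (σ τ : Perm P) : Prop :=
  ∃ p, (∀ q, r q < r p → σ q = τ q) ∧ r (σ p) < r (τ p)
theorem LexLt.trans {r : P → ℕ} (hr : Function.Injective r) (a b c : Perm P) :
    LexLt r a b → LexLt r b c → LexLt r a c := by
  rintro ⟨p, h1, h2⟩ ⟨q, h3, h4⟩
  rcases lt_trichotomy (r p) (r q) with h | h | h
  · exact ⟨p, fun x hx => (h1 x hx).trans (h3 x (hx.trans h)), by rw [← h3 p h]; exact h2⟩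
  · obtain rfl := hr h
    exact ⟨p, fun x hx => (h1 x hx).trans (h3 x hx), h2.trans h4⟩
  · exact ⟨q, fun x hx => (h1 x (hx.trans h)).trans (h3 x hx), by rw [h1 q h]; exact h4⟩
theorem LexLt.irrefl {r : P → ℕ} (a : Perm P) : ¬ LexLt r a a := by
  rintro ⟨p, _, h⟩; exact lt_irrefl _ h
theorem rew_lex {r : P → ℕ} (hr : Function.Injective r) {σ : Perm P}
    (hσ : ∀ p, σ (σ p) = p) {i : Fin 4 ↪ P} (hi : ∀ a b, i a ≠ σ (i b))
    (hj : ∀ a b, a < b → r (σ (i a)) < r (σ (i b)))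
    (hij : ∀ a, r (i a) < r (σ (i a))) (hii : ∀ a b, a < b → r (i a) < r (i b))
    (π : Perm (Fin 4)) (hπ : π ≠ 1) : LexLt r σ (rew σ i π) := by
  have hex : ∃ a, π a ≠ a := by
    by_contra h; push Not at h; exact hπ (Equiv.ext h)
  obtain ⟨a, ha, hmin⟩ := WellFounded.has_min (wellFounded_lt (α := Fin 4)) {a | π a ≠ a} hex
  have hmin : ∀ b, b < a → π b = b := by
    intro b hb; by_contra h; exact hmin b h hb
  refine ⟨i a, fun q hq => ?_, ?_⟩
  · rcases rew_cases hσ hi 1 q with ⟨b, rfl⟩ | ⟨b, rfl⟩ | ⟨h1, h2⟩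
    · rw [rew_i hσ hi, hmin b]
      by_contra h; push Not at h
      rcases h.eq_or_lt with h | h
      · subst h; exact lt_irrefl _ hq
      · exact absurd (hii _ _ h) (not_lt.2 hq.le)
    · simp only [Perm.coe_one, id] at hq ⊢
      have hb : b < a := by
        by_contra h; push Not at h
        rcases h.eq_or_lt with h | h
        · subst h; exact absurd (hij a) (not_lt.2 hq.le)
        · exact absurd ((hij a).trans (hj _ _ h)) (not_lt.2 hq.le)
      have := rew_j hσ hi π b
      rw [hmin b hb] at this
      rw [this, hσ]
    · exact (rew_o hσ hi π q h1 h2).symm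
  · rw [rew_i hσ hi]
    apply hj
    rcases lt_trichotomy (π a) a with h | h | h
    · exact absurd (π.injective (hmin _ h)) ha
    · exact absurd h ha
    · exact h
def gramSub (K P : Type) [Field K] [DecidableEq P] [Fintype P] : Submodule K (Perm P → K) :=
  span K {g | ∃ (σ : Perm P) (i : Fin 4 ↪ P), IsMatch Finset.univ σ ∧
    (∀ a b, i a ≠ σ (i b)) ∧
    g = ∑ π : Perm (Fin 4), ((Perm.sign π : ℤ) : K) • Pi.single (rew σ i π) (1 : K)}
theorem rew_one {σ : Perm P} {i : Fin 4 ↪ P} : rew σ i 1 = σ := by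
  have : (1 : Perm (Fin 4)).viaEmbedding (i.trans σ.toEmbedding) = 1 :=
    map_one (Perm.viaEmbeddingHom (i.trans σ.toEmbedding))
  simp [rew, this]
theorem straighten {r : P → ℕ} (hr : Function.Injective r) (σ : Perm P)
    (hσ : IsMatch Finset.univ σ) : (Pi.single σ (1 : K) : Perm P → K) ∈ gramSub K P ⊔
      span K {t | ∃ τ, IsMatch Finset.univ τ ∧ Good r τ ∧ t = Pi.single τ (1 : K)} := by
  have wf : WellFounded (fun σ τ : Perm P => LexLt r τ σ) := by
    have : IsTrans (Perm P) (fun σ τ => LexLt r τ σ) :=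
      ⟨fun a b c h1 h2 => LexLt.trans hr _ _ _ h2 h1⟩
    have : Std.Irrefl (fun σ τ : Perm P => LexLt r τ σ) := ⟨fun a => LexLt.irrefl a⟩
    exact Finite.wellFounded_of_trans_of_irrefl _
  induction σ using wf.induction with
  | _ σ ih =>
  by_cases hg : Good r σ
  · exact Submodule.mem_sup_right (subset_span ⟨σ, hσ, hg, rfl⟩)
  · unfold Good at hg; push Not at hg
    obtain ⟨a, b, c, d, h1, h2, h3⟩ := hg
    have hii : ∀ x y : Fin 4, x < y → r ((![a, b, c, d] : Fin 4 → P) x) < r (![a, b, c, d] y) := by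
      obtain ⟨u1, -⟩ := h1; obtain ⟨u2, -⟩ := h2; obtain ⟨u3, -⟩ := h3
      intro x y hxy
      fin_cases x <;> fin_cases y <;> simp at hxy ⊢ <;> omega
    have hjj : ∀ x y : Fin 4, x < y → r (σ ((![a, b, c, d] : Fin 4 → P) x)) <
        r (σ (![a, b, c, d] y)) := by
      obtain ⟨-, u1, -⟩ := h1; obtain ⟨-, u2, -⟩ := h2; obtain ⟨-, u3, -⟩ := h3
      intro x y hxy
      fin_cases x <;> fin_cases y <;> simp at hxy ⊢ <;> omega
    have hij : ∀ x : Fin 4, r ((![a, b, c, d] : Fin 4 → P) x) < r (σ (![a, b, c, d] x)) := by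
      obtain ⟨-, -, u1, v1⟩ := h1; obtain ⟨-, -, u2, v2⟩ := h2; obtain ⟨-, -, u3, v3⟩ := h3
      intro x; fin_cases x <;> simp <;> omega
    let i : Fin 4 ↪ P := ⟨![a, b, c, d], by
      intro x y hxy
      rcases lt_trichotomy x y with h | h | h
      · have := hii _ _ h; rw [hxy] at this; exact absurd this (lt_irrefl _)
      · exact h
      · have := hii _ _ h; rw [hxy] at this; exact absurd this (lt_irrefl _)⟩
    have hi : ∀ x y, i x ≠ σ (i y) := by
      intro x y h
      have u := hij x
      have v := hij y
      change r (i x) < r (σ (i x)) at u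
      change r (i y) < r (σ (i y)) at v
      rw [← h] at v
      rw [h, hσ.1] at u
      rw [← h] at u
      omega
    have hmem : ∑ π : Perm (Fin 4), ((Perm.sign π : ℤ) : K) •
        (Pi.single (rew σ i π) (1 : K) : Perm P → K) ∈ gramSub K P :=
      subset_span ⟨σ, i, hσ, hi, rfl⟩
    rw [← Finset.add_sum_erase _ _ (Finset.mem_univ 1), rew_one] at hmem
    simp only [Perm.sign_one, Units.val_one, Int.cast_one, one_smul] at hmem
    have h' := Submodule.mem_sup_left (S := gramSub K P) (T := span K
      {t | ∃ τ, IsMatch Finset.univ τ ∧ Good r τ ∧ t = Pi.single τ (1 : K)}) hmem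
    refine (Submodule.add_mem_iff_left _ ?_).1 h'
    refine Submodule.sum_mem _ fun π hπ => smul_mem _ _ ?_
    refine ih _ ?_ (rew_match hσ.1 hi π (fun p => (hσ.2 p).2 (by simp)))
    exact rew_lex hr hσ.1 hi hjj hij hii π (Finset.ne_of_mem_erase hπ)
open Classical in
theorem good_col {r : P → ℕ} (hr : Function.Injective r) {σ : Perm P}
    (hσ : IsMatch Finset.univ σ) (hg : Good r σ) : ∃ c : P → Fin 3, (∀ p, c (σ p) = c p) ∧
      ∀ τ, IsMatch Finset.univ τ → (∀ p, c (τ p) = c p) → τ ≠ σ → LexLt r τ σ := by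
  let H : P → Fin 3 := fun i => if ∃ a b, Chn r σ a b ∧ Chn r σ b i then 2 else
    if ∃ a, Chn r σ a i then 1 else 0
  have hH : ∀ i i', Chn r σ i i' → H i ≠ H i' := by
    intro i i' h
    simp only [H]
    by_cases h1 : ∃ a b, Chn r σ a b ∧ Chn r σ b i
    · obtain ⟨a, b, h2, h3⟩ := h1
      exact absurd ⟨a, b, i, i', h2, h3, h⟩ hg
    by_cases h2 : ∃ a, Chn r σ a i
    · have : ∃ a b, Chn r σ a b ∧ Chn r σ b i' := by
        obtain ⟨a, ha⟩ := h2; exact ⟨a, i, ha, h⟩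
      rw [if_neg h1, if_pos h2, if_pos this]; decide
    · have : ∃ a, Chn r σ a i' := ⟨i, h⟩
      rw [if_neg h1, if_neg h2]
      split_ifs <;> decide
  let L : P → P := fun p => if r p < r (σ p) then p else σ p
  have hne : ∀ p, σ p ≠ p := fun p => (hσ.2 p).2 (by simp)
  refine ⟨fun p => H (L p), fun p => ?_, fun τ hτ hc hne' => ?_⟩
  · have : r (σ p) ≠ r p := fun h => hne p (hr h)
    have e : L (σ p) = L p := by
      simp only [L, hσ.1]
      split_ifs <;> first | rfl | omega
    simp only [e]
  · have hex : ∃ n, ∃ p, r p = n ∧ τ p ≠ σ p := by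
      by_contra h; push Not at h; exact hne' (Equiv.ext fun p => h _ p rfl)
    obtain ⟨p, hp, hps⟩ := Nat.find_spec hex
    have hmin : ∀ q, r q < r p → τ q = σ q := by
      intro q hq; by_contra h
      exact Nat.find_min hex (by rw [← hp]; exact hq) ⟨q, rfl, h⟩
    refine ⟨p, hmin, ?_⟩
    have t1 : r p < r (τ p) := by
      by_contra h
      have hlt : r (τ p) < r p := lt_of_le_of_ne (not_lt.1 h)
        (fun h => (hτ.2 p).2 (by simp) (hr h))
      have := hmin _ hlt
      rw [hτ.1] at this
      exact hps (σ.injective (by rw [hσ.1]; exact this.symm))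
    have t2 : r p < r (σ p) := by
      by_contra h
      have hlt : r (σ p) < r p := lt_of_le_of_ne (not_lt.1 h) (fun h => hne p (hr h))
      have := hmin _ hlt
      rw [hσ.1] at this
      exact hps (τ.injective (by rw [hτ.1]; exact this.symm))
    by_contra h
    have hlt : r (σ p) < r (τ p) := lt_of_le_of_ne (not_lt.1 h) (fun h => hps (hr h.symm))
    have hs : r p < r (σ (τ p)) := by
      rcases lt_trichotomy (r p) (r (σ (τ p))) with h | h | h
      · exact h
      · have := congrArg σ (hr h); rw [hσ.1] at this
        exact absurd this.symm hps
      · have := hmin _ h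
        rw [hσ.1] at this
        have := τ.injective this
        rw [this] at h; exact absurd h (lt_irrefl _)
    have hcp := hc p
    have hLp : L p = p := by simp [L, t2]
    simp only [hLp] at hcp
    refine hH p (L (τ p)) ?_ hcp.symm
    by_cases h5 : r (τ p) < r (σ (τ p))
    · have : L (τ p) = τ p := by simp [L, h5]
      rw [this]; exact ⟨t1, by omega, t2, h5⟩
    · have h6 : r (σ (τ p)) ≠ r (τ p) := fun h => hne _ (hr h)
      have : L (τ p) = σ (τ p) := by simp [L, h5]
      rw [this]; exact ⟨hs, by rw [hσ.1]; exact hlt, t2, by rw [hσ.1]; omega⟩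
theorem sft (h2 : (2 : K) ≠ 0) {V : Type} [AddCommGroup V] [Module K V] (Θ : Perm P → V)
    (hΘ : ∀ (σ : Perm P) (i : Fin 4 ↪ P), IsMatch Finset.univ σ →
      (∀ a b, i a ≠ σ (i b)) →
      ∑ π : Perm (Fin 4), ((Perm.sign π : ℤ) : K) • Θ (rew σ i π) = 0)
    (c : Perm P → K) (hc : ∀ σ, c σ ≠ 0 → IsMatch Finset.univ σ)
    (h0 : ∀ col : P → Fin 3, ∑ σ, c σ * (if ∀ p, col (σ p) = col p then 1 else 0) = 0) :
    ∑ σ, c σ • Θ σ = 0 := by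
  obtain ⟨r, hr⟩ : ∃ r : P → ℕ, Function.Injective r :=
    ⟨fun p => (Fintype.equivFin P p : ℕ), fun a b h => by simpa [Fin.val_inj] using h⟩
  have hcs : c ∈ gramSub K P ⊔
      span K {t | ∃ τ, IsMatch Finset.univ τ ∧ Good r τ ∧ t = Pi.single τ (1 : K)} := by
    have : c = ∑ σ, c σ • (Pi.single σ (1 : K) : Perm P → K) := by
      ext τ; simp [Finset.sum_apply, Pi.single_apply]
    rw [this]
    refine Submodule.sum_mem _ fun σ _ => ?_
    by_cases h : c σ = 0
    · rw [h, zero_smul]; exact Submodule.zero_mem _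
    · exact smul_mem _ _ (straighten hr σ (hc σ h))
  obtain ⟨g, hg, t, ht, rfl⟩ := Submodule.mem_sup.1 hcs
  have kill : ∀ {V : Type} [AddCommGroup V] [Module K V] (Θ : Perm P → V),
      (∀ (σ : Perm P) (i : Fin 4 ↪ P), IsMatch Finset.univ σ →
      (∀ a b, i a ≠ σ (i b)) →
      ∑ π : Perm (Fin 4), ((Perm.sign π : ℤ) : K) • Θ (rew σ i π) = 0) →
      ∑ σ, g σ • Θ σ = 0 := by
    intro V _ _ Θ hΘ
    rw [← Fintype.linearCombination_apply K Θ g]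
    have : gramSub K P ≤ LinearMap.ker (Fintype.linearCombination K Θ) := by
      refine span_le.2 ?_
      rintro x ⟨σ, i, h1, h2, rfl⟩
      simp only [SetLike.mem_coe, LinearMap.mem_ker, map_sum, map_smul,
        Fintype.linearCombination_apply_single, one_smul]
      exact hΘ σ i h1 h2
    exact this hg
  have tsupp : ∀ σ, t σ ≠ 0 → IsMatch Finset.univ σ ∧ Good r σ := by
    clear hcs hc h0
    induction ht using span_induction with
    | mem x hx =>
      obtain ⟨τ, h1, h2, rfl⟩ := hx
      intro σ hσ
      by_cases h : σ = τ
      · rw [h]; exact ⟨h1, h2⟩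
      · simp [h] at hσ
    | zero => simp
    | add x y _ _ hx hy =>
      intro σ hσ
      by_cases h : x σ = 0
      · exact hy σ (by simpa [h] using hσ)
      · exact hx σ h
    | smul a x _ hx =>
      intro σ hσ
      exact hx σ (fun h => hσ (by simp [h]))
  have t0 : ∀ col : P → Fin 3, ∑ σ, t σ * (if ∀ p, col (σ p) = col p then 1 else 0) = 0 := by
    intro col
    have h1 := h0 col
    have h2 := kill (V := K) (fun σ => if ∀ p, col (σ p) = col p then 1 else 0)
      (fun σ i h3 h4 => gram_delta h3.1 h4 h2 col)
    simp only [Pi.add_apply, add_mul, Finset.sum_add_distrib] at h1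
    simp only [smul_eq_mul] at h2
    rw [h2, zero_add] at h1; exact h1
  have tz : t = 0 := by
    by_contra hne
    obtain ⟨σ0, hσ0⟩ := Function.ne_iff.1 hne
    have wf : WellFounded (fun σ τ : Perm P => LexLt r σ τ) := by
      have : IsTrans (Perm P) (fun σ τ => LexLt r σ τ) := ⟨LexLt.trans hr⟩
      have : Std.Irrefl (fun σ τ : Perm P => LexLt r σ τ) := ⟨fun a => LexLt.irrefl a⟩
      exact Finite.wellFounded_of_trans_of_irrefl _
    obtain ⟨σ, hσ, hmin⟩ := wf.has_min {σ | t σ ≠ 0} ⟨σ0, hσ0⟩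
    obtain ⟨h1, h2⟩ := tsupp σ hσ
    obtain ⟨col, h3, h4⟩ := good_col hr h1 h2
    have := t0 col
    rw [Finset.sum_eq_single σ, if_pos h3, mul_one] at this
    · exact hσ this
    · intro τ _ hτ
      by_cases h5 : t τ = 0
      · rw [h5, zero_mul]
      rw [if_neg, mul_zero]
      intro h6
      exact hmin τ h5 (h4 τ (tsupp τ h5).1 h6 hτ)
    · simp
  subst tz
  simpa using kill Θ hΘ
end SFT2
section Skel
abbrev S4 := Fin 4 × Bool
def fl4 (x : S4) : S4 := if x.2 then (x.1+1,false) else (x.1-1,true)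
def rho4 (e : Fin 4 → Bool) (π : Perm (Fin 4)) (x : S4) : S4 :=
  if x.2 = e x.1 then (π x.1, !e (π x.1)) else (π.symm x.1, e (π.symm x.1))
def walk4 (r : S4 → S4) : ℕ → S4 → Option (List S4)
| 0, _ => none
| n+1, c => if r c = (3,true) then some [] else if r c = (0,false) then none else
   (walk4 r n (fl4 (r c))).map (fun m => r c :: m)
def blk4 (x : S4) : Fin 4 := if x.2 then x.1+1 else x.1
def sg4 (π : Perm (Fin 4)) : ℤ :=
  ((List.finRange 4).map fun a => ((List.finRange 4).map fun b => if a < b ∧ π b < π a then (-1:ℤ) else 1).prod).prod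
theorem sg4_eq : ∀ π : Perm (Fin 4), (Perm.sign π : ℤ) = sg4 π := by decide +kernel
def chk4 (e : Fin 4 → Bool) (π : Perm (Fin 4)) : Bool :=
  match walk4 (rho4 e π) 4 (0,false) with
  | none => false
  | some m => decide ((0 :: m.map blk4).Nodup)
theorem chk4_eq : ∀ e : Fin 4 → Bool, ∀ π, chk4 e π = true := by decide +kernel
theorem chk4_ex (e : Fin 4 → Bool) (π) : ∃ m, walk4 (rho4 e π) 4 (0,false) = some m ∧
    (0 :: m.map blk4).Nodup := by
  have := chk4_eq e π
  unfold chk4 at this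
  split at this
  · simp at this
  · rename_i m h
    exact ⟨m, h, of_decide_eq_true this⟩
def perms4 := permsOfList (List.finRange 4)
theorem sum4 {M : Type} [AddCommMonoid M] (g : Perm (Fin 4) → M) : ∑ π, g π = (perms4.map g).sum := by
  have h1 : perms4.Nodup := nodup_permsOfList (List.nodup_finRange 4)
  rw [← List.sum_toFinset g h1]
  apply Finset.sum_congr _ (fun _ _ => rfl)
  ext π
  simp [perms4, mem_permsOfList_iff]
def coef4 (L : List (ℤ × List S4)) (w : List S4) : ℤ := (L.map fun p => if p.2 = w then p.1 else 0).sum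
theorem formal4 {M : Type} [AddCommGroup M] (v : List S4 → M) (L : List (ℤ × List S4))
    (h : ∀ p ∈ L, coef4 L p.2 = 0) : (L.map fun p => p.1 • v p.2).sum = 0 := by
  classical
  have h1 : ∀ (L : List (ℤ × List S4)) w, (L.map fun p => Finsupp.single p.2 p.1).sum w = coef4 L w := by
    intro L w
    induction L with
    | nil => simp [coef4]
    | cons a L ih =>
      simp only [coef4, List.map_cons, List.sum_cons, Finsupp.add_apply] at ih ⊢
      rw [ih, Finsupp.single_apply]
  have h2 : (L.map fun p => Finsupp.single p.2 p.1).sum = 0 := by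
    ext w
    rw [h1]
    by_cases hw : ∃ p ∈ L, p.2 = w
    · obtain ⟨p, hp, rfl⟩ := hw
      exact h p hp
    · push Not at hw
      rw [coef4, List.sum_eq_zero]; rfl
      intro x hx
      rw [List.mem_map] at hx
      obtain ⟨p, hp, rfl⟩ := hx
      simp [hw p hp]
  have h3 := congrArg (Finsupp.liftAddHom (fun w => (zmultiplesHom M (v w)))) h2
  rw [map_zero, map_list_sum, List.map_map] at h3
  rw [← h3]
  congr 1
  apply List.map_congr_left
  intro p _
  simp
def bar4 (x : S4) : List (ℤ × S4) := [(1, x), (-1, fl4 x)]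
def mul4 (l : List (List (ℤ × S4))) : List (ℤ × List S4) :=
  l.foldr (fun a r => a.flatMap fun p => r.map fun q => (p.1 * q.1, p.2 :: q.2)) [(1, [])]
def T4 (x y z : S4) : List (ℤ × List S4) :=
  mul4 [[(1, x)], bar4 y, bar4 z] ++ mul4 [bar4 y, [(1, fl4 x)], bar4 z] ++ mul4 [bar4 y, bar4 z, [(1, x)]]
def N4 (x y z : S4) : List (ℤ × List S4) :=
  [(1,[x,y,z]),(1,[x,z,y]),(1,[y,x,z]),(1,[y,z,x]),(1,[z,x,y]),(1,[z,y,x])]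
def cert4 (e : Fin 4 → Bool) : List (ℤ × Bool × S4 × S4 × S4) :=
  let A : S4 := (0,true)
  let a : S4 := (1,false)
  let B : S4 := (1,true)
  let b : S4 := (2,false)
  let C : S4 := (2,true)
  let c : S4 := (3,false)
  match (xor (e 0) (e 1)), (xor (e 0) (e 2)), (xor (e 0) (e 3)) with
  | false, false, false => [(1,false,A,B,C)]
  | false, false, true => [(1,false,a,b,C),(-1,false,a,b,c),(1,true,a,B,C),(1,true,b,A,C)]
  | false, true, false => [(1,true,A,B,C)]
  | false, true, true => [(-1,true,c,B,A),(-1,false,A,b,c),(1,true,A,B,C),(1,false,A,B,c)]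
  | true, false, false => [(1,true,C,A,B)]
  | true, false, true => [(1,true,C,B,A),(1,true,A,B,C),(-1,true,a,B,C),(-1,true,c,B,A)]
  | true, true, false => [(1,true,b,A,C)]
  | true, true, true => [(-1,false,a,B,C),(1,false,A,B,C),(-1,true,B,C,A),(-1,true,C,B,A)]
def gen4 (g : Bool × S4 × S4 × S4) : List (ℤ × List S4) :=
  if g.1 then T4 g.2.1 g.2.2.1 g.2.2.2 else N4 g.2.1 g.2.2.1 g.2.2.2
def wl4 (e : Fin 4 → Bool) (π : Perm (Fin 4)) : List S4 := (walk4 (rho4 e π) 4 (0,false)).getD []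
def lhs4 (e : Fin 4 → Bool) : List (ℤ × List S4) :=
  (perms4.map fun π => (sg4 π, wl4 e π)).filter fun p => p.2.length = 3
def all4 (e : Fin 4 → Bool) : List (ℤ × List S4) :=
  lhs4 e ++ (cert4 e).flatMap fun g => (gen4 g.2).map fun p => (-g.1 * p.1, p.2)
theorem all4_ok : ∀ e : Fin 4 → Bool, ∀ p ∈ all4 e, coef4 (all4 e) p.2 = 0 := by decide +kernel
def good4 (x : S4) : Prop := x ≠ (3,true) ∧ x ≠ (0,false)
instance : DecidablePred good4 := fun x => by unfold good4; infer_instance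
theorem cert4_good : ∀ e : Fin 4 → Bool, ∀ g ∈ cert4 e, good4 g.2.2.1 ∧ good4 g.2.2.2.1 ∧ good4 g.2.2.2.2 := by
  decide +kernel
theorem skel4 {M : Type} [AddCommGroup M] (v : List S4 → M)
    (hN : ∀ x y z, good4 x → good4 y → good4 z → ((N4 x y z).map fun p => p.1 • v p.2).sum = 0)
    (hT : ∀ x y z, good4 x → good4 y → good4 z → ((T4 x y z).map fun p => p.1 • v p.2).sum = 0)
    (e : Fin 4 → Bool) :
    ∑ π, sg4 π • (if (wl4 e π).length = 3 then v (wl4 e π) else 0) = 0 := by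
  have h := formal4 v (all4 e) (all4_ok e)
  rw [all4, List.map_append, List.sum_append] at h
  have h2 : (((cert4 e).flatMap fun g => (gen4 g.2).map fun p => (-g.1 * p.1, p.2)).map
      fun p => p.1 • v p.2).sum = 0 := by
    have hg := cert4_good e
    generalize cert4 e = L at hg
    induction L with
    | nil => simp
    | cons g L ih =>
      rw [List.flatMap_cons, List.map_append, List.sum_append, ih fun g hg' => hg g (by simp [hg']), add_zero,
        List.map_map]
      have hs : ∀ Q : List (ℤ × List S4), (Q.map ((fun p : ℤ × List S4 => p.1 • v p.2) ∘
          fun p => (-g.1 * p.1, p.2))).sum = (-g.1) • (Q.map fun p => p.1 • v p.2).sum := by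
        intro Q
        induction Q with
        | nil => simp
        | cons q Q ih => simp only [List.map_cons, List.sum_cons, ih, smul_add, Function.comp, mul_smul]
      rw [hs]
      obtain ⟨g1, g2, g3⟩ := hg g (by simp)
      have : ((gen4 g.2).map fun p => p.1 • v p.2).sum = 0 := by
        unfold gen4
        split
        · exact hT _ _ _ g1 g2 g3
        · exact hN _ _ _ g1 g2 g3
      rw [this, smul_zero]
  rw [h2, add_zero, lhs4] at h
  rw [sum4]
  refine Eq.trans ?_ h
  generalize perms4 = L
  induction L with
  | nil => simp
  | cons π L ih =>
    simp only [List.map_cons, List.sum_cons, List.filter_cons, decide_eq_true_eq] at ih ⊢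
    split <;> simp only [ih, smul_zero, zero_add, List.map_cons, List.sum_cons]
end Skel
section Alg
variable {K : Type} [Field K] {d : ℕ}
def flp {d : ℕ} (p : Ltr d) : Ltr d := (p.1, !p.2)
@[simp] theorem flp_flp (p : Ltr d) : flp (flp p) = p := by simp [flp]
@[simp] theorem flp_fst (p : Ltr d) : (flp p).1 = p.1 := rfl
theorem flp_ne (p : Ltr d) : flp p ≠ p := by
  intro h; have := congrArg Prod.snd h; simp [flp] at this
theorem tp_add (a b : FA K d) : tp K d (a + b) = tp K d a + tp K d b := by simp [tp]
theorem tp_mul (a b : FA K d) : tp K d (a * b) = tp K d b * tp K d a := by simp [tp]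
theorem tp_smul (c : K) (a : FA K d) : tp K d (c • a) = c • tp K d a := by simp [tp]
theorem tp_one : tp K d 1 = 1 := by simp [tp]
theorem tp_iota (p : Ltr d) : tp K d (ι K p) = ι K (flp p) := by simp [tp, flp]
noncomputable def tpL : FA K d →ₗ[K] FA K d where
  toFun := tp K d
  map_add' := tp_add
  map_smul' := tp_smul
theorem tp_zero : tp K d 0 = 0 := (tpL (K := K) (d := d)).map_zero
theorem tp_sub (a b : FA K d) : tp K d (a - b) = tp K d a - tp K d b := (tpL (K := K) (d := d)).map_sub a b
theorem tp_neg (a : FA K d) : tp K d (-a) = - tp K d a := (tpL (K := K) (d := d)).map_neg a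
theorem wordOf_nil : wordOf K d [] = 1 := rfl
theorem wordOf_cons (p : Ltr d) (l) : wordOf K d (p :: l) = ι K p * wordOf K d l := by
  simp [wordOf]
theorem wordOf_append (l m : List (Ltr d)) : wordOf K d (l ++ m) = wordOf K d l * wordOf K d m := by
  simp [wordOf]
theorem tp_wordOf (l : List (Ltr d)) : tp K d (wordOf K d l) = wordOf K d (l.reverse.map flp) := by
  induction l with
  | nil => simp [wordOf_nil, tp_one]
  | cons p l ih =>
    rw [wordOf_cons, tp_mul, ih, tp_iota]
    simp [wordOf_append, wordOf_cons, wordOf_nil]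
theorem span_words : span K (Set.range (wordOf K d)) = ⊤ := by
  rw [eq_top_iff]
  intro a _
  induction a using FreeAlgebra.induction with
  | grade0 r =>
    rw [Algebra.algebraMap_eq_smul_one]
    exact smul_mem _ _ (subset_span ⟨[], rfl⟩)
  | grade1 x => exact subset_span ⟨[x], by simp [wordOf_cons, wordOf_nil]⟩
  | add a b ha hb => exact Submodule.add_mem _ (ha trivial) (hb trivial)
  | mul a b ha hb =>
    have h := Submodule.mul_mem_mul (ha trivial) (hb trivial)
    rw [Submodule.span_mul_span] at h
    refine Submodule.span_mono ?_ h
    rintro _ ⟨_, ⟨l, rfl⟩, _, ⟨m, rfl⟩, rfl⟩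
    exact ⟨l ++ m, wordOf_append l m⟩
theorem fa_ind {p : FA K d → Prop} (hw : ∀ l, p (wordOf K d l)) (ha : ∀ a b, p a → p b → p (a + b))
    (hs : ∀ (c : K) a, p a → p (c • a)) (a) : p a := by
  have h : a ∈ span K (Set.range (wordOf K d)) := by rw [span_words]; trivial
  induction h using span_induction with
  | mem x hx => obtain ⟨l, rfl⟩ := hx; exact hw l
  | zero => have := hs 0 _ (hw []); rwa [zero_smul] at this
  | add x y _ _ hx hy => exact ha _ _ hx hy
  | smul c x _ hx => exact hs _ _ hx
theorem tp_tp (a : FA K d) : tp K d (tp K d a) = a := by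
  induction a using fa_ind with
  | hw l => rw [tp_wordOf, tp_wordOf]; congr 1; simp [List.map_reverse, Function.comp_def]
  | ha a b h1 h2 => rw [tp_add, tp_add, h1, h2]
  | hs c a h => rw [tp_smul, tp_smul, h]
noncomputable def aug : FA K d →ₐ[K] K := FreeAlgebra.lift K fun _ => 0
theorem aug_word (l : List (Ltr d)) : aug (wordOf K d l) = if l = [] then 1 else 0 := by
  cases l with
  | nil => simp [wordOf_nil]
  | cons p l => simp [wordOf_cons, aug]
theorem mem_MF (a : FA K d) : a ∈ MFsub K d ↔ aug a = 0 := by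
  constructor
  · intro h
    have : MFsub K d ≤ LinearMap.ker (aug (K := K) (d := d)).toLinearMap := by
      rw [MFsub, span_le]
      rintro _ ⟨l, hl, rfl⟩
      simp [aug_word, hl]
    exact this h
  · intro h
    have key : ∀ a : FA K d, a - (aug a) • 1 ∈ MFsub K d := by
      intro a
      induction a using fa_ind with
      | hw l =>
        rw [aug_word]
        split
        · rename_i h; subst h; simp [wordOf_nil]
        · rename_i h; rw [zero_smul, sub_zero]; exact subset_span ⟨l, h, rfl⟩
      | ha a b h1 h2 =>
        have := Submodule.add_mem _ h1 h2
        rw [map_add, add_smul]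
        convert this using 1; abel
      | hs c a h =>
        have := smul_mem _ c h
        rw [map_smul, smul_eq_mul, mul_smul, ← smul_sub]; exact this
    have := key a
    rwa [h, zero_smul, sub_zero] at this
theorem MF_mul_left (a : FA K d) {b : FA K d} (hb : b ∈ MFsub K d) : a * b ∈ MFsub K d := by
  rw [mem_MF] at *; rw [map_mul, hb, mul_zero]
theorem MF_mul_right {a : FA K d} (b : FA K d) (ha : a ∈ MFsub K d) : a * b ∈ MFsub K d := by
  rw [mem_MF] at *; rw [map_mul, ha, zero_mul]
theorem MF_word {l : List (Ltr d)} (h : l ≠ []) : wordOf K d l ∈ MFsub K d := subset_span ⟨l, h, rfl⟩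
theorem MF_iota (p : Ltr d) : ι K p ∈ MFsub K d := by rw [mem_MF]; simp [aug]
theorem MF_tp {a : FA K d} (h : a ∈ MFsub K d) : tp K d a ∈ MFsub K d := by
  have : MFsub K d ≤ (MFsub K d).comap (tpL (K := K) (d := d)) := by
    conv_lhs => rw [MFsub]
    rw [span_le]
    rintro _ ⟨l, hl, rfl⟩
    show tp K d (wordOf K d l) ∈ MFsub K d
    rw [tp_wordOf]
    exact MF_word (by simpa using hl)
  exact this h
theorem MF_bar {a : FA K d} (h : a ∈ MFsub K d) : bar K d a ∈ MFsub K d := Submodule.sub_mem _ h (MF_tp h)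
def IA (K : Type) [Field K] (d : ℕ) : Submodule K (FA K d) where
  carrier := {x | x ∈ idealA K d}
  add_mem' := fun ha hb => (idealA K d).add_mem ha hb
  zero_mem' := (idealA K d).zero_mem
  smul_mem' := fun c x hx => by
    show c • x ∈ idealA K d
    rw [Algebra.smul_def]; exact (idealA K d).mul_mem_left _ _ hx
theorem mem_IA {x : FA K d} : x ∈ IA K d ↔ x ∈ idealA K d := Iff.rfl
theorem IA_l (a : FA K d) {x} (h : x ∈ IA K d) : a * x ∈ IA K d := (idealA K d).mul_mem_left _ _ h
theorem IA_r {x : FA K d} (h : x ∈ IA K d) (a) : x * a ∈ IA K d := (idealA K d).mul_mem_right _ _ h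
theorem IA_cube {a : FA K d} (ha : a ∈ MFsub K d) : a ^ 3 ∈ IA K d :=
  TwoSidedIdeal.subset_span (Or.inl ⟨a, ha, rfl⟩)
theorem IA_T {a b c : FA K d} (ha : a ∈ MFsub K d) (hb : b ∈ MFsub K d) (hc : c ∈ MFsub K d) :
    Trel K d a b c ∈ IA K d :=
  TwoSidedIdeal.subset_span (Or.inr ⟨a, ha, b, hb, c, hc, rfl⟩)
theorem IA_N {a b c : FA K d} (ha : a ∈ MFsub K d) (hb : b ∈ MFsub K d) (hc : c ∈ MFsub K d) :
    a*b*c + a*c*b + b*a*c + b*c*a + c*a*b + c*b*a ∈ IA K d := by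
  have e : a*b*c + a*c*b + b*a*c + b*c*a + c*a*b + c*b*a =
    (a+b+c)^3 - (a+b)^3 - (a+c)^3 - (b+c)^3 + a^3 + b^3 + c^3 := by noncomm_ring
  rw [e]
  have m : ∀ {x y}, x ∈ MFsub K d → y ∈ MFsub K d → x + y ∈ MFsub K d := fun h h' => (MFsub K d).add_mem h h'
  refine add_mem (add_mem (add_mem (sub_mem (sub_mem (sub_mem ?_ ?_) ?_) ?_) ?_) ?_) ?_ <;>
    apply IA_cube <;> first | assumption | exact m (m ha hb) hc | exact m ha hb | exact m ha hc | exact m hb hc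
theorem IA_ind {S : Submodule K (FA K d)}
    (h1 : ∀ x y a, a ∈ MFsub K d → x * a^3 * y ∈ S)
    (h2 : ∀ x y a b c, a ∈ MFsub K d → b ∈ MFsub K d → c ∈ MFsub K d → x * Trel K d a b c * y ∈ S) :
    IA K d ≤ S := by
  intro u hu
  replace hu : u ∈ idealA K d := hu
  rw [idealA, TwoSidedIdeal.mem_span_iff_mem_addSubgroup_closure] at hu
  induction hu using AddSubgroup.closure_induction with
  | mem x hx =>
    obtain ⟨_, ⟨x, _, g, hg, rfl⟩, y, _, rfl⟩ := hx
    rcases hg with ⟨a, ha, rfl⟩ | ⟨a, ha, b, hb, c, hc, rfl⟩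
    · exact h1 x y a ha
    · exact h2 x y a b c ha hb hc
  | zero => exact S.zero_mem
  | add x y _ _ hx hy => exact S.add_mem hx hy
  | neg x _ hx => exact S.neg_mem hx
end Alg
section Gram
variable {K : Type} [Field K] {d : ℕ}
def Tt (σ : Perm (Ltr d)) (z : Fin d) : ℕ → Ltr d
| 0 => (z, true)
| k+1 => flp (σ (Tt σ z k))
def Hh (σ : Perm (Ltr d)) (z : Fin d) (k : ℕ) : Ltr d := σ (Tt σ z k)
theorem Tt_succ (σ : Perm (Ltr d)) (z : Fin d) (k) : Tt σ z (k+1) = flp (Hh σ z k) := rfl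
def lst (σ : Perm (Ltr d)) (z : Fin d) : List (Ltr d) := (List.range (d-1)).map (Hh σ z)
def Full (z : Fin d) (l : List (Ltr d)) : Prop := ((l.map Prod.fst : List (Fin d)) : Multiset (Fin d)) = (Finset.univ.erase z).val
def Conn (σ : Perm (Ltr d)) (z : Fin d) : Prop := Full z (lst σ z) ∧ Hh σ z (d-1) = (z,false)
open Classical in
noncomputable def Th (K : Type) [Field K] (z : Fin d) (σ : Perm (Ltr d)) : FA K d ⧸ IA K d :=
  if Conn σ z then (IA K d).mkQ (wordOf K d (lst σ z)) else 0
theorem Full.nodup {z : Fin d} {l} (h : Full z l) : (l.map Prod.fst).Nodup := by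
  have := (Finset.univ.erase z).nodup
  rw [← h] at this; exact this
theorem Full.mem {z : Fin d} {l} (h : Full z l) (k : Fin d) : k ∈ l.map Prod.fst ↔ k ≠ z := by
  have : k ∈ (Finset.univ.erase z).val ↔ k ≠ z := by
    rw [Finset.mem_val, Finset.mem_erase]; simp
  rw [← h] at this; exact this
theorem Full.length {z : Fin d} {l} (h : Full z l) : l.length = d - 1 := by
  have := congrArg Multiset.card h
  simpa using this
def Walks (σ : Perm (Ltr d)) : Ltr d → List (Ltr d) → Ltr d → Prop
| p, [], q => p = q
| p, l :: ls, q => σ p = l ∧ Walks σ (flp l) ls q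
theorem Walks.append {σ : Perm (Ltr d)} {p l q m r} (h1 : Walks σ p l q) (h2 : Walks σ q m r) :
    Walks σ p (l ++ m) r := by
  induction l generalizing p with
  | nil => simp only [Walks] at h1; subst h1; exact h2
  | cons a l ih => exact ⟨h1.1, ih h1.2⟩
theorem Walks.eq {σ : Perm (Ltr d)} {z : Fin d} {l q} {k} (h : Walks σ (Tt σ z k) l q) :
    l = (List.range' k l.length).map (Hh σ z) ∧ q = Tt σ z (k + l.length) := by
  induction l generalizing k with
  | nil => exact ⟨by simp, h.symm⟩
  | cons a l ih =>
    obtain ⟨h1, h2⟩ := h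
    subst h1
    have := ih (k := k+1) h2
    refine ⟨?_, ?_⟩
    · rw [List.length_cons, List.range'_succ, List.map_cons, ← this.1]; rfl
    · rw [this.2, List.length_cons]; congr 1; omega
def fwd (σ : Perm (Ltr d)) (z : Fin d) (a b : ℕ) : List (Ltr d) := (List.range' a (b-a)).map (Hh σ z)
def bwd (σ : Perm (Ltr d)) (z : Fin d) (a b : ℕ) : List (Ltr d) := ((List.range' (a+1) (b-a)).map (Tt σ z)).reverse
variable {σ μ : Perm (Ltr d)} {z : Fin d}
theorem fwd_succ {a b} (h : a ≤ b) : fwd σ z a (b+1) = fwd σ z a b ++ [Hh σ z b] := by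
  unfold fwd
  rw [Nat.succ_sub h, List.range'_concat, List.map_append]
  simp; congr 1; omega
theorem fwd_append {a b c} (h : a ≤ b) (h' : b ≤ c) : fwd σ z a b ++ fwd σ z b c = fwd σ z a c := by
  unfold fwd
  rw [← List.map_append]; congr 1
  obtain ⟨k, rfl⟩ := Nat.exists_eq_add_of_le h
  obtain ⟨m, rfl⟩ := Nat.exists_eq_add_of_le h'
  rw [show a + k + m - a = k + m by omega, show a + k - a = k by omega, show a + k + m - (a+k) = m by omega]
  rw [← List.range'_append_1]
theorem bwd_succ {a b} (h : a ≤ b) : bwd σ z a (b+1) = Tt σ z (b+1) :: bwd σ z a b := by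
  unfold bwd
  rw [Nat.succ_sub h, List.range'_concat, List.map_append, List.reverse_append]
  simp; congr 1; omega
theorem bwd_eq (a b) : bwd σ z a b = (fwd σ z a b).reverse.map flp := by
  unfold bwd fwd
  rw [← List.map_reverse, ← List.map_reverse, List.map_map]
  rw [show List.range' (a+1) (b-a) = (List.range' a (b-a)).map (· + 1) by
    apply List.ext_getElem <;> simp <;> intros <;> omega]
  rw [← List.map_reverse, List.map_map]; rfl
theorem bwd_fst (a b) : ((bwd σ z a b).map Prod.fst).Perm ((fwd σ z a b).map Prod.fst) := by
  rw [bwd_eq, List.map_map, show Prod.fst ∘ (flp (d := d)) = Prod.fst from rfl]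
  exact (List.reverse_perm _).map _
theorem tp_fwd (a b) : tp K d (wordOf K d (fwd σ z a b)) = wordOf K d (bwd σ z a b) := by
  rw [tp_wordOf, bwd_eq]
theorem tp_bwd (a b) : tp K d (wordOf K d (bwd σ z a b)) = wordOf K d (fwd σ z a b) := by
  rw [← tp_fwd, tp_tp]
theorem fwd_len (a b) : (fwd σ z a b).length = b - a := by simp [fwd]
theorem walks_fwd {p a b} (hp : μ p = Hh σ z a) (hab : a < b) (h : ∀ j, a < j → j < b → μ (Tt σ z j) = Hh σ z j) :
    Walks μ p (fwd σ z a b) (Tt σ z b) := by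
  induction b, hab using Nat.le_induction with
  | base => rw [fwd_succ le_rfl]; simp [fwd, Walks, hp, Tt_succ]
  | succ b hb ih =>
    rw [fwd_succ (by omega)]
    refine (ih fun j h1 h2 => h j h1 (by omega)).append ⟨h b hb (by omega), rfl⟩
theorem walks_fwd0 {b} (h : ∀ j, j < b → μ (Tt σ z j) = Hh σ z j) :
    Walks μ (z, true) (fwd σ z 0 b) (Tt σ z b) := by
  rcases Nat.eq_zero_or_pos b with rfl | hb
  · simp [fwd, Walks, Tt]
  · exact walks_fwd (h 0 hb) hb fun j _ => h j
theorem walks_bwd {p a b} (hp : μ p = Tt σ z b) (hab : a < b) (h : ∀ j, a < j → j < b → μ (Hh σ z j) = Tt σ z j) :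
    Walks μ p (bwd σ z a b) (Hh σ z a) := by
  induction b, hab using Nat.le_induction generalizing p with
  | base => rw [bwd_succ le_rfl]; simp [bwd, Walks, hp, Tt_succ]
  | succ b hb ih =>
    rw [bwd_succ (by omega)]
    refine ⟨hp, ?_⟩
    rw [Tt_succ, flp_flp]
    exact ih (h b hb (by omega)) fun j h1 h2 => h j h1 (by omega)
def pt (σ : Perm (Ltr d)) (z : Fin d) (k : ℕ) (b : Bool) : Ltr d := if b then Hh σ z k else Tt σ z k
theorem lst_get (k) (h : k < d-1) : Hh σ z k ∈ lst σ z := List.mem_map.2 ⟨k, by simpa using h, rfl⟩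
theorem Conn.inj_lt (hc : Conn σ z) {a b} (ha : a < d-1) (hb : b < d-1) (h : (Hh σ z a).1 = (Hh σ z b).1) : a = b := by
  have := hc.1.nodup
  rw [lst, List.map_map] at this
  exact List.inj_on_of_nodup_map this (by simpa using ha) (by simpa using hb) h
theorem Conn.ne (hc : Conn σ z) {a} (ha : a < d-1) : (Hh σ z a).1 ≠ z :=
  (hc.1.mem _).1 (List.mem_map.2 ⟨_, lst_get a ha, rfl⟩)
theorem Conn.inj (hc : Conn σ z) {a b x y} (ha : a < d) (hb : b < d) (h : pt σ z a x = pt σ z b y) : a = b ∧ x = y := by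
  have e := hc.2
  have hT : ∀ a b, a < d → b < d → Tt σ z a = Tt σ z b → a = b := by
    intro a b ha hb h
    rcases a with _ | a <;> rcases b with _ | b
    · rfl
    · have := congrArg Prod.fst h; simp only [Tt_succ, flp_fst, Tt] at this
      exact absurd this.symm (hc.ne (by omega))
    · have := congrArg Prod.fst h; simp only [Tt_succ, flp_fst, Tt] at this
      exact absurd this (hc.ne (by omega))
    · have := congrArg Prod.fst h; simp only [Tt_succ, flp_fst] at this
      rw [hc.inj_lt (by omega) (by omega) this]
  have hTH : ∀ a b, a < d → b < d → Tt σ z a ≠ Hh σ z b := by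
    intro a b ha hb h
    by_cases hb' : b = d - 1
    · subst hb'
      rw [e] at h
      rcases a with _ | a
      · simp [Tt] at h
      · have := congrArg Prod.fst h; simp only [Tt_succ, flp_fst] at this
        exact hc.ne (by omega) this
    · rcases a with _ | a
      · have := congrArg Prod.fst h; simp only [Tt] at this
        exact hc.ne (by omega) this.symm
      · have := congrArg Prod.fst h; simp only [Tt_succ, flp_fst] at this
        have := hc.inj_lt (by omega) (by omega) this
        subst this
        exact flp_ne _ h
  unfold pt at h
  cases x <;> cases y <;> simp only [if_true, if_false, Bool.false_eq_true] at h
  · exact ⟨hT _ _ ha hb h, rfl⟩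
  · exact absurd h (hTH _ _ ha hb)
  · exact absurd h.symm (hTH _ _ hb ha)
  · exact ⟨hT _ _ ha hb (σ.injective h), rfl⟩
theorem Conn.ex (hc : Conn σ z) (p : Ltr d) : ∃ k b, k < d ∧ p = pt σ z k b := by
  have hd : 0 < d := z.pos
  by_cases hp : p.1 = z
  · rcases p with ⟨k, b⟩
    simp only at hp; subst hp
    cases b
    · exact ⟨d-1, true, by omega, hc.2.symm⟩
    · exact ⟨0, false, hd, rfl⟩
  · have := (hc.1.mem p.1).2 hp
    simp only [lst, List.map_map, List.mem_map, List.mem_range, Function.comp] at this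
    obtain ⟨k, hk, h⟩ := this
    by_cases h2 : (Hh σ z k).2 = p.2
    · exact ⟨k, true, by omega, Prod.ext h.symm h2.symm⟩
    · refine ⟨k+1, false, by omega, ?_⟩
      have : p = flp (Hh σ z k) := by
        refine Prod.ext h.symm ?_
        simp only [flp]
        cases hx : (Hh σ z k).2 <;> cases hy : p.2 <;> simp_all
      exact this
end Gram
section Gram2
variable {K : Type} [Field K] {d : ℕ} {σ μ : Perm (Ltr d)} {z : Fin d}
theorem sig_pt (hσ : ∀ p, σ (σ p) = p) (k b) : σ (pt σ z k b) = pt σ z k (!b) := by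
  cases b
  · rfl
  · simp [pt, Hh, hσ]
def seg (σ : Perm (Ltr d)) (z : Fin d) (k : Fin 4 → ℕ) (x : S4) : List (Ltr d) :=
  if x.2 then fwd σ z (k x.1) (k (x.1+1)) else bwd σ z (k (x.1-1)) (k x.1)
def qq (σ : Perm (Ltr d)) (z : Fin d) (k : Fin 4 → ℕ) (x : S4) : Ltr d := pt σ z (k x.1) x.2
theorem mono4 {k : Fin 4 → ℕ} (hk : StrictMono k) : k 0 < k 1 ∧ k 1 < k 2 ∧ k 2 < k 3 :=
  ⟨hk (by decide), hk (by decide), hk (by decide)⟩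
theorem seg_walk {k : Fin 4 → ℕ} (hk : StrictMono k)
    (hm : ∀ j b, j < k 3 → (∀ a, j ≠ k a) → μ (pt σ z j b) = pt σ z j (!b))
    {x : S4} (hx : good4 x) {p} (hp : μ p = qq σ z k x) : Walks μ p (seg σ z k x) (qq σ z k (fl4 x)) := by
  obtain ⟨h0, h1, h2⟩ := mono4 hk
  have nb : ∀ j, (k 0 < j ∧ j < k 1) ∨ (k 1 < j ∧ j < k 2) ∨ (k 2 < j ∧ j < k 3) → ∀ b,
      μ (pt σ z j b) = pt σ z j (!b) := by
    intro j hj b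
    refine hm j b (by omega) ?_
    intro a; fin_cases a <;> simp <;> omega
  have nT : ∀ j, (k 0 < j ∧ j < k 1) ∨ (k 1 < j ∧ j < k 2) ∨ (k 2 < j ∧ j < k 3) →
      μ (Tt σ z j) = Hh σ z j := fun j hj => nb j hj false
  have nH : ∀ j, (k 0 < j ∧ j < k 1) ∨ (k 1 < j ∧ j < k 2) ∨ (k 2 < j ∧ j < k 3) →
      μ (Hh σ z j) = Tt σ z j := fun j hj => nb j hj true
  obtain ⟨a, b⟩ := x
  cases b
  · have : seg σ z k (a, false) = bwd σ z (k (a-1)) (k a) := rfl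
    rw [this]
    have hq : qq σ z k (fl4 (a, false)) = Hh σ z (k (a-1)) := rfl
    rw [hq]
    fin_cases a
    · exact absurd rfl hx.2
    · exact walks_bwd hp h0 fun j g1 g2 => nH j (Or.inl ⟨g1, g2⟩)
    · exact walks_bwd hp h1 fun j g1 g2 => nH j (Or.inr (Or.inl ⟨g1, g2⟩))
    · exact walks_bwd hp h2 fun j g1 g2 => nH j (Or.inr (Or.inr ⟨g1, g2⟩))
  · have : seg σ z k (a, true) = fwd σ z (k a) (k (a+1)) := rfl
    rw [this]
    have hq : qq σ z k (fl4 (a, true)) = Tt σ z (k (a+1)) := rfl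
    rw [hq]
    fin_cases a
    · exact walks_fwd hp h0 fun j g1 g2 => nT j (Or.inl ⟨g1, g2⟩)
    · exact walks_fwd hp h1 fun j g1 g2 => nT j (Or.inr (Or.inl ⟨g1, g2⟩))
    · exact walks_fwd hp h2 fun j g1 g2 => nT j (Or.inr (Or.inr ⟨g1, g2⟩))
    · exact absurd rfl hx.1
theorem walk_walks {k : Fin 4 → ℕ} (hk : StrictMono k) (hkd : k 3 < d) (r : S4 → S4)
    (hc : Hh σ z (d-1) = (z, false))
    (hr : ∀ x, μ (qq σ z k x) = qq σ z k (r x))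
    (hm : ∀ j b, j < d → (∀ a, j ≠ k a) → μ (pt σ z j b) = pt σ z j (!b)) (n) :
    ∀ cur m, walk4 r n cur = some m →
      Walks μ (qq σ z k cur) (m.flatMap (seg σ z k) ++ fwd σ z (k 3) d) (z, true) ∧ ∀ x ∈ m, good4 x := by
  induction n with
  | zero => intro cur m h; simp [walk4] at h
  | succ n ih =>
    intro cur m h
    rw [walk4] at h
    split at h
    · rename_i hx
      simp only [Option.some.injEq] at h
      subst h
      refine ⟨?_, by simp⟩
      simp only [List.flatMap_nil, List.nil_append]
      have e : (z, true) = Tt σ z d := by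
        have := Tt_succ σ z (d-1)
        rw [show d - 1 + 1 = d by omega, hc] at this
        exact this.symm
      rw [e]
      refine walks_fwd ?_ hkd ?_
      · rw [hr, hx]; rfl
      · intro j h1 h2
        have h' := mono4 hk
        exact hm j false h2 fun a => by fin_cases a <;> simp <;> omega
    · rename_i hx
      split at h
      · simp at h
      · rename_i hx'
        rw [Option.map_eq_some_iff] at h
        obtain ⟨m', h1, rfl⟩ := h
        obtain ⟨i1, i2⟩ := ih _ _ h1
        have g : good4 (r cur) := ⟨hx, hx'⟩
        refine ⟨?_, List.forall_mem_cons.2 ⟨g, i2⟩⟩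
        rw [List.flatMap_cons, List.append_assoc]
        exact (seg_walk hk (fun j b h => hm j b (by omega)) g (hr cur)).append i1
theorem seg_fst {k : Fin 4 → ℕ} {x : S4} (hx : good4 x) :
    ((seg σ z k x).map Prod.fst).Perm ((fwd σ z (k (blk4 x - 1)) (k (blk4 x))).map Prod.fst) := by
  obtain ⟨a, b⟩ := x
  cases b
  · exact bwd_fst _ _
  · simp only [seg, blk4, if_true, add_sub_cancel_right]; rfl
theorem flat_perm {k : Fin 4 → ℕ} {m : List S4} (hm : ∀ x ∈ m, good4 x) :
    ((m.flatMap (seg σ z k)).map Prod.fst).Perm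
    ((m.map blk4).flatMap fun b => (fwd σ z (k (b - 1)) (k b)).map Prod.fst) := by
  induction m with
  | nil => simp
  | cons x m ih =>
    simp only [List.flatMap_cons, List.map_cons, List.map_append]
    exact (seg_fst (hm x (by simp))).append (ih fun y hy => hm y (by simp [hy]))
theorem nodup4 {l : List (Fin 4)} (h : (0 :: l).Nodup) (hl : l.length = 3) : l.Perm [1,2,3] := by
  have h2 : (0 :: l).Perm [0,1,2,3] := by
    apply List.perm_of_nodup_nodup_toFinset_eq h (by decide)
    have : (0 :: l).toFinset.card = Fintype.card (Fin 4) := by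
      rw [List.toFinset_card_of_nodup h]; simp [hl]
    rw [(Finset.card_eq_iff_eq_univ _).1 this]; decide
  exact (List.perm_cons _).1 h2
theorem len4 {g : Fin 4 → ℕ} (hg : 0 < g 1 ∧ 0 < g 2 ∧ 0 < g 3) {l : List (Fin 4)} (h : (0 :: l).Nodup) (hl : l.length ≠ 3) :
    (l.map g).sum < g 1 + g 2 + g 3 := by
  have h1 : (l.map g).sum = ∑ b ∈ l.toFinset, g b := (List.sum_toFinset g (List.nodup_cons.1 h).2).symm
  have hs : l.toFinset ⊆ {1,2,3} := by
    intro b hb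
    have h0 : b ≠ 0 := by rintro rfl; exact (List.nodup_cons.1 h).1 (by simpa using hb)
    fin_cases b <;> simp_all
  have hne : l.toFinset ≠ {1,2,3} := by
    intro e
    have := List.toFinset_card_of_nodup (List.nodup_cons.1 h).2
    rw [e] at this; exact hl this.symm
  obtain ⟨b, hb, hb'⟩ := Finset.exists_of_ssubset (lt_of_le_of_ne hs hne)
  have := Finset.sum_lt_sum_of_subset (f := g) hs hb hb' (by fin_cases b <;> simp_all) (fun _ _ _ => Nat.zero_le _)
  rw [h1]; refine lt_of_lt_of_eq this ?_
  rw [Finset.sum_insert (by decide), Finset.sum_insert (by decide), Finset.sum_singleton]; ring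
theorem th_eq {k : Fin 4 → ℕ} (hk : StrictMono k) (hkd : k 3 < d) (r : S4 → S4)
    (hc : Conn σ z)
    (hr : ∀ x, μ (qq σ z k x) = qq σ z k (r x))
    (hm : ∀ j b, j < d → (∀ a, j ≠ k a) → μ (pt σ z j b) = pt σ z j (!b)) {m}
    (hw : walk4 r 4 (0, false) = some m) (hn : (0 :: m.map blk4).Nodup) :
    Th K z μ = if m.length = 3 then (IA K d).mkQ (wordOf K d (fwd σ z 0 (k 0)) *
      (m.map fun x => wordOf K d (seg σ z k x)).prod * wordOf K d (fwd σ z (k 3) (d-1))) else 0 := by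
  obtain ⟨w1, hg⟩ := walk_walks hk hkd r hc.2 hr hm 4 _ _ hw
  have h' := mono4 hk
  have w0 : Walks μ (z, true) (fwd σ z 0 (k 0)) (Tt σ z (k 0)) := by
    refine walks_fwd0 fun j hj => hm j false (by omega) fun a => by fin_cases a <;> simp <;> omega
  have w := w0.append w1
  obtain ⟨e1, e2⟩ := Walks.eq (z := z) (k := 0) (σ := μ) w
  set L := fwd σ z 0 (k 0) ++ (m.flatMap (seg σ z k) ++ fwd σ z (k 3) d) with hL
  have fd : fwd σ z (k 3) d = fwd σ z (k 3) (d-1) ++ [(z, false)] := by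
    have := fwd_succ (σ := σ) (z := z) (a := k 3) (b := d-1) (by omega)
    rw [show d - 1 + 1 = d by omega, hc.2] at this
    exact this
  split_ifs with h3
  · have p1 : ((m.flatMap (seg σ z k)).map Prod.fst).Perm ((fwd σ z (k 0) (k 3)).map Prod.fst) := by
      refine (flat_perm hg).trans (((nodup4 (List.nodup_cons.2 (List.nodup_cons.1 hn)) (by simpa using h3)).flatMap_right _).trans ?_)
      simp only [List.flatMap_cons, List.flatMap_nil, List.append_nil]
      rw [← List.map_append, ← List.map_append]
      rw [show (1:Fin 4) - 1 = 0 from rfl, show (2:Fin 4) - 1 = 1 from rfl, show (3:Fin 4) - 1 = 2 from rfl,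
        fwd_append (by omega) (by omega), fwd_append (by omega) (by omega)]
    set L' := fwd σ z 0 (k 0) ++ (m.flatMap (seg σ z k) ++ fwd σ z (k 3) (d-1)) with hL'
    have p2 : (L'.map Prod.fst).Perm ((fwd σ z 0 (d-1)).map Prod.fst) := by
      rw [← fwd_append (σ := σ) (z := z) (Nat.zero_le (k 0)) (show k 0 ≤ d-1 by omega),
        ← fwd_append (σ := σ) (z := z) (show k 0 ≤ k 3 by omega) (show k 3 ≤ d-1 by omega)]
      simp only [hL', List.map_append]
      exact (List.Perm.refl _).append (p1.append (List.Perm.refl _))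
    have hLL : L = L' ++ [(z, false)] := by simp [hL, hL', fd]
    have len : L'.length = d - 1 := by
      have := p2.length_eq
      simpa [fwd] using this
    rw [hLL, List.length_append, len, List.length_singleton, ← List.range_eq_range', List.range_succ, List.map_append] at e1
    obtain ⟨f1, f2⟩ := List.append_inj e1 (by simp [len])
    have f1' : lst μ z = L' := f1.symm
    have f2' : Hh μ z (d-1) = (z, false) := by simpa using f2.symm
    have ls : lst σ z = fwd σ z 0 (d-1) := by simp [lst, fwd, List.range_eq_range']
    have cn : Conn μ z := by
      refine ⟨?_, f2'⟩
      have := hc.1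
      unfold Full at *
      rw [f1', ← this, ls]
      exact Multiset.coe_eq_coe.2 p2
    rw [Th, if_pos cn, f1', hL', wordOf_append, wordOf_append, mul_assoc]
    congr 3
    clear * -
    induction m with
    | nil => rfl
    | cons x m ih => rw [List.flatMap_cons, wordOf_append, ih, List.map_cons, List.prod_cons]
  · rw [Th, if_neg]
    intro cn
    have hlen : L.length ≤ d - 1 := by
      have l1 := (flat_perm (σ := σ) (z := z) (k := k) hg).length_eq
      have l2 := len4 (g := fun b => k b - k (b-1)) ⟨by
        show 0 < k 1 - k 0; omega, by show 0 < k 2 - k 1; omega, by show 0 < k 3 - k 2; omega⟩ hn (by simpa using h3)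
      have l3 : (k 1 - k (1-1)) + (k 2 - k (2-1)) + (k 3 - k (3-1)) = k 3 - k 0 := by
        show (k 1 - k 0) + (k 2 - k 1) + (k 3 - k 2) = k 3 - k 0; omega
      rw [List.length_map, List.length_flatMap (l := m.map blk4)] at l1
      simp only [List.length_map, fwd_len] at l1
      rw [hL, List.length_append, List.length_append, fwd_len, fwd_len, l1]
      replace l2 : ((m.map blk4).map fun b => k b - k (b-1)).sum < (k 1 - k (1-1)) + (k 2 - k (2-1)) + (k 3 - k (3-1)) := l2
      rw [l3] at l2
      omega
    have hz : (z, false) ∈ L := by simp [hL, fd]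
    rw [e1, List.mem_map] at hz
    obtain ⟨j, hj, hz⟩ := hz
    rw [List.mem_range'_1] at hj
    have : (z, false) ∈ lst μ z := hz ▸ lst_get j (by omega)
    exact (cn.1.mem z).1 (List.mem_map.2 ⟨_, this, rfl⟩) rfl
end Gram2
section Gram3
variable {K : Type} [Field K] {d : ℕ} {σ μ : Perm (Ltr d)} {z : Fin d}
theorem val_MF {k : Fin 4 → ℕ} (hk : StrictMono k) {x : S4} (hx : good4 x) : wordOf K d (seg σ z k x) ∈ MFsub K d := by
  apply MF_word
  obtain ⟨h0, h1, h2⟩ := mono4 hk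
  obtain ⟨a, b⟩ := x
  intro h
  have := congrArg List.length h
  fin_cases a <;> cases b <;>
    first
    | exact absurd rfl hx.1
    | exact absurd rfl hx.2
    | (simp [seg, fwd, bwd] at this
       try omega)
  all_goals first
    | (change k 2 ≤ k 1 at this; omega)
    | (change k 3 ≤ k 2 at this; omega)
    | (change k 1 ≤ k 0 at this; omega)
theorem val_fl {k : Fin 4 → ℕ} (x : S4) :
    wordOf K d (seg σ z k (fl4 x)) = tp K d (wordOf K d (seg σ z k x)) := by
  obtain ⟨a, b⟩ := x
  cases b
  · simp only [seg, fl4, if_true, Bool.false_eq_true, if_false, sub_add_cancel]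
    rw [tp_bwd]
  · simp only [seg, fl4, if_true, Bool.false_eq_true, if_false, add_sub_cancel_right]
    rw [tp_fwd]
theorem v_N {f : S4 → FA K d} (Pp Qq : FA K d) (x y w : S4) (hx : f x ∈ MFsub K d) (hy : f y ∈ MFsub K d) (hw : f w ∈ MFsub K d) :
    ((N4 x y w).map fun p => p.1 • (IA K d).mkQ (Pp * (p.2.map f).prod * Qq)).sum = 0 := by
  have h := IA_r (IA_l Pp (IA_N hx hy hw)) Qq
  rw [← Submodule.Quotient.mk_eq_zero, ← Submodule.mkQ_apply] at h
  rw [← h]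
  simp only [N4, List.map_cons, List.map_nil, List.sum_cons, List.sum_nil, List.prod_cons, List.prod_nil, one_smul, add_zero, mul_one,
    ← map_add]
  congr 1; noncomm_ring
theorem v_T {f : S4 → FA K d} (hf : ∀ x, f (fl4 x) = tp K d (f x)) (Pp Qq : FA K d) (x y w : S4)
    (hx : f x ∈ MFsub K d) (hy : f y ∈ MFsub K d) (hw : f w ∈ MFsub K d) :
    ((T4 x y w).map fun p => p.1 • (IA K d).mkQ (Pp * (p.2.map f).prod * Qq)).sum = 0 := by
  have h := IA_r (IA_l Pp (IA_T hx hy hw)) Qq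
  rw [← Submodule.Quotient.mk_eq_zero, ← Submodule.mkQ_apply] at h
  rw [← h]
  simp only [T4, mul4, bar4, List.foldr, List.flatMap_cons, List.flatMap_nil, List.append_nil, List.map_append, List.sum_append,
    List.map_cons, List.map_nil, List.sum_cons, List.sum_nil, List.prod_cons, List.prod_nil, one_smul, add_zero, mul_one,
    one_mul, neg_smul, mul_neg, neg_neg, List.cons_append, List.nil_append, ← map_neg, ← map_add, hf]
  congr 1; unfold Trel bar; noncomm_ring
theorem gram_core (hσ : ∀ p, σ (σ p) = p) (hc : Conn σ z) (i : Fin 4 ↪ Ltr d) (hi : ∀ a b, i a ≠ σ (i b))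
    (k : Fin 4 → ℕ) (hk : StrictMono k) (hkd : ∀ a, k a < d) (e : Fin 4 → Bool) (he : ∀ a, i a = pt σ z (k a) (e a)) :
    ∑ π : Perm (Fin 4), ((Perm.sign π : ℤ) : K) • Th K z (rew σ i π) = 0 := by
  rw [← skel4 (fun l => (IA K d).mkQ (wordOf K d (fwd σ z 0 (k 0)) *
      (l.map fun x => wordOf K d (seg σ z k x)).prod * wordOf K d (fwd σ z (k 3) (d-1))))
      (fun x y w hx hy hw => v_N _ _ x y w (val_MF hk hx) (val_MF hk hy) (val_MF hk hw))
      (fun x y w hx hy hw => v_T val_fl _ _ x y w (val_MF hk hx) (val_MF hk hy) (val_MF hk hw)) e]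
  apply Finset.sum_congr rfl
  intro π _
  obtain ⟨m, hm, hn⟩ := chk4_ex e π
  have hwl : wl4 e π = m := by rw [wl4, hm]; rfl
  rw [hwl, sg4_eq, Int.cast_smul_eq_zsmul]
  congr 1
  refine th_eq hk (hkd 3) (rho4 e π) hc ?_ ?_ hm hn
  · rintro ⟨a, b⟩
    unfold qq rho4
    simp only
    split_ifs with h
    · subst h
      rw [← he, rew_i hσ hi, he, sig_pt hσ]
    · have hb : b = !e a := by cases b <;> cases h' : e a <;> simp_all
      rw [hb, ← sig_pt hσ, ← he]
      have := rew_j hσ hi π (π.symm a)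
      rw [Equiv.apply_symm_apply] at this
      rw [this, he]
  · intro j b hj hne
    rw [rew_o hσ hi, sig_pt hσ]
    · intro a h; rw [he] at h; exact hne a (hc.inj hj (hkd a) h).1
    · intro a h; rw [he, sig_pt hσ] at h; exact hne a (hc.inj hj (hkd a) h).1
theorem perm_ext_rew (hσ : ∀ p, σ (σ p) = p) {i : Fin 4 ↪ Ltr d} (hi : ∀ a b, i a ≠ σ (i b)) (π) (ν : Perm (Ltr d))
    (h1 : ∀ a, ν (i a) = σ (i (π a))) (h2 : ∀ a, ν (σ (i (π a))) = i a)
    (h3 : ∀ p, (∀ a, p ≠ i a) → (∀ a, p ≠ σ (i a)) → ν p = σ p) : ν = rew σ i π := by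
  ext1 p
  rcases rew_cases hσ hi π p with ⟨a, rfl⟩ | ⟨a, rfl⟩ | ⟨h, h'⟩
  · rw [h1, rew_i hσ hi]
  · rw [h2, rew_j hσ hi]
  · rw [h3 p h h', rew_o hσ hi π p h h']
theorem gram_conn (hσ : ∀ p, σ (σ p) = p) (hc : Conn σ z) (i : Fin 4 ↪ Ltr d) (hi : ∀ a b, i a ≠ σ (i b)) :
    ∑ π : Perm (Fin 4), ((Perm.sign π : ℤ) : K) • Th K z (rew σ i π) = 0 := by
  choose k e hk he using fun a => hc.ex (i a)
  have kinj : Function.Injective k := by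
    intro a b hab
    by_contra hne
    by_cases h : e a = e b
    · exact hne (i.injective (by rw [he, he, hab, h]))
    · apply hi a b
      rw [he, he, sig_pt hσ, hab]
      congr 1
      cases h1 : e a <;> cases h2 : e b <;> simp_all
  let τ := Tuple.sort k
  have hmono : StrictMono (k ∘ τ) := (Tuple.monotone_sort k).strictMono_of_injective (kinj.comp τ.injective)
  let i' : Fin 4 ↪ Ltr d := τ.toEmbedding.trans i
  have hi'a : ∀ a, i' a = i (τ a) := fun a => rfl
  have hi' : ∀ a b, i' a ≠ σ (i' b) := fun a b => hi _ _
  have h := gram_core (K := K) hσ hc i' hi' (k ∘ τ) hmono (fun a => hk _) (e ∘ τ) (fun a => he _)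
  rw [← h]
  refine Fintype.sum_equiv (MulAut.conj τ⁻¹).toEquiv _ _ fun π => ?_
  have e1 : (MulAut.conj τ⁻¹).toEquiv π = τ⁻¹ * π * τ := by simp [MulAut.conj_apply]
  rw [e1]
  congr 1
  · have : Perm.sign (τ⁻¹ * π * τ) = Perm.sign π := by
      rw [map_mul, map_mul, map_inv, mul_comm, ← mul_assoc, mul_inv_cancel, one_mul]
    rw [this]
  · congr 1
    apply perm_ext_rew hσ hi'
    · intro a; rw [hi'a, rew_i hσ hi]; simp [hi'a]
    · intro a
      rw [hi'a]
      have := rew_j hσ hi π (τ a)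
      simpa [hi'a] using this
    · intro p h1 h2
      apply rew_o hσ hi
      · intro a; have := h1 (τ⁻¹ a); simpa [hi'a] using this
      · intro a; have := h2 (τ⁻¹ a); simpa [hi'a] using this
theorem gram (σ : Perm (Ltr d)) (i : Fin 4 ↪ Ltr d) (hσ : IsMatch Finset.univ σ) (hi : ∀ a b, i a ≠ σ (i b)) :
    ∑ π : Perm (Fin 4), ((Perm.sign π : ℤ) : K) • Th K z (rew σ i π) = 0 := by
  by_cases hc : ∃ π, Conn (rew σ i π) z
  · obtain ⟨π0, hc⟩ := hc
    have hm := rew_match hσ.1 hi π0 (fun p => (hσ.2 p).2 (by simp))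
    have hi2 : ∀ a b, i a ≠ rew σ i π0 (i b) := by
      intro a b; rw [rew_i hσ.1 hi]; exact hi _ _
    have h := gram_conn (K := K) hm.1 hc i hi2
    have h' := congrArg (fun x => ((Perm.sign π0 : ℤ) : K) • x) h
    simp only [smul_zero, Finset.smul_sum] at h'
    rw [← h']
    symm
    refine Fintype.sum_equiv (Equiv.mulLeft π0) _ _ fun π => ?_
    rw [Equiv.coe_mulLeft, smul_smul]
    congr 1
    · simp
    · congr 1
      symm
      apply perm_ext_rew hm.1 hi2
      · intro a; rw [rew_i hσ.1 hi, rew_i hσ.1 hi]; rfl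
      · intro a; rw [rew_i hσ.1 hi]
        have := rew_j hσ.1 hi (π0 * π) a
        exact this
      · intro p h1 h2
        have h2' : ∀ a, p ≠ σ (i a) := by
          intro a; have := h2 (π0⁻¹ a); rw [rew_i hσ.1 hi] at this; simpa using this
        rw [rew_o hσ.1 hi _ p h1 h2', rew_o hσ.1 hi _ p h1 h2']
  · push Not at hc
    apply Finset.sum_eq_zero
    intro π _
    rw [Th, if_neg (hc π), smul_zero]
end Gram3
open Matrix
section DecS
variable {K : Type} [Field K] {d d' : ℕ}
abbrev M3 (R : Type) := Matrix (Fin 3) (Fin 3) R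
noncomputable def SubR (Y : Fin d → M3 (Rpoly K d')) : Rpoly K d →ₐ[K] Rpoly K d' :=
  MvPolynomial.aeval fun p => Y p.2.2 p.1 p.2.1
theorem SubR_X (Y : Fin d → M3 (Rpoly K d')) (p) : SubR Y (MvPolynomial.X p) = Y p.2.2 p.1 p.2.1 := by
  simp [SubR]
theorem SubR_gen (Y : Fin d → M3 (Rpoly K d')) (k) : (SubR Y).mapMatrix (genMat K d k) = Y k := by
  ext i j; simp [genMat, SubR_X]
noncomputable def cg (g : M3 K) : M3 (Rpoly K d) := g.map (algebraMap K (Rpoly K d))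
theorem cg_orth {g : M3 K} (hg : gᵀ * g = 1) : (cg g : M3 (Rpoly K d))ᵀ * cg g = 1 := by
  have := congrArg (fun M : M3 K => M.map (algebraMap K (Rpoly K d))) hg
  simp only [Matrix.map_mul] at this
  rw [cg, ← Matrix.transpose_map, this]
  exact Matrix.map_one _ (map_zero _) (map_one _)
theorem cg_orth' {g : M3 K} (hg : gᵀ * g = 1) : (cg g : M3 (Rpoly K d)) * (cg g)ᵀ = 1 :=
  mul_eq_one_comm.1 (cg_orth hg)
theorem act_gen (g : M3 K) (k) : (actHom K d g).mapMatrix (genMat K d k) = (cg g)ᵀ * genMat K d k * cg g := by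
  ext i j; simp [genMat, actHom, cg]
theorem act_cg (g h : M3 K) : (actHom K d g).mapMatrix (cg h) = cg h := by
  ext i j; simp [cg]
theorem SubR_cg (Y : Fin d → M3 (Rpoly K d')) (h : M3 K) : (SubR Y).mapMatrix (cg h) = cg h := by
  ext i j; simp [cg]
theorem SubR_act {Y : Fin d → M3 (Rpoly K d')} {g : M3 K}
    (hY : ∀ k, (actHom K d' g).mapMatrix (Y k) = (cg g)ᵀ * Y k * cg g) (f : Rpoly K d) :
    actHom K d' g (SubR Y f) = SubR Y (actHom K d g f) := by
  have : (actHom K d' g).comp (SubR Y) = (SubR Y).comp (actHom K d g) := by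
    apply MvPolynomial.algHom_ext
    rintro ⟨i, j, k⟩
    have h1 := congrFun (congrFun (hY k) i) j
    have h2 := congrArg (fun M => (SubR Y).mapMatrix M) (act_gen (d := d) g k)
    have ht : (SubR Y).mapMatrix ((cg g : M3 (Rpoly K d))ᵀ) = (cg g)ᵀ := by
      rw [← SubR_cg Y g]; rfl
    simp only [map_mul, SubR_cg, ht, SubR_gen] at h2
    have h3 := congrFun (congrFun h2 i) j
    rw [← h3] at h1
    simpa [genMat, SubR_X] using h1
  exact congrArg (fun h => h f) this |>.trans rfl
theorem ev_act {g : M3 K} (hg : gᵀ * g = 1) (a : FA K d) :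
    (actHom K d g).mapMatrix (evMat K d a) = (cg g)ᵀ * evMat K d a * cg g := by
  induction a using FreeAlgebra.induction with
  | grade0 r =>
    rw [AlgHom.commutes, AlgHom.commutes, Algebra.algebraMap_eq_smul_one, mul_smul_comm, mul_one, smul_mul_assoc, cg_orth hg]
  | grade1 x =>
    rw [evMat, FreeAlgebra.lift_ι_apply]
    split
    · have := congrArg Matrix.transpose (act_gen (d := d) g x.1)
      rw [Matrix.transpose_mul, Matrix.transpose_mul, Matrix.transpose_transpose] at this
      rw [mul_assoc, ← this]; rfl
    · exact act_gen g x.1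
  | add a b ha hb => rw [map_add, map_add, ha, hb, mul_add, add_mul]
  | mul a b ha hb =>
    rw [map_mul, map_mul, ha, hb]
    calc _ = (cg g)ᵀ * evMat K d a * (cg g * (cg g)ᵀ) * evMat K d b * cg g := by simp only [mul_assoc]
      _ = _ := by rw [cg_orth' hg, mul_one]; simp only [mul_assoc]
theorem tr_ev_inv (a : FA K d) : trace (evMat K d a) ∈ invAlg K d := by
  intro g hg
  have h := congrArg trace (ev_act hg a)
  rw [Matrix.trace_mul_cycle, cg_orth' hg, one_mul] at h
  refine Eq.trans ?_ h; simp [trace]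
theorem ev_tp (a : FA K d) : evMat K d (tp K d a) = (evMat K d a)ᵀ := by
  induction a using FreeAlgebra.induction with
  | grade0 r =>
    rw [Algebra.algebraMap_eq_smul_one, tp_smul, tp_one, map_smul, map_one, Matrix.transpose_smul, Matrix.transpose_one]
  | grade1 x =>
    rw [tp_iota, evMat, FreeAlgebra.lift_ι_apply, FreeAlgebra.lift_ι_apply]
    rcases x with ⟨k, b⟩; cases b <;> simp [flp]
  | add a b ha hb => rw [tp_add, map_add, map_add, ha, hb, Matrix.transpose_add]
  | mul a b ha hb => rw [tp_mul, map_mul, map_mul, ha, hb, Matrix.transpose_mul]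
theorem ev_const (a : FA K d) : (constantCoeff : Rpoly K d →+* K).mapMatrix (evMat K d a) = aug a • 1 := by
  induction a using FreeAlgebra.induction with
  | grade0 r =>
    rw [AlgHom.commutes, AlgHom.commutes]
    ext i j; simp [Matrix.algebraMap_matrix_apply, Matrix.one_apply]; split <;> simp
  | grade1 x =>
    rw [evMat, FreeAlgebra.lift_ι_apply, aug, FreeAlgebra.lift_ι_apply]
    ext i j; split <;> simp [genMat]
  | add a b ha hb => rw [map_add, map_add, ha, hb, map_add, add_smul]
  | mul a b ha hb => rw [map_mul, map_mul, ha, hb, map_mul, smul_mul_smul_comm, mul_one]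
theorem ev_const0 {a : FA K d} (ha : a ∈ MFsub K d) (i j) : constantCoeff (evMat K d a i j) = 0 := by
  have := congrFun (congrFun (ev_const a) i) j
  rw [(mem_MF a).1 ha] at this
  simpa using this
def IPl (f : Rpoly K d) : Prop := f ∈ invAlg K d ∧ constantCoeff f = 0
noncomputable def Dec (K : Type) [Field K] (d : ℕ) : Submodule K (Rpoly K d) :=
  span K {h | ∃ f g, IPl f ∧ IPl g ∧ h = f * g}
theorem Dec_mul {f g : Rpoly K d} (hf : IPl f) (hg : IPl g) : f * g ∈ Dec K d :=
  subset_span ⟨f, g, hf, hg, rfl⟩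
theorem IPl.mul {f g : Rpoly K d} (hf : IPl f) (hg : g ∈ invAlg K d) : IPl (f * g) :=
  ⟨mul_mem hf.1 hg, by rw [map_mul, hf.2, zero_mul]⟩
theorem IPl.add {f g : Rpoly K d} (hf : IPl f) (hg : IPl g) : IPl (f + g) :=
  ⟨add_mem hf.1 hg.1, by rw [map_add, hf.2, hg.2, zero_add]⟩
theorem IPl.smul {f : Rpoly K d} (hf : IPl f) (c : K) : IPl (c • f) :=
  ⟨Subalgebra.smul_mem _ hf.1 c, by rw [MvPolynomial.smul_eq_C_mul, map_mul, hf.2, mul_zero]⟩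
theorem tr_IPl {a : FA K d} (ha : a ∈ MFsub K d) : IPl (trace (evMat K d a)) :=
  ⟨tr_ev_inv a, by rw [trace, map_sum]; exact Finset.sum_eq_zero fun i _ => ev_const0 ha i i⟩
theorem act_comp {M : Type} [AddCommMonoid M] [DecidableEq M] (w : Fin d → M) (n : M) (g : M3 K) (f : Rpoly K d) :
    MvPolynomial.weightedHomogeneousComponent (fun p : Fin 3 × Fin 3 × Fin d => w p.2.2) n (actHom K d g f) =
    actHom K d g (MvPolynomial.weightedHomogeneousComponent (fun p : Fin 3 × Fin 3 × Fin d => w p.2.2) n f) := by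
  classical
  set W := (fun p : Fin 3 × Fin 3 × Fin d => w p.2.2) with hW
  have hh : ∀ m c, MvPolynomial.IsWeightedHomogeneous W (actHom K d g (MvPolynomial.monomial m c)) (Finsupp.weight W m) := by
    intro m c
    rw [actHom, MvPolynomial.aeval_monomial, ← zero_add (Finsupp.weight W m)]
    refine MvPolynomial.IsWeightedHomogeneous.mul (MvPolynomial.isWeightedHomogeneous_C W c) ?_
    rw [Finsupp.weight_apply, Finsupp.prod, Finsupp.sum]
    refine MvPolynomial.IsWeightedHomogeneous.prod _ _ _ fun p _ => ?_
    refine MvPolynomial.IsWeightedHomogeneous.pow ?_ _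
    rw [mul_apply]
    refine MvPolynomial.IsWeightedHomogeneous.sum _ _ _ fun j _ => ?_
    rw [mul_apply, Finset.sum_mul]
    refine MvPolynomial.IsWeightedHomogeneous.sum _ _ _ fun i _ => ?_
    have h1 : MvPolynomial.IsWeightedHomogeneous W (MvPolynomial.X (i, j, p.2.2) : Rpoly K d) (W p) :=
      MvPolynomial.isWeightedHomogeneous_X K W _
    have h2 := (MvPolynomial.isWeightedHomogeneous_C W (g i p.1)).mul (h1.mul (MvPolynomial.isWeightedHomogeneous_C W (g j p.2.1)))
    rw [zero_add, add_zero] at h2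
    convert h2 using 1
    simp [genMat, mul_assoc];
  induction f using MvPolynomial.induction_on' with
  | monomial m c =>
    have h2 := MvPolynomial.isWeightedHomogeneous_monomial W m c (m := Finsupp.weight W m) rfl
    by_cases h : Finsupp.weight W m = n
    · subst h
      rw [(hh m c).weightedHomogeneousComponent_same, h2.weightedHomogeneousComponent_same]
    · rw [(hh m c).weightedHomogeneousComponent_ne _ (Ne.symm h), h2.weightedHomogeneousComponent_ne _ (Ne.symm h), map_zero]
  | add p q hp hq => simp only [map_add, hp, hq]
end DecS
open Matrix
section DecT
variable {K : Type} [Field K] {d d' : ℕ}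
theorem act_const {g : M3 K} (f : Rpoly K d) : constantCoeff (actHom K d g f) = constantCoeff f := by
  induction f using MvPolynomial.induction_on with
  | C a => simp [actHom]
  | add p q hp hq => rw [map_add, map_add, map_add, hp, hq]
  | mul_X p i hp =>
    rw [map_mul, map_mul, map_mul]
    simp [actHom, mul_apply, genMat]
theorem decomp_sub : decompSet K d ⊆ Dec K d := by
  rintro _ ⟨f, hf, rfl⟩
  have h1 : plusIdeal K d ≤ RingHom.ker ((constantCoeff : Rpoly K d →+* K).comp (invAlg K d).val.toRingHom) := by
    rw [plusIdeal, Ideal.span_le]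
    rintro f ⟨n, hn, hf⟩
    show constantCoeff (f : Rpoly K d) = 0
    rw [MvPolynomial.constantCoeff_eq]
    exact hf.coeff_eq_zero (by simpa using hn.ne)
  have hf' : f ∈ plusIdeal K d ^ 2 := hf
  rw [pow_two] at hf'
  show (f : Rpoly K d) ∈ Dec K d
  induction hf' using Submodule.mul_induction_on' with
  | mem_mul_mem m hm n hn => exact Dec_mul ⟨m.2, h1 hm⟩ ⟨n.2, h1 hn⟩
  | add x hx y hy h1 h2 =>
    exact add_mem (h1 (by rw [pow_two]; exact hx)) (h2 (by rw [pow_two]; exact hy))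
theorem IPl_plus {f : Rpoly K d} (hf : IPl f) : (⟨f, hf.1⟩ : invAlg K d) ∈ plusIdeal K d := by
  have key : ∀ n, MvPolynomial.homogeneousComponent n f ∈ invAlg K d := by
    intro n g hg
    have := act_comp (K := K) (d := d) (fun _ => (1 : ℕ)) n g f
    rw [hf.1 g hg] at this
    exact this.symm
  have e : (⟨f, hf.1⟩ : invAlg K d) = ∑ n ∈ Finset.range (f.totalDegree + 1), ⟨_, key n⟩ := by
    apply Subtype.ext
    rw [AddSubmonoidClass.coe_finset_sum]
    exact (MvPolynomial.sum_homogeneousComponent f).symm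
  rw [e]
  refine Ideal.sum_mem _ fun n _ => ?_
  rcases Nat.eq_zero_or_pos n with rfl | hn
  · have := hf.2
    rw [MvPolynomial.constantCoeff_eq] at this
    convert Ideal.zero_mem (plusIdeal K d)
    simp [MvPolynomial.homogeneousComponent_zero, this]
  · exact Ideal.subset_span ⟨n, hn, MvPolynomial.homogeneousComponent_isHomogeneous n f⟩
theorem decomp_iff (f : Rpoly K d) : f ∈ decompSet K d ↔ f ∈ Dec K d := by
  refine ⟨fun h => decomp_sub h, fun h => ?_⟩
  have : Dec K d ≤ ((plusIdeal K d ^ 2 : Ideal (invAlg K d)).restrictScalars K).map (invAlg K d).val.toLinearMap := by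
    rw [Dec, span_le]
    rintro _ ⟨f, g, hf, hg, rfl⟩
    refine ⟨⟨f, hf.1⟩ * ⟨g, hg.1⟩, ?_, rfl⟩
    show _ ∈ plusIdeal K d ^ 2
    rw [pow_two]
    exact Ideal.mul_mem_mul (IPl_plus hf) (IPl_plus hg)
  obtain ⟨x, hx, rfl⟩ := this h
  exact ⟨x, hx, rfl⟩
theorem Dec_IPl {f g : Rpoly K d} (hf : f ∈ Dec K d) (hg : g ∈ invAlg K d) : f * g ∈ Dec K d := by
  rw [Dec] at hf
  induction hf using span_induction with
  | mem x hx => obtain ⟨a, b, ha, hb, rfl⟩ := hx; rw [mul_assoc]; exact Dec_mul ha (hb.mul hg)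
  | zero => rw [zero_mul]; exact zero_mem _
  | add x y _ _ hx hy => rw [add_mul]; exact add_mem hx hy
  | smul c x _ hx => rw [smul_mul_assoc]; exact smul_mem _ _ hx
theorem SubR_const {Y : Fin d → M3 (Rpoly K d')} (hY : ∀ k i j, constantCoeff (Y k i j) = 0) (f : Rpoly K d) :
    constantCoeff (SubR Y f) = constantCoeff f := by
  induction f using MvPolynomial.induction_on with
  | C a => simp [SubR]
  | add p q hp hq => rw [map_add, map_add, map_add, hp, hq]
  | mul_X p i hp => rw [map_mul, map_mul, map_mul, SubR_X, hY]; simp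
theorem SubR_Dec {Y : Fin d → M3 (Rpoly K d')} (hY : ∀ k i j, constantCoeff (Y k i j) = 0)
    (hA : ∀ g : M3 K, gᵀ * g = 1 → ∀ k, (actHom K d' g).mapMatrix (Y k) = (cg g)ᵀ * Y k * cg g) {f : Rpoly K d} (hf : f ∈ Dec K d) :
    SubR Y f ∈ Dec K d' := by
  have hI : ∀ f : Rpoly K d, IPl f → IPl (SubR Y f) := fun f hf =>
    ⟨fun g hg => by rw [SubR_act (hA g hg), hf.1 g hg], by rw [SubR_const hY, hf.2]⟩
  have : Dec K d ≤ (Dec K d').comap (SubR Y).toLinearMap := by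
    conv_lhs => rw [Dec]
    rw [span_le]
    rintro _ ⟨f, g, hf, hg, rfl⟩
    show SubR Y (f * g) ∈ Dec K d'
    rw [map_mul]; exact Dec_mul (hI f hf) (hI g hg)
  exact this hf
noncomputable def Dk (k : Fin d) : Derivation K (Rpoly K d) (Rpoly K d) :=
  ∑ i : Fin 3, MvPolynomial.pderiv (i, i, k)
theorem Dk_X (k : Fin d) (i j l) : Dk (K := K) k (MvPolynomial.X (i, j, l)) = if i = j ∧ l = k then 1 else 0 := by
  rw [Dk, sum_univ_three]
  simp only [Derivation.add_apply, MvPolynomial.pderiv_X, Pi.single_apply, Prod.mk.injEq]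
  by_cases h : l = k
  · fin_cases i <;> fin_cases j <;> simp [h]
  · simp [h]
theorem Dk_act {g : M3 K} (hg : gᵀ * g = 1) (k : Fin d) (f : Rpoly K d) :
    Dk k (actHom K d g f) = actHom K d g (Dk k f) := by
  induction f using MvPolynomial.induction_on with
  | C a =>
    have : actHom K d g (MvPolynomial.C a) = MvPolynomial.C a := (actHom K d g).commutes a
    rw [this]
    have : Dk k (MvPolynomial.C a : Rpoly K d) = 0 := (Dk k).map_algebraMap a
    rw [this, map_zero]
  | add p q hp hq => simp only [map_add, hp, hq]
  | mul_X p i hp =>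
    rw [map_mul, Derivation.leibniz, Derivation.leibniz, hp, map_add, smul_eq_mul, smul_eq_mul, smul_eq_mul, smul_eq_mul, map_mul, map_mul]
    congr 2
    obtain ⟨i, j, l⟩ := i
    have h1 := congrFun (congrFun (act_gen (d := d) g l) i) j
    have h1' : actHom K d g (MvPolynomial.X (i, j, l)) = ((cg g)ᵀ * genMat K d l * cg g : M3 (Rpoly K d)) i j := h1
    rw [h1', Dk_X]
    have hc : ∀ a b, Dk k ((cg g : M3 (Rpoly K d)) a b) = 0 := fun a b => (Dk k).map_algebraMap (g a b)
    have h3 : Dk k (((cg g)ᵀ * genMat K d l * cg g : M3 (Rpoly K d)) i j) = if l = k then ((cg g)ᵀ * cg g : M3 (Rpoly K d)) i j else 0 := by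
      simp only [mul_apply, Matrix.transpose_apply, map_sum, Derivation.leibniz, hc, smul_zero, add_zero, zero_add, genMat, Matrix.of_apply, Dk_X, Finset.sum_mul, smul_eq_mul]
      split
      · rename_i h; simp [h]
        refine Finset.sum_congr rfl fun a _ => by ring
      · rename_i h; simp [h]
    rw [h3, cg_orth hg, Matrix.one_apply]
    by_cases h : l = k <;> by_cases h' : i = j <;> simp [h, h']
theorem Dk_gen (k l : Fin d) (i j) : Dk (K := K) k (genMat K d l i j) = if l = k then (1 : M3 (Rpoly K d)) i j else 0 := by
  rw [genMat, Matrix.of_apply, Dk_X, Matrix.one_apply]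
  by_cases h : l = k <;> by_cases h' : i = j <;> simp [h, h']
theorem Dk_const [CharP K 3] (k : Fin d) {f : Rpoly K d} (hf : f ∈ invAlg K d) : constantCoeff (Dk k f) = 0 := by
  have hl : ∀ (g : M3 K) (i j : Fin 3), constantCoeff (MvPolynomial.pderiv (i, j, k) (actHom K d g f)) =
      ∑ a, ∑ b, constantCoeff (MvPolynomial.pderiv (a, b, k) f) * (g i a * g j b) := by
    intro g i j
    generalize f = f'
    induction f' using MvPolynomial.induction_on with
    | C a =>
      have : actHom K d g (MvPolynomial.C a) = MvPolynomial.C a := (actHom K d g).commutes a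
      simp [this]
    | add p q hp hq => simp only [map_add, hp, hq, add_mul, Finset.sum_add_distrib]
    | mul_X p x hp =>
      obtain ⟨x, y, l⟩ := x
      rw [map_mul, Derivation.leibniz, map_add, smul_eq_mul, smul_eq_mul, map_mul, map_mul, hp, act_const, act_const]
      have h1 := congrFun (congrFun (act_gen (d := d) g l) x) y
      have h1' : actHom K d g (MvPolynomial.X (x, y, l)) = ((cg g)ᵀ * genMat K d l * cg g : M3 (Rpoly K d)) x y := h1
      have hc : ∀ a b, (cg g : M3 (Rpoly K d)) a b = MvPolynomial.C (g a b) := fun a b => rfl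
      rw [h1']
      simp only [mul_apply, Matrix.transpose_apply, map_sum, Derivation.leibniz, hc, MvPolynomial.pderiv_C, smul_zero, add_zero, zero_add, genMat, Matrix.of_apply, MvPolynomial.pderiv_X, Finset.sum_mul, smul_eq_mul, map_mul, map_add, MvPolynomial.constantCoeff_C, MvPolynomial.constantCoeff_X, mul_zero, zero_mul, Pi.single_apply, Prod.mk.injEq]
      by_cases h : l = k
      · simp [h, ite_and, apply_ite]
        exact Or.inl (mul_comm _ _)
      · simp [h]
  have h3 : (3 : K) = 0 := by exact_mod_cast CharP.cast_eq_zero K 3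
  have hp : ∀ τ : Perm (Fin 3), ∀ i, constantCoeff (MvPolynomial.pderiv (i, i, k) f) = constantCoeff (MvPolynomial.pderiv (τ i, τ i, k) f) := by
    intro τ i
    have ho : (τ.permMatrix K)ᵀ * τ.permMatrix K = 1 := by
      rw [Matrix.transpose_permMatrix, ← Matrix.permMatrix_mul]; simp
    have := hl (τ.permMatrix K) i i
    rw [hf _ ho] at this
    rw [this]
    simp [Perm.permMatrix, PEquiv.toMatrix_apply, Equiv.toPEquiv_apply]
  rw [Dk, sum_univ_three, Derivation.add_apply, Derivation.add_apply, map_add, map_add]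
  have e1 := hp (Equiv.swap 0 1) 0
  have e2 := hp (Equiv.swap 0 2) 0
  rw [Equiv.swap_apply_left] at e1 e2
  rw [← e1, ← e2]
  linear_combination constantCoeff (MvPolynomial.pderiv ((0 : Fin 3), (0 : Fin 3), k) f) * h3
theorem Dk_Dec [CharP K 3] (k : Fin d) {f : Rpoly K d} (hf : f ∈ Dec K d) : Dk k f ∈ Dec K d := by
  have hI : ∀ f : Rpoly K d, IPl f → IPl (Dk k f) := fun f hf =>
    ⟨fun g hg => by rw [← Dk_act hg, hf.1 g hg], Dk_const k hf.1⟩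
  have : Dec K d ≤ (Dec K d).comap (Dk k : Derivation K (Rpoly K d) (Rpoly K d)).toLinearMap := by
    conv_lhs => rw [Dec]
    rw [span_le]
    rintro _ ⟨f, g, hf, hg, rfl⟩
    show Dk k (f * g) ∈ Dec K d
    rw [Derivation.leibniz]
    exact add_mem (Dec_mul hf (hI g hg)) (Dec_mul hg (hI f hf))
  exact this hf
end DecT
open Matrix
section Bwd
variable {K : Type} [Field K] {d d' : ℕ}
theorem CH3 {R : Type} [CommRing R] (A : M3 R) :
    (2 : R) • A ^ 3 = (2 * A.trace) • A ^ 2 - (A.trace ^ 2 - (A ^ 2).trace) • A + (2 * A.det) • (1 : M3 R) := by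
  ext i j
  fin_cases i <;> fin_cases j <;>
    simp [pow_succ, mul_apply, sum_univ_three, trace, Matrix.det_fin_three] <;> ring
theorem skew3 {R : Type} [CommRing R] (A : M3 R) : ∃ a b c, A - Aᵀ = !![0, a, b; -a, 0, c; -b, -c, 0] := by
  refine ⟨A 0 1 - A 1 0, A 0 2 - A 2 0, A 1 2 - A 2 1, ?_⟩
  ext i j; fin_cases i <;> fin_cases j <;> simp
theorem Tid3 {R : Type} [CommRing R] (A M N : M3 R) (B C : M3 R) (hB : B = M - Mᵀ) (hC : C = N - Nᵀ) :
    (2 : R) • (A * B * C + B * Aᵀ * C + B * C * A) =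
     (B * C).trace • A + (2 * A.trace) • (B * C) + (2 * (A * B * C).trace - (B * C).trace * A.trace) • (1 : M3 R) := by
  obtain ⟨b1, b2, b3, h⟩ := skew3 M
  obtain ⟨c1, c2, c3, h'⟩ := skew3 N
  rw [hB, hC, h, h']
  ext i j
  simp only [Matrix.add_apply, Matrix.smul_apply, mul_apply, Matrix.one_apply, sum_univ_three, trace, Matrix.diag_apply, Matrix.transpose_apply]
  fin_cases i <;> fin_cases j <;> simp <;> ring
theorem det_IPl {a : FA K d} (ha : a ∈ MFsub K d) : IPl (Matrix.det (evMat K d a)) := by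
  constructor
  · intro g hg
    have h := congrArg Matrix.det (ev_act hg a)
    have h2 := congrArg Matrix.det (cg_orth (d := d) hg)
    rw [Matrix.det_mul, Matrix.det_one] at h2
    rw [Matrix.det_mul, Matrix.det_mul, mul_right_comm, h2, one_mul] at h
    rw [← AlgHom.map_det] at h
    exact h
  · rw [RingHom.map_det, ev_const, (mem_MF a).1 ha]; simp
theorem tr_MF {a b : FA K d} (ha : a ∈ MFsub K d) (hb : b ∈ MFsub K d) :
    trace (evMat K d a) * trace (evMat K d b) ∈ Dec K d := Dec_mul (tr_IPl ha) (tr_IPl hb)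
theorem half_Dec (h2 : (2 : K) ≠ 0) {f : Rpoly K d} (h : 2 * f ∈ Dec K d) : f ∈ Dec K d := by
  have := smul_mem _ (2⁻¹ : K) h
  have e : (2⁻¹ : K) • (2 * f) = f := by
    have : (2 : Rpoly K d) * f = (2 : K) • f := by rw [ofNat_smul_eq_nsmul, nsmul_eq_mul]; rfl
    rw [this, smul_smul, inv_mul_cancel₀ h2, one_smul]
  rwa [e] at this
noncomputable def SDec (K : Type) [Field K] (d : ℕ) : Submodule K (FA K d) where
  carrier := {v | ∀ w ∈ MFsub K d, trace (evMat K d (v * w)) ∈ Dec K d}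
  add_mem' := fun ha hb w hw => by
    rw [add_mul, map_add, Matrix.trace_add]; exact add_mem (ha w hw) (hb w hw)
  zero_mem' := fun w hw => by rw [zero_mul, map_zero, Matrix.trace_zero]; exact zero_mem _
  smul_mem' := fun c x hx w hw => by
    rw [smul_mul_assoc, map_smul, Matrix.trace_smul]; exact smul_mem _ _ (hx w hw)
theorem IA_Dec (h2 : (2 : K) ≠ 0) {v w : FA K d} (hv : v ∈ IA K d) (hw : w ∈ MFsub K d) :
    trace (evMat K d (v * w)) ∈ Dec K d := by
  have key : IA K d ≤ SDec K d := by
    apply IA_ind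
    · intro x y a ha
      intro w hw
      show trace (evMat K d (x * a ^ 3 * y * w)) ∈ Dec K d
      have e : trace (evMat K d (x * a ^ 3 * y * w)) = trace (evMat K d a ^ 3 * evMat K d (y * w * x)) := by
        simp only [map_mul, map_pow, mul_assoc]; rw [Matrix.trace_mul_comm]; simp only [mul_assoc]
      rw [e]
      set b := y * w * x with hb
      have mb : b ∈ MFsub K d := MF_mul_right _ (MF_mul_left _ hw)
      apply half_Dec h2
      have h := congrArg (fun M => trace (M * evMat K d b)) (CH3 (evMat K d a))
      simp only [add_mul, sub_mul, smul_mul_assoc, one_mul, Matrix.trace_add, Matrix.trace_sub, Matrix.trace_smul, smul_eq_mul, nsmul_eq_mul, Nat.cast_ofNat] at h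
      rw [h, ← map_pow, ← map_mul, ← map_mul]
      have m2 : a ^ 2 ∈ MFsub K d := by rw [pow_two]; exact MF_mul_left _ ha
      refine add_mem (sub_mem ?_ ?_) ?_
      · rw [mul_assoc, two_mul]; exact add_mem (tr_MF ha (MF_mul_left _ mb)) (tr_MF ha (MF_mul_left _ mb))
      · refine sub_mem ?_ (tr_MF m2 (MF_mul_left _ mb))
        rw [pow_two, mul_assoc]
        exact Dec_mul (tr_IPl ha) ((tr_IPl ha).mul (tr_IPl (MF_mul_left _ mb)).1)
      · rw [mul_assoc, two_mul]; exact add_mem (Dec_mul (det_IPl ha) (tr_IPl mb)) (Dec_mul (det_IPl ha) (tr_IPl mb))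
    · intro x y a b c ha hb hc
      intro w hw
      show trace (evMat K d (x * Trel K d a b c * y * w)) ∈ Dec K d
      have e : trace (evMat K d (x * Trel K d a b c * y * w)) = trace (evMat K d (Trel K d a b c) * evMat K d (y * w * x)) := by
        simp only [map_mul, mul_assoc]; rw [Matrix.trace_mul_comm]; simp only [mul_assoc]
      rw [e]
      set z := y * w * x with hz
      have mz : z ∈ MFsub K d := MF_mul_right _ (MF_mul_left _ hw)
      have mb := MF_bar hb
      have mc := MF_bar hc
      apply half_Dec h2
      have hbar : ∀ b, evMat K d (bar K d b) = evMat K d b - (evMat K d b)ᵀ := fun b => by rw [bar, map_sub, ev_tp]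
      have h := congrArg (fun M => trace (M * evMat K d z)) (Tid3 (evMat K d a) _ _ _ _ (hbar b) (hbar c))
      rw [← ev_tp] at h
      simp only [← map_mul, ← map_add] at h
      simp only [add_mul, sub_mul, smul_mul_assoc, one_mul, Matrix.trace_add, Matrix.trace_sub, Matrix.trace_smul, smul_eq_mul, nsmul_eq_mul, Nat.cast_ofNat, ← map_mul] at h
      rw [Trel, ← map_mul, add_mul, add_mul, h]
      refine add_mem (add_mem ?_ ?_) (sub_mem ?_ ?_)
      · exact tr_MF (MF_mul_left _ mc) (MF_mul_left _ mz)
      · rw [mul_assoc, two_mul]; exact add_mem (tr_MF ha (MF_mul_left _ mz)) (tr_MF ha (MF_mul_left _ mz))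
      · rw [mul_assoc, two_mul]; exact add_mem (tr_MF (MF_mul_left _ mc) mz) (tr_MF (MF_mul_left _ mc) mz)
      · rw [mul_assoc]; exact Dec_mul (tr_IPl (MF_mul_left _ mc)) ((tr_IPl ha).mul (tr_IPl mz).1)
  exact key hv w hw
end Bwd
open Matrix
section MLP
variable {K : Type} [Field K] {d : ℕ}
noncomputable def Wt (d : ℕ) (p : Fin 3 × Fin 3 × Fin d) : Fin d → ℕ := Pi.single p.2.2 1
def nS (S : Finset (Fin d)) : Fin d → ℕ := fun k => if k ∈ S then 1 else 0
def SB (S : Finset (Fin d)) : Finset (Ltr d) := S ×ˢ Finset.univ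
theorem mem_SB {S : Finset (Fin d)} {p : Ltr d} : p ∈ SB S ↔ p.1 ∈ S := by simp [SB]
noncomputable def vev (v : Ltr d → Fin 3 → K) : Rpoly K d →ₐ[K] K :=
  MvPolynomial.aeval fun p => v (p.2.2, false) p.1 * v (p.2.2, true) p.2.1
noncomputable def cS (S : Finset (Fin d)) : Rpoly K d →ₗ[K] Rpoly K d := MvPolynomial.weightedHomogeneousComponent (Wt d) (nS S)
theorem wt_apply (m : Fin 3 × Fin 3 × Fin d →₀ ℕ) (k : Fin d) : Finsupp.weight (Wt d) m k = ∑ p, if p.2.2 = k then m p else 0 := by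
  rw [Finsupp.weight_apply, Finsupp.sum_fintype _ _ (by simp), Finset.sum_apply]
  refine Finset.sum_congr rfl fun p _ => ?_
  simp [Wt, Pi.single_apply, eq_comm]
theorem mono_form {S : Finset (Fin d)} {m : Fin 3 × Fin 3 × Fin d →₀ ℕ} (hm : Finsupp.weight (Wt d) m = nS S) (a : K) :
    ∃ e : Ltr d → Fin 3, ∀ v, vev v (MvPolynomial.monomial m a) = a * ∏ p ∈ SB S, v p (e p) := by
  have h1 : ∀ k, ∃ q : Fin 3 × Fin 3, k ∈ S → m (q.1, q.2, k) = 1 ∧ ∀ i j, (i, j) ≠ q → m (i, j, k) = 0 := by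
    intro k
    by_cases hk : k ∈ S
    · have h := congrFun hm k
      rw [wt_apply, nS, if_pos hk] at h
      have hex : ∃ p : Fin 3 × Fin 3 × Fin d, (if p.2.2 = k then m p else 0) ≠ 0 := by
        by_contra hc
        push Not at hc
        rw [Finset.sum_eq_zero fun p _ => hc p] at h
        exact absurd h (by norm_num)
      obtain ⟨⟨i, j, k'⟩, hp⟩ := hex
      have hk' : k' = k := by by_contra hne; simp [hne] at hp
      subst hk'
      simp only [if_true] at hp
      refine ⟨(i, j), fun _ => ?_⟩
      rw [← Finset.add_sum_erase _ _ (Finset.mem_univ (i, j, k'))] at h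
      simp only [if_true] at h
      have h0 : ∑ x ∈ Finset.univ.erase (i, j, k'), (if x.2.2 = k' then m x else 0) = 0 := by omega
      refine ⟨by dsimp; omega, fun i' j' hne => ?_⟩
      rw [Finset.sum_eq_zero_iff] at h0
      have := h0 (i', j', k') (by simp at hne ⊢; exact hne)
      simpa using this
    · exact ⟨(0, 0), fun h => absurd h hk⟩
  choose q hq using h1
  have h2 : ∀ k ∉ S, ∀ i j, m (i, j, k) = 0 := by
    intro k hk i j
    have h := congrFun hm k
    rw [wt_apply, nS, if_neg hk, Finset.sum_eq_zero_iff] at h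
    simpa using h (i, j, k) (Finset.mem_univ _)
  refine ⟨fun p => if p.2 then (q p.1).2 else (q p.1).1, fun v => ?_⟩
  rw [vev, MvPolynomial.aeval_monomial, Finsupp.prod_fintype _ _ (by simp)]
  congr 1
  rw [SB, Finset.prod_product, ← Finset.prod_subset (Finset.subset_univ (S.image fun k => ((q k).1, (q k).2, k))), Finset.prod_image]
  · refine Finset.prod_congr rfl fun k hk => ?_
    rw [(hq k hk).1]; simp [mul_comm]
  · intro a _ b _ h; simp at h; exact h.2.2
  · rintro ⟨i, j, k⟩ _ hx
    have : m (i, j, k) = 0 := by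
      by_cases hk : k ∈ S
      · apply (hq k hk).2
        intro he; apply hx; simp only [Finset.mem_image]; exact ⟨k, hk, by rw [← he]⟩
      · exact h2 k hk i j
    rw [this, pow_zero]
theorem ml_prod (S : Finset (Ltr d)) (a : K) (e : Ltr d → Fin 3) : IsML S (fun v => a * ∏ p ∈ S, v p (e p)) := by
  constructor
  · intro p hp v x
    congr 1
    refine Finset.prod_congr rfl fun q hq => ?_
    rw [update_of_ne]; rintro rfl; exact hp hq
  · intro p hp v x y c
    have : ∀ z, ∏ q ∈ S, update v p z q (e q) = z (e p) * ∏ q ∈ S.erase p, v q (e q) := by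
      intro z
      rw [← Finset.mul_prod_erase _ _ hp, Function.update_self]
      congr 1
      refine Finset.prod_congr rfl fun q hq => ?_
      rw [update_of_ne (Finset.ne_of_mem_erase hq)]
    rw [this, this, this]
    simp only [Pi.add_apply, Pi.smul_apply, smul_eq_mul]; ring
theorem ml_cS (S : Finset (Fin d)) (f : Rpoly K d) : IsML (SB S) (fun v => vev v (cS S f)) := by
  classical
  have h : ∀ T : Finset (Fin 3 × Fin 3 × Fin d →₀ ℕ), (∀ m ∈ T, Finsupp.weight (Wt d) m = nS S) →
      IsML (SB S) (fun v => ∑ m ∈ T, vev v (MvPolynomial.monomial m (MvPolynomial.coeff m f))) := by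
    intro T hT
    have h' : ∀ m ∈ T, IsML (SB S) (fun v => vev v (MvPolynomial.monomial m (MvPolynomial.coeff m f))) := by
      intro m hm
      obtain ⟨e, he⟩ := mono_form (hT m hm) (MvPolynomial.coeff m f)
      have := ml_prod (SB S) (MvPolynomial.coeff m f) e
      simp only [← he] at this
      exact this
    constructor
    · intro p hp v x
      exact Finset.sum_congr rfl fun m hm => (h' m hm).indep p hp v x
    · intro p hp v x y c
      rw [Finset.mul_sum, ← Finset.sum_add_distrib]
      exact Finset.sum_congr rfl fun m hm => (h' m hm).lin p hp v x y c
  have := h (f.support.filter fun m => Finsupp.weight (Wt d) m = nS S) (fun m hm => (Finset.mem_filter.1 hm).2)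
  simp only [cS, MvPolynomial.weightedHomogeneousComponent_apply, map_sum]
  exact this
def chi (σ : Perm (Ltr d)) : (Ltr d → Fin 3) → K := fun c => if ∀ p, c (σ p) = c p then 1 else 0
noncomputable def stp (c : Ltr d → Fin 3) : Ltr d → Fin 3 → K := fun p => Pi.single (c p) 1
theorem vev_act {g : M3 K} (v : Ltr d → Fin 3 → K) (f : Rpoly K d) :
    vev (fun p => g *ᵥ v p) f = vev v (actHom K d gᵀ f) := by
  have : vev (fun p => g *ᵥ v p) = (vev v).comp (actHom K d gᵀ) := by
    apply MvPolynomial.algHom_ext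
    rintro ⟨i, j, k⟩
    simp only [vev, actHom, AlgHom.comp_apply, MvPolynomial.aeval_X, Matrix.mulVec, dotProduct, mul_apply, Matrix.transpose_apply, Matrix.map_apply, map_sum, map_mul, AlgHom.commutes, genMat, Matrix.of_apply, Finset.sum_mul, Finset.mul_sum, Algebra.algebraMap_self, RingHom.id_apply]
    refine Finset.sum_congr rfl fun a _ => Finset.sum_congr rfl fun b _ => ?_
    ring
  rw [this]; rfl
theorem inv_match [Infinite K] (h3 : (3 : K) = 0) (S : Finset (Fin d)) {f : Rpoly K d} (hf : f ∈ invAlg K d) :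
    (fun c => vev (stp c) (cS S f)) ∈ span K {x : (Ltr d → Fin 3) → K | ∃ σ, IsMatch (SB S) σ ∧ x = chi σ} := by
  obtain ⟨a, ha, h⟩ := fft h3 (SB S) (by simp [SB]) _ (ml_cS S f) (by
    intro g hg v
    rw [vev_act]
    have hg' : gᵀᵀ * gᵀ = 1 := by rw [Matrix.transpose_transpose]; exact mul_eq_one_comm.1 hg
    have := act_comp (fun k => (Pi.single k 1 : Fin d → ℕ)) (nS S) gᵀ f
    rw [hf _ hg'] at this
    exact congrArg (vev v) this.symm)
  have e : (fun c => vev (stp c) (cS S f)) = ∑ σ, a σ • chi σ := by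
    funext c
    rw [Finset.sum_apply]
    exact h c
  rw [e]
  refine Submodule.sum_mem _ fun σ _ => ?_
  by_cases h0 : a σ = 0
  · rw [h0, zero_smul]; exact zero_mem _
  · exact smul_mem _ _ (subset_span ⟨σ, ha σ h0, rfl⟩)
theorem cS_mul (f g : Rpoly K d) : cS Finset.univ (f * g) = ∑ S, cS S f * cS Sᶜ g := by
  classical
  induction f using MvPolynomial.induction_on' with
  | add p q hp hq => rw [add_mul, map_add, hp, hq, ← Finset.sum_add_distrib]; exact Finset.sum_congr rfl fun S _ => by rw [map_add, add_mul]
  | monomial m a =>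
  induction g using MvPolynomial.induction_on' with
  | add p q hp hq => rw [mul_add, map_add, hp, hq, ← Finset.sum_add_distrib]; exact Finset.sum_congr rfl fun S _ => by rw [map_add, mul_add]
  | monomial m' a' =>
  have hw : ∀ S : Finset (Fin d), ∀ m, ∀ a : K, cS S (MvPolynomial.monomial m a) = if Finsupp.weight (Wt d) m = nS S then MvPolynomial.monomial m a else 0 := by
    intro S m a
    rw [cS, MvPolynomial.weightedHomogeneousComponent_of_mem ((MvPolynomial.mem_weightedHomogeneousSubmodule K (Wt d) _ _).2 (MvPolynomial.isWeightedHomogeneous_monomial (Wt d) m a rfl))]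
    simp only [eq_comm]
  rw [MvPolynomial.monomial_mul]
  simp only [hw, map_add]
  by_cases h : Finsupp.weight (Wt d) m + Finsupp.weight (Wt d) m' = nS Finset.univ
  · rw [if_pos h]
    have hk : ∀ k, Finsupp.weight (Wt d) m k + Finsupp.weight (Wt d) m' k = 1 := fun k => by
      have := congrFun h k; simpa [nS] using this
    rw [Finset.sum_eq_single (Finset.univ.filter fun k => Finsupp.weight (Wt d) m k = 1)]
    · rw [if_pos, if_pos, MvPolynomial.monomial_mul]
      · funext k; have := hk k; simp only [nS, Finset.mem_compl, Finset.mem_filter, Finset.mem_univ, true_and]; split <;> omega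
      · funext k; have := hk k; simp only [nS, Finset.mem_filter, Finset.mem_univ, true_and]; split <;> omega
    · intro S _ hS
      rw [if_neg, zero_mul]
      intro he; apply hS; ext k
      rw [Finset.mem_filter, he]; simp [nS]
    · simp
  · rw [if_neg h]
    symm; apply Finset.sum_eq_zero
    intro S _
    by_cases h1 : Finsupp.weight (Wt d) m = nS S
    · rw [if_pos h1, if_neg, mul_zero]
      intro h2; apply h; rw [h1, h2]; funext k; by_cases hk : k ∈ S <;> simp [nS, hk]
    · rw [if_neg h1, zero_mul]
theorem cS_empty {f : Rpoly K d} (hf : constantCoeff f = 0) : cS ∅ f = 0 := by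
  classical
  rw [cS, MvPolynomial.weightedHomogeneousComponent_apply]
  apply Finset.sum_eq_zero
  intro m hm
  have h := (Finset.mem_filter.1 hm).2
  have : m = 0 := by
    ext p
    have := congrFun h p.2.2
    rw [wt_apply] at this
    simp only [nS, Finset.notMem_empty, if_false, Finset.sum_eq_zero_iff] at this
    simpa using this p (Finset.mem_univ _)
  rw [this, ← MvPolynomial.constantCoeff_eq, hf, MvPolynomial.monomial_zero]
end MLP
open Matrix
open scoped Pointwise
section MLQ
variable {K : Type} [Field K] {d : ℕ}
theorem match_mul {S T : Finset (Ltr d)} {σ τ : Perm (Ltr d)} (h1 : IsMatch S σ) (h2 : IsMatch T τ) (hST : Disjoint S T) :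
    IsMatch (S ∪ T) (σ * τ) ∧ (chi (σ * τ) : _ → K) = chi σ * chi τ ∧ (∀ x ∉ T, (σ * τ) x = σ x) ∧ (∀ x ∉ S, (σ * τ) x = τ x) := by
  have fS : ∀ x ∉ S, σ x = x := fun x hx => by by_contra h; exact hx ((h1.2 x).1 h)
  have fT : ∀ x ∉ T, τ x = x := fun x hx => by by_contra h; exact hx ((h2.2 x).1 h)
  have mS : ∀ x ∈ S, σ x ∈ S := fun x hx => (h1.2 _).1 (by rw [h1.1]; exact ((h1.2 x).2 hx).symm)
  have mT : ∀ x ∈ T, τ x ∈ T := fun x hx => (h2.2 _).1 (by rw [h2.1]; exact ((h2.2 x).2 hx).symm)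
  have dST : ∀ x ∈ S, x ∉ T := fun x hx hx' => Finset.disjoint_left.1 hST hx hx'
  have A : ∀ x ∉ T, (σ * τ) x = σ x := fun x hx => by rw [Perm.mul_apply, fT x hx]
  have B : ∀ x ∉ S, (σ * τ) x = τ x := fun x hx => by
    rw [Perm.mul_apply]
    by_cases hT : x ∈ T
    · exact fS _ fun h => dST _ h (mT x hT)
    · rw [fT x hT, fS x hx]
  refine ⟨⟨fun p => ?_, fun p => ?_⟩, ?_, A, B⟩
  · by_cases hp : p ∈ S
    · rw [A p (dST p hp), A _ (dST _ (mS p hp)), h1.1]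
    · rw [B p hp]
      by_cases hT : p ∈ T
      · rw [B _ fun h => dST _ h (mT p hT), h2.1]
      · rw [fT p hT, A p hT, fS p hp]
  · rw [Finset.mem_union]
    by_cases hp : p ∈ S
    · rw [A p (dST p hp), h1.2]; simp [hp]
    · rw [B p hp, h2.2]; simp [hp]
  · funext c
    have : (∀ p, c ((σ * τ) p) = c p) ↔ (∀ p, c (σ p) = c p) ∧ (∀ p, c (τ p) = c p) := by
      constructor
      · intro h
        refine ⟨fun p => ?_, fun p => ?_⟩
        · by_cases hp : p ∈ S
          · rw [← A p (dST p hp), h]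
          · rw [fS p hp]
        · by_cases hp : p ∈ S
          · rw [fT p (dST p hp)]
          · rw [← B p hp, h]
      · rintro ⟨ha, hb⟩ p
        rw [Perm.mul_apply, ha, hb]
    simp only [chi, Pi.mul_apply, this]
    split_ifs <;> simp_all
noncomputable def Gam (K : Type) [Field K] (z : Fin d) : Submodule K (((Ltr d → Fin 3) → K) × (FA K d ⧸ IA K d)) :=
  span K {x | ∃ σ, IsMatch Finset.univ σ ∧ x = (chi σ, Th K z σ)}
theorem Gam_zero (h2 : (2 : K) ≠ 0) {z : Fin d} {y} (h : ((0 : (Ltr d → Fin 3) → K), y) ∈ Gam K z) : y = 0 := by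
  classical
  have key : ∀ x ∈ Gam K z, ∃ c : Perm (Ltr d) → K, (∀ σ, c σ ≠ 0 → IsMatch Finset.univ σ) ∧ x = ∑ σ, c σ • ((chi σ : (Ltr d → Fin 3) → K), Th K z σ) := by
    intro x hx
    rw [Gam] at hx
    induction hx using span_induction with
    | mem x hx =>
      obtain ⟨σ, hσ, rfl⟩ := hx
      refine ⟨Pi.single σ 1, fun τ hτ => ?_, ?_⟩
      · by_cases h : τ = σ
        · rw [h]; exact hσ
        · simp [h] at hτ
      · rw [Finset.sum_eq_single σ (fun b _ hb => by rw [Pi.single_eq_of_ne hb, zero_smul]) (by simp), Pi.single_eq_same, one_smul]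
    | zero => exact ⟨0, fun σ h => absurd rfl h, by simp⟩
    | add x y _ _ hx hy =>
      obtain ⟨c, hc, rfl⟩ := hx; obtain ⟨c', hc', rfl⟩ := hy
      refine ⟨c + c', fun σ h => ?_, by simp only [Pi.add_apply, add_smul, Finset.sum_add_distrib]⟩
      by_cases h0 : c σ = 0
      · exact hc' σ (by simpa [h0] using h)
      · exact hc σ h0
    | smul a x _ hx =>
      obtain ⟨c, hc, rfl⟩ := hx
      refine ⟨a • c, fun σ h => hc σ (by simp at h; exact h.2), by simp only [Pi.smul_apply, smul_assoc, Finset.smul_sum]⟩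
  obtain ⟨c, hc, e⟩ := key _ h
  have e1 := congrArg Prod.fst e
  have e2 := congrArg Prod.snd e
  rw [Prod.fst_sum] at e1
  rw [Prod.snd_sum] at e2
  dsimp at e1 e2
  rw [e2]
  refine sft h2 (Th K z) (fun σ i => gram σ i) c hc fun col => ?_
  have := congrFun e1 col
  rw [Finset.sum_apply] at this
  exact this.symm
theorem not_conn {z : Fin d} {σ : Perm (Ltr d)} {S : Finset (Fin d)} (h0 : S.Nonempty) (h1 : Sᶜ.Nonempty)
    (h : ∀ p, (σ p).1 ∈ S ↔ p.1 ∈ S) : ¬ Conn σ z := by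
  rintro ⟨hF, -⟩
  have ht : ∀ k, (Tt σ z k).1 ∈ S ↔ z ∈ S := by
    intro k
    induction k with
    | zero => rfl
    | succ k ih => rw [Tt_succ, flp_fst, Hh, h, ih]
  have hall : ∀ k, k ∈ S ↔ z ∈ S := by
    intro k
    by_cases hk : k = z
    · rw [hk]
    · have := (hF.mem k).2 hk
      rw [lst, List.map_map, List.mem_map] at this
      obtain ⟨n, -, rfl⟩ := this
      show (σ (Tt σ z n)).1 ∈ S ↔ _
      rw [h, ht]
  obtain ⟨a, ha⟩ := h0; obtain ⟨b, hb⟩ := h1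
  rw [Finset.mem_compl] at hb
  exact hb ((hall b).2 ((hall a).1 ha))
theorem Dec_Gam [Infinite K] (h3 : (3 : K) = 0) (z : Fin d) {f : Rpoly K d} (hf : f ∈ Dec K d) :
    ((fun c => vev (stp c) (cS Finset.univ f)), (0 : FA K d ⧸ IA K d)) ∈ Gam K z := by
  classical
  let L : Rpoly K d →ₗ[K] ((Ltr d → Fin 3) → K) × (FA K d ⧸ IA K d) :=
    LinearMap.prod (LinearMap.pi fun c => (vev (stp c)).toLinearMap.comp (cS Finset.univ)) 0
  have : Dec K d ≤ (Gam K z).comap L := by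
    rw [Dec, span_le]
    rintro _ ⟨f, g, hf, hg, rfl⟩
    show ((fun c => vev (stp c) (cS Finset.univ (f * g))), (0 : FA K d ⧸ IA K d)) ∈ Gam K z
    have e : ((fun c => vev (stp c) (cS Finset.univ (f * g))), (0 : FA K d ⧸ IA K d)) =
       ∑ S, (((fun c => vev (stp c) (cS S f)) * (fun c => vev (stp c) (cS Sᶜ g)) : (Ltr d → Fin 3) → K), (0 : FA K d ⧸ IA K d)) := by
      refine Prod.ext ?_ ?_
      · rw [Prod.fst_sum]; funext c; rw [Finset.sum_apply]; dsimp only; rw [cS_mul, map_sum]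
        exact Finset.sum_congr rfl fun S _ => by rw [map_mul]; rfl
      · rw [Prod.snd_sum]; simp
    rw [e]
    refine Submodule.sum_mem _ fun S _ => ?_
    rcases S.eq_empty_or_nonempty with rfl | hS
    · rw [cS_empty hf.2]; convert zero_mem (Gam K z) using 1; exact Prod.ext (by funext c; simp) rfl
    rcases Sᶜ.eq_empty_or_nonempty with hS' | hS'
    · rw [hS', cS_empty hg.2]; convert zero_mem (Gam K z) using 1; exact Prod.ext (by funext c; simp) rfl
    have hm := Submodule.mul_mem_mul (inv_match h3 S hf.1) (inv_match h3 Sᶜ hg.1)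
    rw [Submodule.span_mul_span] at hm
    have hle : span K ({x : (Ltr d → Fin 3) → K | ∃ σ, IsMatch (SB S) σ ∧ x = chi σ} * {x : (Ltr d → Fin 3) → K | ∃ σ, IsMatch (SB Sᶜ) σ ∧ x = chi σ}) ≤
        (Gam K z).comap (LinearMap.inl K _ (FA K d ⧸ IA K d)) := by
      rw [span_le]
      rintro _ ⟨_, ⟨σ, hσ, rfl⟩, _, ⟨τ, hτ, rfl⟩, rfl⟩
      obtain ⟨m1, m2, m3, m4⟩ := match_mul (K := K) hσ hτ (by
        rw [Finset.disjoint_left]; intro x hx hx'; rw [mem_SB] at hx hx'; exact (Finset.mem_compl.1 hx') hx)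
      have hu : SB S ∪ SB Sᶜ = Finset.univ := by
        ext x; simp only [Finset.mem_union, mem_SB, Finset.mem_compl, Finset.mem_univ, iff_true]; tauto
      rw [hu] at m1
      refine subset_span ⟨σ * τ, m1, ?_⟩
      have hT : Th K z (σ * τ) = 0 := by
        rw [Th, if_neg]
        apply not_conn hS hS'
        intro p
        have mm : ∀ {T : Finset (Fin d)} {ρ : Perm (Ltr d)}, IsMatch (SB T) ρ → ∀ x : Ltr d, x.1 ∈ T → (ρ x).1 ∈ T := by
          intro T ρ hρ x hx
          have := (hρ.2 (ρ x)).1 (by rw [hρ.1]; exact ((hρ.2 x).2 (mem_SB.2 hx)).symm)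
          exact mem_SB.1 this
        by_cases hp : p.1 ∈ S
        · rw [m3 p (by rw [mem_SB, Finset.mem_compl]; simpa using hp)]; simp [hp, mm hσ p hp]
        · rw [m4 p (by rwa [mem_SB])]
          have := mm hτ p (by simpa using hp)
          rw [Finset.mem_compl] at this; simp [hp, this]
      rw [hT, m2]; rfl
    exact hle hm
  exact this hf
def Mw : Ltr d → List (Ltr d) → Ltr d → Perm (Ltr d)
| p, [], q => Equiv.swap p q
| p, l :: ls, q => Equiv.swap p l * Mw (flp l) ls q
def Sw : Ltr d → List (Ltr d) → Ltr d → Finset (Ltr d)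
| p, [], q => {p, q}
| p, l :: ls, q => {p, l} ∪ Sw (flp l) ls q
theorem flp_or (x l : Ltr d) : (x = l ∨ x = flp l) ↔ x.1 = l.1 := by
  obtain ⟨a, b⟩ := x; obtain ⟨a', b'⟩ := l
  simp only [flp, Prod.mk.injEq]
  cases b <;> cases b' <;> simp
theorem mem_Sw {p q : Ltr d} {ls} {x} : x ∈ Sw p ls q ↔ x = p ∨ x = q ∨ x.1 ∈ ls.map Prod.fst := by
  induction ls generalizing p with
  | nil => simp [Sw]
  | cons l ls ih =>
    have := flp_or x l
    simp only [Sw, Finset.mem_union, mem_insert, Finset.mem_singleton, ih, List.map_cons, List.mem_cons]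
    tauto
theorem swap_match {p q : Ltr d} (h : p ≠ q) : IsMatch {p, q} (Equiv.swap p q) := by
  refine ⟨fun x => Equiv.swap_apply_self p q x, fun x => ?_⟩
  rw [Equiv.swap_apply_ne_self_iff]; simp [h]
theorem Mw_disj {p q : Ltr d} {l ls} (h1 : p ≠ q) (h2 : ((l :: ls).map Prod.fst).Nodup) (h3 : p.1 ∉ (l :: ls).map Prod.fst) (h4 : q.1 ∉ (l :: ls).map Prod.fst) :
    Disjoint {p, l} (Sw (flp l) ls q) := by
  simp only [List.map_cons, List.nodup_cons, List.mem_cons, not_or] at h2 h3 h4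
  rw [Finset.disjoint_left]
  intro x hx
  rw [mem_Sw]
  simp only [mem_insert, Finset.mem_singleton] at hx
  rcases hx with rfl | rfl
  · rintro (h | h | h)
    · exact h3.1 (by rw [h, flp_fst])
    · exact h1 h
    · exact h3.2 h
  · rintro (h | h | h)
    · exact flp_ne _ h.symm
    · exact h4.1 (by rw [h])
    · exact h2.1 h
def PathV (v : Ltr d → Fin 3 → K) : Ltr d → List (Ltr d) → Ltr d → K
| p, [], q => v p ⬝ᵥ v q
| p, l :: ls, q => (v p ⬝ᵥ v l) * PathV v (flp l) ls q
theorem chi_swap {p q : Ltr d} (c) : (chi (Equiv.swap p q) c : K) = stp c p ⬝ᵥ stp c q := by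
  rw [stp, stp, single_one_dotProduct, chi, Pi.single_apply]
  have : (∀ x, c (Equiv.swap p q x) = c x) ↔ c p = c q := by
    constructor
    · intro h; have := h q; rwa [Equiv.swap_apply_right] at this
    · intro h x
      rw [Equiv.swap_apply_def]; split_ifs with h1 h2
      · rw [h1, h]
      · rw [h2, h]
      · rfl
  simp only [this]
theorem Mw_match {p q : Ltr d} {ls} (h1 : p ≠ q) (h2 : (ls.map Prod.fst).Nodup) (h3 : p.1 ∉ ls.map Prod.fst) (h4 : q.1 ∉ ls.map Prod.fst) :
    IsMatch (Sw p ls q) (Mw p ls q) ∧ (∀ c, (chi (Mw p ls q) c : K) = PathV (stp c) p ls q) ∧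
    ∀ σ : Perm (Ltr d), (∀ x ∈ Sw p ls q, σ x = Mw p ls q x) → Walks σ p (ls ++ [q]) (flp q) := by
  induction ls generalizing p with
  | nil =>
    refine ⟨swap_match h1, fun c => chi_swap c, fun σ h => ⟨?_, rfl⟩⟩
    rw [h p (by simp [Sw]), Mw, Equiv.swap_apply_left]
  | cons l ls ih =>
    have hd := Mw_disj h1 h2 h3 h4
    have h3' := h3
    simp only [List.map_cons, List.nodup_cons, List.mem_cons, not_or] at h2 h3 h4
    obtain ⟨i1, i2, i3⟩ := ih (p := flp l) (by intro h; apply h4.1; rw [← h, flp_fst]) h2.2 (by rw [flp_fst]; exact h2.1) h4.2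
    have hpl : p ≠ l := by rintro rfl; exact h3.1 rfl
    obtain ⟨m1, m2, m3, m4⟩ := match_mul (K := K) (swap_match hpl) i1 hd
    refine ⟨m1, fun c => ?_, fun σ h => ⟨?_, i3 σ fun x hx => ?_⟩⟩
    · rw [Mw, m2, Pi.mul_apply, i2, chi_swap]; rfl
    · have hp : p ∈ ({p, l} : Finset (Ltr d)) := by simp
      rw [h p (by rw [mem_Sw]; exact Or.inl rfl)]
      show (Equiv.swap p l * Mw (flp l) ls q) p = l
      rw [m3 p (Finset.disjoint_left.1 hd hp), Equiv.swap_apply_left]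
    · rw [h x (Finset.mem_union_right _ hx)]
      exact m4 x fun h => Finset.disjoint_left.1 hd h hx
theorem vev_iota (v : Ltr d → Fin 3 → K) (p : Ltr d) : (vev v).mapMatrix (evMat K d (ι K p)) = Matrix.vecMulVec (v p) (v (flp p)) := by
  obtain ⟨k, b⟩ := p
  rw [evMat, FreeAlgebra.lift_ι_apply]
  ext i j
  cases b <;> simp [genMat, vev, Matrix.vecMulVec_apply, flp, mul_comm]
theorem vev_path (v : Ltr d → Fin 3 → K) (p q : Ltr d) (l) :
    v p ⬝ᵥ ((vev v).mapMatrix (evMat K d (wordOf K d l)) *ᵥ v q) = PathV v p l q := by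
  induction l generalizing p with
  | nil => rw [wordOf_nil, map_one, map_one, Matrix.one_mulVec]; rfl
  | cons a l ih =>
    rw [wordOf_cons, map_mul, map_mul, vev_iota, ← Matrix.mulVec_mulVec, PathV, ← ih, Matrix.vecMulVec_mulVec]
    simp [mul_comm]
theorem vev_tr (v : Ltr d → Fin 3 → K) (z : Fin d) (l) :
    vev v (trace (evMat K d (wordOf K d l) * genMat K d z)) = PathV v (z, true) l (z, false) := by
  have h : genMat K d z = evMat K d (ι K (z, false)) := by simp [evMat]
  have h2 : ∀ A : M3 (Rpoly K d), vev v (trace A) = trace ((vev v).mapMatrix A) := fun A => by simp [trace]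
  rw [h2, map_mul, h, vev_iota, ← vev_path, Matrix.mul_vecMulVec, Matrix.trace_vecMulVec, dotProduct_comm]; rfl
theorem ev_wh (l : List (Ltr d)) (i j) : MvPolynomial.IsWeightedHomogeneous (Wt d) (evMat K d (wordOf K d l) i j) (fun k => (l.map Prod.fst).count k) := by
  induction l generalizing i with
  | nil =>
    rw [wordOf_nil, map_one, Matrix.one_apply]
    have e : (fun k => (([] : List (Ltr d)).map Prod.fst).count k) = (0 : Fin d → ℕ) := by funext k; simp
    rw [e]
    split
    · exact MvPolynomial.isWeightedHomogeneous_one K _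
    · exact MvPolynomial.isWeightedHomogeneous_zero K _ _
  | cons p l ih =>
    rw [wordOf_cons, map_mul, mul_apply]
    refine MvPolynomial.IsWeightedHomogeneous.sum _ _ _ fun a _ => ?_
    have e : (fun k => ((p :: l).map Prod.fst).count k) = (Pi.single p.1 1 : Fin d → ℕ) + fun k => (l.map Prod.fst).count k := by
      funext k
      by_cases hk : k = p.1
      · subst hk; simp [add_comm]
      · simp [List.count_cons, hk, Ne.symm hk]
    rw [e]
    refine MvPolynomial.IsWeightedHomogeneous.mul ?_ (ih a)
    rw [evMat, FreeAlgebra.lift_ι_apply]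
    split <;> exact MvPolynomial.isWeightedHomogeneous_X K (Wt d) _
theorem word_Gam {z : Fin d} {l : List (Ltr d)} (hl : Full z l) :
    ((fun c => vev (stp c) (cS Finset.univ (trace (evMat K d (wordOf K d l) * genMat K d z)))), (IA K d).mkQ (wordOf K d l)) ∈ Gam K z := by
  have hz : z ∉ l.map Prod.fst := fun h => (hl.mem z).1 h rfl
  obtain ⟨m1, m2, m3⟩ := Mw_match (K := K) (p := (z, true)) (q := (z, false)) (ls := l) (by simp) hl.nodup hz hz
  have hu : Sw (z, true) l (z, false) = Finset.univ := by
    ext x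
    rw [mem_Sw, hl.mem]
    simp only [Finset.mem_univ, iff_true]
    obtain ⟨k, b⟩ := x
    by_cases hk : k = z
    · cases b <;> simp [hk]
    · simp [hk]
  rw [hu] at m1
  refine subset_span ⟨_, m1, Prod.ext ?_ ?_⟩
  · funext c
    show _ = chi _ c
    rw [m2, ← vev_tr]
    show vev (stp c) (cS Finset.univ _) = _
    refine congrArg _ ?_
    apply MvPolynomial.IsWeightedHomogeneous.weightedHomogeneousComponent_same
    have h : genMat K d z = evMat K d (wordOf K d [(z, false)]) := by simp [evMat, wordOf]
    rw [h, ← map_mul, ← wordOf_append, trace]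
    refine MvPolynomial.IsWeightedHomogeneous.sum _ _ _ fun i _ => ?_
    have := ev_wh (K := K) (l ++ [(z, false)]) i i
    convert this using 1
    · rfl
    funext k
    rw [List.map_append, List.count_append]
    by_cases hk : k = z
    · subst hk; simp [nS, List.count_eq_zero_of_not_mem hz]
    · have h1 : (l.map Prod.fst).count k = 1 := List.count_eq_one_of_mem hl.nodup ((hl.mem k).2 hk)
      rw [h1]; simp [nS, List.count_cons, Ne.symm hk]
  · set σ := Mw (z, true) l (z, false)
    have w := m3 σ fun _ _ => rfl
    have w' : Walks σ (Tt σ z 0) (l ++ [(z, false)]) (flp (z, false)) := w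
    have e := w'.eq.1
    rw [List.length_append, List.length_singleton, List.range'_concat, List.map_append] at e
    have e' := List.append_inj e (by simp)
    have hlst : lst σ z = l := by
      rw [lst, ← hl.length, List.range_eq_range']; exact e'.1.symm
    have hc : Conn σ z := by
      refine ⟨by rw [hlst]; exact hl, ?_⟩
      have := e'.2
      rw [hl.length] at this
      simpa using this.symm
    show _ = Th K z σ
    rw [Th, if_pos hc, hlst]
theorem multilin [Infinite K] [CharP K 3] {z : Fin d} {u : FA K d} (hu : u ∈ span K {w | ∃ l, Full z l ∧ w = wordOf K d l})
    (h : trace (evMat K d u * genMat K d z) ∈ Dec K d) : u ∈ IA K d := by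
  have h3 : (3 : K) = 0 := by exact_mod_cast CharP.cast_eq_zero K 3
  have h2 : (2 : K) ≠ 0 := fun h2 => by
    have : (1 : K) = 3 - 2 := by norm_num
    rw [h2, h3, sub_zero] at this; exact one_ne_zero this
  have key : ((fun c => vev (stp c) (cS Finset.univ (trace (evMat K d u * genMat K d z)))), (IA K d).mkQ u) ∈ Gam K z := by
    clear h
    induction hu using span_induction with
    | mem x hx => obtain ⟨l, hl, rfl⟩ := hx; exact word_Gam hl
    | zero => convert zero_mem (Gam K z) using 1; simp; rfl
    | add x y _ _ hx hy =>
      convert add_mem hx hy using 1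
      simp only [map_add, add_mul, Matrix.trace_add]; rfl
    | smul a x _ hx =>
      convert smul_mem _ a hx using 1
      simp only [map_smul, smul_mul_assoc, Matrix.trace_smul]; rfl
  have hd := sub_mem key (Dec_Gam h3 z h)
  rw [Prod.mk_sub_mk, sub_self, sub_zero] at hd
  have := Gam_zero h2 hd
  rwa [Submodule.mkQ_apply, Submodule.Quotient.mk_eq_zero] at this
end MLQ
open Matrix
section SUBS
variable {K : Type} [Field K] {n m : ℕ}
noncomputable def Sh (a : Fin n → FA K m) : FA K n →ₐ[K] FA K m :=
  FreeAlgebra.lift K fun p : Ltr n => if p.2 then tp K m (a p.1) else a p.1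
theorem Sh_iota (a : Fin n → FA K m) (p : Ltr n) : Sh a (ι K p) = if p.2 then tp K m (a p.1) else a p.1 := by simp [Sh]
theorem Sh_tp (a : Fin n → FA K m) (u : FA K n) : Sh a (tp K n u) = tp K m (Sh a u) := by
  induction u using FreeAlgebra.induction with
  | grade0 r => rw [Algebra.algebraMap_eq_smul_one, tp_smul, tp_one, map_smul, map_one, tp_smul, tp_one]
  | grade1 x =>
    rw [tp_iota, Sh_iota, Sh_iota]
    obtain ⟨k, b⟩ := x
    cases b <;> simp [flp, tp_tp]
  | mul a b ha hb => rw [tp_mul, map_mul, map_mul, ha, hb, tp_mul]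
  | add a b ha hb => rw [tp_add, map_add, map_add, ha, hb, tp_add]
theorem Sh_MF {a : Fin n → FA K m} (ha : ∀ k, a k ∈ MFsub K m) {u} (hu : u ∈ MFsub K n) : Sh a u ∈ MFsub K m := by
  rw [mem_MF] at *
  have : (aug (K := K) (d := m)).comp (Sh a) = aug := by
    apply FreeAlgebra.hom_ext
    funext p
    have h1 := (mem_MF _).1 (ha p.1)
    have h2 := (mem_MF _).1 (MF_tp (ha p.1))
    simp only [Function.comp_apply, AlgHom.comp_apply, Sh_iota]
    rw [(mem_MF _).1 (MF_iota p)]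
    split <;> assumption
  rw [← hu, ← this]; rfl
theorem Sh_IA {a : Fin n → FA K m} (ha : ∀ k, a k ∈ MFsub K m) {u} (hu : u ∈ IA K n) : Sh a u ∈ IA K m := by
  have : IA K n ≤ (IA K m).comap (Sh a).toLinearMap := by
    refine IA_ind (fun x y b hb => ?_) (fun x y b c e hb hc he => ?_)
    · show Sh a (x * b ^ 3 * y) ∈ IA K m
      rw [map_mul, map_mul, map_pow]
      exact IA_r (IA_l _ (IA_cube (Sh_MF ha hb))) _
    · show Sh a (x * Trel K n b c e * y) ∈ IA K m
      have : Sh a (Trel K n b c e) = Trel K m (Sh a b) (Sh a c) (Sh a e) := by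
        simp only [Trel, bar, map_add, map_mul, map_sub, Sh_tp]
      rw [map_mul, map_mul, this]
      exact IA_r (IA_l _ (IA_T (Sh_MF ha hb) (Sh_MF ha hc) (Sh_MF ha he))) _
  exact this hu
theorem Sh_ev (a : Fin n → FA K m) (u : FA K n) :
    evMat K m (Sh a u) = (SubR fun k => evMat K m (a k)).mapMatrix (evMat K n u) := by
  have : (evMat K m).comp (Sh a) = (AlgHom.mapMatrix (SubR fun k => evMat K m (a k))).comp (evMat K n) := by
    apply FreeAlgebra.hom_ext
    funext p
    obtain ⟨k, b⟩ := p
    have h : evMat K n (ι K (k, b)) = if b then (genMat K n k)ᵀ else genMat K n k := by simp [evMat]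
    have h' := SubR_gen (fun k => evMat K m (a k)) k
    simp only [Function.comp_apply, AlgHom.comp_apply, Sh_iota, h]
    cases b
    · simp only [Bool.false_eq_true, if_false]; exact h'.symm
    · simp only [if_true]; rw [ev_tp, ← h']; rfl
  exact DFunLike.congr_fun this u
noncomputable def emb : FA K n →ₐ[K] FA K (n+1) := Sh fun k => ι K (k.succ, false)
noncomputable def Hs (K : Type) [Field K] (n : ℕ) : Submodule K (FA K n) where
  carrier := {u | trace (evMat K (n+1) (emb u) * genMat K (n+1) 0) ∈ Dec K (n+1)}
  add_mem' := fun {a b} ha hb => by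
    simp only [Set.mem_setOf_eq] at *
    rw [map_add, map_add, add_mul, Matrix.trace_add]; exact add_mem ha hb
  zero_mem' := by simp
  smul_mem' := fun c a ha => by
    simp only [Set.mem_setOf_eq] at *
    rw [map_smul, map_smul, smul_mul_assoc, Matrix.trace_smul]; exact smul_mem _ c ha
theorem mem_Hs {u : FA K n} : u ∈ Hs K n ↔ trace (evMat K (n+1) (emb u) * genMat K (n+1) 0) ∈ Dec K (n+1) := Iff.rfl
theorem gen_ev (k : Fin n) : genMat K n k = evMat K n (ι K (k, false)) := by simp [evMat]
theorem Sh_comp {p : ℕ} (b : Fin m → FA K p) (a : Fin n → FA K m) (u) : Sh b (Sh a u) = Sh (fun k => Sh b (a k)) u := by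
  have : (Sh b).comp (Sh a) = Sh (fun k => Sh b (a k)) := by
    apply FreeAlgebra.hom_ext
    funext p
    simp only [Function.comp_apply, AlgHom.comp_apply, Sh_iota]
    split
    · rw [Sh_tp]
    · rfl
  exact DFunLike.congr_fun this u
theorem Sh_H {a : Fin n → FA K m} (ha : ∀ k, a k ∈ MFsub K m) {u} (hu : u ∈ Hs K n) : Sh a u ∈ Hs K m := by
  rw [mem_Hs] at *
  let b : Fin (n+1) → FA K (m+1) := Fin.cons (ι K (0, false)) fun k => emb (a k)
  have hb : ∀ k, b k ∈ MFsub K (m+1) := by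
    intro k
    refine Fin.cases ?_ (fun k => ?_) k
    · exact MF_iota _
    · exact Sh_MF (fun k => MF_iota _) (ha k)
  have e : emb (Sh a u) = Sh b (emb u) := by
    rw [emb, emb, Sh_comp, Sh_comp]; congr 2; funext k; rw [Sh_iota]; rfl
  have := SubR_Dec (Y := fun k => evMat K (m+1) (b k)) (fun k i j => ev_const0 (hb k) i j) (fun g hg k => ev_act hg _) hu
  rw [e, Sh_ev]
  convert this using 1
  have h0 : evMat K (m+1) (b 0) = genMat K (m+1) 0 := (gen_ev _).symm
  have := SubR_gen (fun k => evMat K (m+1) (b k)) 0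
  rw [h0] at this
  rw [← this, ← map_mul, trace, trace, map_sum]; rfl
theorem two_ne [CharP K 3] : (2 : K) ≠ 0 := fun h2 => by
  have h3 : (3 : K) = 0 := by exact_mod_cast CharP.cast_eq_zero K 3
  have : (1 : K) = 3 - 2 := by norm_num
  rw [h2, h3, sub_zero] at this; exact one_ne_zero this
theorem IA_H [CharP K 3] {u : FA K n} (hu : u ∈ IA K n) : u ∈ Hs K n := by
  rw [mem_Hs, gen_ev, ← map_mul]
  exact IA_Dec two_ne (Sh_IA (fun k => MF_iota _) hu) (MF_iota _)
noncomputable def dlh (k : Fin n) : FA K n →ₐ[K] TrivSqZeroExt (FA K n) (FA K n) :=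
  FreeAlgebra.lift K fun p : Ltr n => TrivSqZeroExt.inl (ι K p) + TrivSqZeroExt.inr (if p.1 = k then 1 else 0)
theorem dlh_fst (k : Fin n) (a : FA K n) : (dlh k a).fst = a := by
  have : (TrivSqZeroExt.fstHom K (FA K n) (FA K n)).comp (dlh k) = AlgHom.id K _ := by
    apply FreeAlgebra.hom_ext
    funext p
    simp [dlh]; split <;> simp
  exact DFunLike.congr_fun this a
noncomputable def dl (k : Fin n) : FA K n →ₗ[K] FA K n where
  toFun := fun a => (dlh k a).snd
  map_add' := fun a b => by simp
  map_smul' := fun c a => by simp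
theorem dl_mul (k : Fin n) (a b : FA K n) : dl k (a * b) = a * dl k b + dl k a * b := by
  show (dlh k (a * b)).snd = _
  rw [map_mul, TrivSqZeroExt.snd_mul, dlh_fst, dlh_fst]; rfl
theorem dl_iota (k : Fin n) (p : Ltr n) : dl k (ι K p) = if p.1 = k then 1 else 0 := by
  show (dlh k _).snd = _
  simp [dlh]; split <;> simp
theorem dl_one (k : Fin n) : dl (K := K) k 1 = 0 := by
  show (dlh k _).snd = _
  simp
theorem dl_ev (k : Fin n) (u : FA K n) (i j) : Dk (K := K) k.succ (evMat K (n+1) (emb u) i j) = evMat K (n+1) (emb (dl k u)) i j := by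
  induction u using FreeAlgebra.induction generalizing i j with
  | grade0 r =>
    rw [Algebra.algebraMap_eq_smul_one, map_smul, map_smul, map_smul, dl_one, map_one, map_one]
    rw [Matrix.smul_apply, Derivation.map_smul, Matrix.one_apply]; split <;> simp
  | grade1 p =>
    rw [dl_iota, emb, Sh_iota]
    obtain ⟨l, b⟩ := p
    have := Dk_gen (K := K) k.succ l.succ
    by_cases h : l = k
    · subst h
      cases b <;> simp [ev_tp, ← gen_ev, this, Matrix.one_apply, eq_comm]
    · cases b <;> simp [ev_tp, ← gen_ev, this, h]
  | mul a b ha hb =>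
    rw [dl_mul, map_add, map_add, map_mul, map_mul, map_mul, map_mul, map_mul, map_mul, Matrix.add_apply, mul_apply, mul_apply, mul_apply, map_sum, ← Finset.sum_add_distrib]
    refine Finset.sum_congr rfl fun c _ => ?_
    rw [Derivation.leibniz, ha, hb, smul_eq_mul, smul_eq_mul]; ring
  | add a b ha hb => simp only [map_add, Matrix.add_apply, ha, hb]
theorem dl_H [CharP K 3] (k : Fin n) {u : FA K n} (hu : u ∈ Hs K n) : dl k u ∈ Hs K n := by
  rw [mem_Hs] at *
  convert Dk_Dec k.succ hu using 1
  simp only [trace, Matrix.diag_apply, mul_apply, map_sum, Derivation.leibniz, dl_ev, Dk_gen]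
  simp [Fin.succ_ne_zero, (Fin.succ_ne_zero _).symm, mul_comm]
end SUBS
section ABSN
variable {R : Type} [Ring R] (h3 : (3 : R) = 0) {Z : R} (hN : ∀ b : R, Z*Z*b + Z*b*Z + b*Z*Z = 0) (hZ : Z*Z*Z = 0)
include h3 hN hZ
theorem hD1 (x : R) : (x*Z-Z*x)*Z = Z*(x*Z-Z*x) := by
  linear_combination (norm := noncomm_ring) hN x - h3 * (Z*x*Z)
theorem hD2 (x y : R) : (x*Z-Z*x)*(y*Z-Z*y) = 0 := by
  have a := hD1 h3 hN hZ (x*y)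
  have b := hD1 h3 hN hZ x
  have c := hD1 h3 hN hZ y
  have : (2:R) * ((x*Z-Z*x)*(y*Z-Z*y)) = 0 := by
    linear_combination (norm := noncomm_ring) a - b * y - x * c
  linear_combination (norm := noncomm_ring) 2 * this - h3 * ((x*Z-Z*x)*(y*Z-Z*y))
theorem hD3 (x y w : R) : (x*Z-Z*x)*(y*(w*Z-Z*w)) = 0 := by
  have a := hD2 h3 hN hZ x (y*w)
  have b := hD2 h3 hN hZ x y
  linear_combination (norm := noncomm_ring) a - b * w
theorem id34 (a b c d : R) : a*Z*b*Z*c*Z + Z*(a*b*Z*c*Z + a*Z*b*c*Z + a*Z*b*Z*c) = 0 ∧ a*Z*b*Z*c*Z*d*Z = 0 := by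
  have A1 := hD1 h3 hN hZ a
  have B1 := hD1 h3 hN hZ b
  have C1 := hD1 h3 hN hZ c
  have D1 := hD1 h3 hN hZ d
  have ab := hD2 h3 hN hZ a b
  have ac := hD2 h3 hN hZ a c
  have ad := hD2 h3 hN hZ a d
  have bc := hD2 h3 hN hZ b c
  have bd := hD2 h3 hN hZ b d
  have cd := hD2 h3 hN hZ c d
  have abc := hD3 h3 hN hZ a b c
  have abd := hD3 h3 hN hZ a b d
  have acd := hD3 h3 hN hZ a c d
  have abcd := hD3 h3 hN hZ a (b*c) d
  have bcd := hD3 h3 hN hZ b c d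
  have ea : a*Z = Z*a + (a*Z-Z*a) := by abel
  have eb : b*Z = Z*b + (b*Z-Z*b) := by abel
  have ec : c*Z = Z*c + (c*Z-Z*c) := by abel
  have ed : d*Z = Z*d + (d*Z-Z*d) := by abel
  generalize a*Z-Z*a = da at ea A1 ab ac ad abc abd acd abcd
  generalize b*Z-Z*b = db at eb B1 ab bc bd bcd
  generalize c*Z-Z*c = dc at ec C1 ac bc cd abc
  generalize d*Z-Z*d = dd at ed D1 ad bd cd abd acd abcd bcd
  have as : ∀ {x y w : R}, x*y = w → ∀ r, x*(y*r) = w*r := fun h r => by rw [← mul_assoc, h]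
  have as2 : ∀ {x y w v : R}, x*(y*w) = v → ∀ r, x*(y*(w*r)) = v*r := fun h r => by rw [← h]; simp only [mul_assoc]
  rw [mul_assoc] at hZ
  rw [mul_assoc] at abcd
  constructor
  · have : a*Z*b*Z*c*Z + Z*(a*b*Z*c*Z + a*Z*b*c*Z + a*Z*b*Z*c) = 3 * (Z*(Z*(a*(b*dc))) + 2*(Z*(Z*(a*(db*c)))) + 3*(Z*(Z*(da*(b*c))))) := by
      simp only [mul_assoc, mul_add, add_mul, ea, eb, ec, as ea, as eb, as ec, A1, B1, C1, as A1, as B1, as C1, ab, ac, bc, as ab, as ac, as bc, abc, as2 abc, hZ, as2 hZ, mul_zero, zero_mul, add_zero, zero_add]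
      noncomm_ring
    rw [this, h3, zero_mul]
  · simp only [mul_assoc, mul_add, add_mul, ea, eb, ec, ed, as ea, as eb, as ec, as ed, A1, B1, C1, D1, as A1, as B1, as C1, as D1, ab, ac, ad, bc, bd, cd, as ab, as ac, as bc, as ad, as bd, as cd, abc, as2 abc, abd, as2 abd, acd, as2 acd, bcd, as2 bcd, abcd, hZ, as2 hZ, mul_zero, zero_mul, add_zero, zero_add]
end ABSN
section QUOT
variable {K : Type} [Field K] {n : ℕ}
noncomputable def qt : FA K n →+* (idealA K n).ringCon.Quotient := (idealA K n).ringCon.mk'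
theorem qt_zero {x : FA K n} : qt x = 0 ↔ x ∈ IA K n := by
  rw [mem_IA, TwoSidedIdeal.mem_iff, ← map_zero (qt (K := K) (n := n))]
  exact RingCon.eq _
theorem qt_eq {x y : FA K n} : qt x = qt y ↔ x - y ∈ IA K n := by
  rw [← sub_eq_zero, ← map_sub, qt_zero]
theorem qt_surj (x : (idealA K n).ringCon.Quotient) : ∃ a : FA K n, qt a = x := Quotient.inductionOn' x fun a => ⟨a, rfl⟩
variable [CharP K 3]
theorem FA3 : (3 : FA K n) = 0 := by
  have h3 : (3 : K) = 0 := by exact_mod_cast CharP.cast_eq_zero K 3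
  have := congrArg (algebraMap K (FA K n)) h3
  rwa [map_ofNat, map_zero] at this
theorem add3 (w : FA K n) : w + w + w = 0 := by
  have : w + w + w = 3 * w := by noncomm_ring
  rw [this, FA3, zero_mul]
theorem Q3 : (3 : (idealA K n).ringCon.Quotient) = 0 := by
  have := congrArg qt (FA3 (K := K) (n := n))
  rwa [map_ofNat, map_zero] at this
theorem MF_split (a : FA K n) : ∃ b ∈ MFsub K n, ∃ c : K, a = b + c • 1 :=
  ⟨a - aug a • 1, by rw [mem_MF]; simp, aug a, by abel⟩
theorem IA_half {x : FA K n} (h : x + x ∈ IA K n) : x ∈ IA K n := by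
  have e : x = (3 : FA K n) * x - (x + x) := by noncomm_ring
  rw [e, FA3, zero_mul, zero_sub]; exact neg_mem h
theorem IA_NN {z : FA K n} (hz : z ∈ MFsub K n) (b : FA K n) : z*z*b + z*b*z + b*z*z ∈ IA K n := by
  obtain ⟨b, hb, c, rfl⟩ := MF_split b
  have h1 : z*z*b + z*b*z + b*z*z ∈ IA K n := IA_half (by convert IA_N hz hz hb using 1; abel)
  have e : z*z*(b+c•1) + z*(b+c•1)*z + (b+c•1)*z*z = (z*z*b + z*b*z + b*z*z) + (c • (z*z) + c • (z*z) + c • (z*z)) := by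
    simp only [mul_add, add_mul, mul_smul_comm, smul_mul_assoc, mul_one, one_mul, mul_assoc]; abel
  rw [e, add3, add_zero]; exact h1
theorem IA_TT {k l : FA K n} (hk : k ∈ MFsub K n) (hl : l ∈ MFsub K n) (tk : tp K n k = -k) (tl : tp K n l = -l) (a : FA K n) :
    a*k*l + k*tp K n a*l + k*l*a ∈ IA K n := by
  obtain ⟨a, ha, c, rfl⟩ := MF_split a
  have hb : ∀ {k : FA K n}, tp K n k = -k → bar K n (-k) = k := fun {k} h => by
    rw [bar, tp_neg, h]
    have : -k - - -k = k - 3 * k := by noncomm_ring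
    rw [this, FA3, zero_mul, sub_zero]
  have h1 := IA_T ha (Submodule.neg_mem _ hk) (Submodule.neg_mem _ hl)
  rw [Trel, hb tk, hb tl] at h1
  have e : (a+c•1)*k*l + k*tp K n (a+c•1)*l + k*l*(a+c•1) = (a*k*l + k*tp K n a*l + k*l*a) + (c • (k*l) + c • (k*l) + c • (k*l)) := by
    simp only [tp_add, tp_smul, tp_one, mul_add, add_mul, mul_smul_comm, smul_mul_assoc, mul_one, one_mul, mul_assoc]; abel
  rw [e, add3, add_zero]; exact h1
theorem QN {z : FA K n} (hz : z ∈ MFsub K n) (b) : qt z*qt z*b + qt z*b*qt z + b*qt z*qt z = 0 := by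
  obtain ⟨b, rfl⟩ := qt_surj b
  simp only [← map_mul, ← map_add]; exact qt_zero.2 (IA_NN hz b)
theorem QZ {z : FA K n} (hz : z ∈ MFsub K n) : qt z*qt z*qt z = 0 := by
  simp only [← map_mul]; rw [qt_zero]; have := IA_cube hz; rwa [pow_three, ← mul_assoc] at this
theorem IA_3 {z : FA K n} (hz : z ∈ MFsub K n) (a b c d : FA K n) : a*z*b*z*c*z*d + z*(a*b*z*c*z*d + a*z*b*c*z*d + a*z*b*z*c*d) ∈ IA K n := by
  have := (id34 Q3 (QN hz) (QZ hz) (qt a) (qt b) (qt c) (qt d)).1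
  simp only [← map_mul, ← map_add] at this
  convert IA_r (qt_zero.1 this) d using 1; noncomm_ring
theorem IA_4 {z : FA K n} (hz : z ∈ MFsub K n) (a b c d e : FA K n) : a*z*b*z*c*z*d*z*e ∈ IA K n := by
  have := (id34 Q3 (QN hz) (QZ hz) (qt a) (qt b) (qt c) (qt d)).2
  simp only [← map_mul, ← map_add] at this
  exact IA_r (qt_zero.1 this) e
end QUOT
section ERULE
variable {K : Type} [Field K] {n : ℕ}
theorem IA_tp {x : FA K n} (h : x ∈ IA K n) : tp K n x ∈ IA K n := by
  have : IA K n ≤ (IA K n).comap (tpL (K := K) (d := n)) := by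
    refine IA_ind (fun x y b hb => ?_) (fun x y b c e hb hc he => ?_)
    · show tp K n (x * b ^ 3 * y) ∈ IA K n
      rw [tp_mul, tp_mul]
      refine IA_l _ (IA_r ?_ _)
      have : tp K n (b^3) = (tp K n b)^3 := by simp only [pow_three, tp_mul, mul_assoc]
      rw [this]; exact IA_cube (MF_tp hb)
    · show tp K n (x * Trel K n b c e * y) ∈ IA K n
      rw [tp_mul, tp_mul]
      refine IA_l _ (IA_r ?_ _)
      have : tp K n (Trel K n b c e) = Trel K n (tp K n b) e c := by
        simp only [Trel, bar, tp_add, tp_mul, tp_sub, tp_tp]; noncomm_ring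
      rw [this]; exact IA_T (MF_tp hb) he hc
  exact this h
theorem MF_sk [CharP K 3] (y : FA K n) : y - tp K n y ∈ MFsub K n := by
  obtain ⟨b, hb, c, rfl⟩ := MF_split y
  rw [tp_add, tp_smul, tp_one, add_sub_add_right_eq_sub]; exact MF_bar hb
theorem tp_sk (y : FA K n) : tp K n (y - tp K n y) = -(y - tp K n y) := by rw [tp_sub, tp_tp]; abel
variable [CharP K 3] {z : FA K n} (hz : z ∈ MFsub K n) (tz : tp K n z = -z)
theorem Qhalf {x : (idealA K n).ringCon.Quotient} (h : x + x = 0) : x = 0 := by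
  linear_combination (norm := noncomm_ring) Q3 (K := K) (n := n) * x - h
include hz
theorem e_one (a : FA K n) : qt z * qt a * qt z * qt z + qt z * qt z * qt a * qt z = 0 := by
  linear_combination (norm := noncomm_ring) qt z * QN hz (qt a) - QZ hz * qt a
include tz
theorem e_T (a : FA K n) : qt z * qt z * qt a * qt z = qt z * qt z * qt (tp K n a) * qt z := by
  have h := qt_zero.2 (IA_TT hz hz tz tz a)
  simp only [map_add, map_mul] at h
  linear_combination (norm := noncomm_ring) qt z * QN hz (qt a) - qt z * h
theorem e_R (a b : FA K n) : qt a * (qt z * qt z * qt b * qt z) + qt z * qt z * qt b * qt z * qt a - qt z * qt z * qt a * qt z * qt b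
    + qt z * qt z * (qt b * qt a) * qt z = 0 := by
  have hl : z*z*b - tp K n b*z*z ∈ MFsub K n := Submodule.sub_mem _ (by rw [mul_assoc]; exact MF_mul_right _ hz) (MF_mul_left _ hz)
  have tl : tp K n (z*z*b - tp K n b*z*z) = -(z*z*b - tp K n b*z*z) := by
    simp only [tp_sub, tp_mul, tz, tp_tp]; noncomm_ring
  have h := qt_zero.2 (IA_TT hz hl tz tl a)
  simp only [map_add, map_mul, map_sub] at h
  have Z := QZ hz
  have e1 := e_one hz (tp K n b)
  have e2 := e_one hz (tp K n a)
  have e3 := e_one hz (tp K n (b * a))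
  have t1 := e_T hz tz b
  have t2 := e_T hz tz a
  have t3 := e_T hz tz (b * a)
  simp only [tp_mul, map_mul] at e3 t3
  linear_combination (norm := noncomm_ring) h - qt a * Z * qt b - Z * qt b * qt a + qt a * e1 - e2 * qt b + e3 + e1 * qt a
    + qt a * t1 + t1 * qt a - t2 * qt b + t3
theorem e_l {l : FA K n} (hl : l ∈ MFsub K n) (tl : tp K n l = -l) (a : FA K n) : qt z * qt z * qt a * qt z * qt l = 0 := by
  have h := qt_zero.2 (IA_TT hz hl tz tl a)
  simp only [map_add, map_mul] at h
  have Z := QZ hz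
  linear_combination (norm := noncomm_ring) qt z * qt z * h - Z * qt (tp K n a) * qt l - Z * qt l * qt a
theorem e_la {l : FA K n} (hl : l ∈ MFsub K n) (tl : tp K n l = -l) (a : FA K n) : qt z * qt z * (qt l * qt a) * qt z = 0 := by
  have h0 : qt z * qt z * qt l * qt z = 0 := by
    have := e_T hz tz l
    rw [tl, map_neg] at this
    exact Qhalf (by linear_combination (norm := noncomm_ring) this)
  linear_combination (norm := noncomm_ring) e_R hz tz a l - qt a * h0 - h0 * qt a + e_l hz tz hl tl a
theorem e_al {l : FA K n} (hl : l ∈ MFsub K n) (tl : tp K n l = -l) (a : FA K n) : qt z * qt z * (qt a * qt l) * qt z = 0 := by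
  have h := e_T hz tz (a * l)
  have h' := e_la hz tz hl tl (tp K n a)
  rw [tp_mul, tl] at h
  simp only [map_mul, map_neg] at h
  linear_combination (norm := noncomm_ring) h - h'
theorem e_yl {l : FA K n} (hl : l ∈ MFsub K n) (tl : tp K n l = -l) (a y : FA K n) : qt z * qt z * qt a * qt z * qt y * qt l = 0 := by
  have h1 := e_l hz tz (MF_sk y) (tp_sk y) a
  have h2 := e_l hz tz (l := (y + tp K n y) * l + l * (y + tp K n y)) (Submodule.add_mem _ (MF_mul_left _ hl) (MF_mul_right _ hl))
    (by simp only [tp_add, tp_mul, tl, tp_tp]; noncomm_ring) a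
  have h3 := e_l hz tz hl tl a
  simp only [map_mul, map_add, map_sub] at h1 h2
  exact Qhalf (by linear_combination (norm := noncomm_ring) h2 + h1 * qt l - h3 * (qt y + qt (tp K n y)))
theorem e_xly {l : FA K n} (hl : l ∈ MFsub K n) (tl : tp K n l = -l) (x y : FA K n) : qt z * qt z * (qt x * qt l * qt y) * qt z = 0 := by
  have h1 := e_R hz tz y (x * l)
  have h2 := e_al hz tz hl tl x
  have h3 := e_yl hz tz hl tl y x
  simp only [map_mul] at h1
  linear_combination (norm := noncomm_ring) h1 - qt y * h2 - h2 * qt y + h3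
theorem e_st {s t : FA K n} (hs : tp K n s = s) (ht : tp K n t = t) :
    qt z * qt z * (qt s * qt t) * qt z = qt z * qt z * qt s * qt z * qt t + qt z * qt z * qt t * qt z * qt s := by
  have h1 := e_R hz tz t s
  have h2 : qt (s * (z*z*t*z) + z*z*t*z*s - z*z*s*z*t + z*z*(t*s)*z) = 0 := by
    have := e_R hz tz s t
    simpa only [map_mul, map_add, map_sub] using this
  have h3 := qt_zero.2 (IA_tp (qt_zero.1 h2))
  have h4 := e_R hz tz s t
  simp only [tp_add, tp_sub, tp_mul, tz, hs, ht, map_add, map_sub, map_mul, map_neg] at h3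
  have e1 := e_one hz s
  have e2 := e_one hz t
  have e3 := e_one hz (s * t)
  have e4 := e_T hz tz (s * t)
  simp only [tp_mul, hs, ht, map_mul] at e3 e4
  have c : qt t * (qt z * qt z * qt s * qt z) = qt z * qt z * qt s * qt z * qt t := by
    linear_combination (norm := noncomm_ring) h4 - h3 - e2 * qt s - qt s * e2 + qt t * e1 - e3 + e4
  linear_combination (norm := noncomm_ring) h1 - c - Q3 (K := K) (n := n) * (qt z * qt z * qt s * qt z * qt t)
theorem e_bt {t : FA K n} (ht : tp K n t = t) (b : FA K n) :
    qt z * qt z * (qt b * qt t) * qt z = qt z * qt z * qt b * qt z * qt t + qt z * qt z * qt t * qt z * qt b := by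
  have h1 := e_st hz tz (s := b + tp K n b) (by rw [tp_add, tp_tp, add_comm]) ht
  have h2 := e_la hz tz (MF_sk b) (tp_sk b) t
  have h3 := e_l hz tz (MF_sk b) (tp_sk b) t
  have h4 := e_T hz tz b
  simp only [map_add, map_sub] at h1 h2 h3
  refine sub_eq_zero.1 (Qhalf ?_)
  linear_combination (norm := noncomm_ring) h1 + h2 - h4 * qt t - h3
end ERULE
section YW
variable {K : Type} [Field K] {n : ℕ}
noncomputable def ys (ε : Fin n → Bool) (i : Fin n) : FA K n := ι K (i, false) + (if ε i then -1 else 1 : K) • ι K (i, true)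
noncomputable def yw (ε : Fin n → Bool) (l : List (Fin n)) : FA K n := (l.map (ys ε)).prod
theorem yw_nil (ε : Fin n → Bool) : yw (K := K) ε [] = 1 := rfl
theorem yw_cons (ε : Fin n → Bool) (i l) : yw (K := K) ε (i :: l) = ys ε i * yw ε l := by simp [yw]
theorem yw_append (ε : Fin n → Bool) (l l') : yw (K := K) ε (l ++ l') = yw ε l * yw ε l' := by simp [yw]
theorem tp_ys (ε : Fin n → Bool) (i) : tp K n (ys ε i) = (if ε i then -1 else 1 : K) • ys ε i := by
  rw [ys, tp_add, tp_smul, tp_iota, tp_iota]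
  simp only [flp, Bool.not_false, Bool.not_true]
  cases ε i <;> simp [add_comm]
theorem MF_ys (ε : Fin n → Bool) (i) : ys ε i ∈ MFsub K n := Submodule.add_mem _ (MF_iota _) (smul_mem _ _ (MF_iota _))
noncomputable def WS (K : Type) [Field K] (ε : Fin n → Bool) (M : Multiset (Fin n)) : Submodule K (FA K n) :=
  span K {w | ∃ l : List (Fin n), (l : Multiset (Fin n)) = M ∧ w = yw ε l}
theorem WS_yw (ε : Fin n → Bool) (l : List (Fin n)) : yw ε l ∈ WS K ε (l : Multiset (Fin n)) := subset_span ⟨l, rfl, rfl⟩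
theorem WS_yw' {ε : Fin n → Bool} {l : List (Fin n)} {M} (h : (l : Multiset (Fin n)) = M) : yw ε l ∈ WS K ε M := h ▸ WS_yw ε l
theorem WS_le {ε : Fin n → Bool} {M} {S : Submodule K (FA K n)} (h : ∀ l : List (Fin n), (l : Multiset (Fin n)) = M → yw ε l ∈ S) : WS K ε M ≤ S := by
  refine span_le.2 ?_
  rintro _ ⟨l, hl, rfl⟩; exact h l hl
theorem WS_cons {ε : Fin n → Bool} {M} (i) {x : FA K n} (hx : x ∈ WS K ε M) : ys ε i * x ∈ WS K ε (i ::ₘ M) := by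
  have : WS K ε M ≤ (WS K ε (i ::ₘ M)).comap (LinearMap.mulLeft K (ys ε i)) := WS_le fun l hl => by
    show ys ε i * yw ε l ∈ WS K ε (i ::ₘ M)
    rw [← yw_cons]; exact WS_yw' (by rw [← hl]; rfl)
  exact this hx
theorem Sh_yw {m : ℕ} {ε : Fin n → Bool} {ε' : Fin m → Bool} {a : Fin n → FA K m} {q : Fin n → Fin m} {l : List (Fin n)}
    (h : ∀ k ∈ l, a k = ι K (q k, false) ∧ ε' (q k) = ε k) : Sh a (yw ε l) = yw ε' (l.map q) := by
  induction l with
  | nil => simp [yw_nil]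
  | cons k l ih =>
    obtain ⟨h1, h2⟩ := h k (by simp)
    rw [List.map_cons, yw_cons, yw_cons, map_mul, ih fun k hk => h k (by simp [hk])]
    congr 1
    rw [ys, ys, map_add, map_smul, Sh_iota, Sh_iota]
    simp [h1, h2, tp_iota, flp]
theorem splt {i : Fin n} {l : List (Fin n)} (h : i ∈ l) : ∃ a b, l = a ++ i :: b ∧ i ∉ a ∧ b.count i + 1 = l.count i := by
  obtain ⟨a, b, rfl, h'⟩ := List.eq_append_cons_of_mem h
  exact ⟨a, b, rfl, h', by simp [List.count_eq_zero_of_not_mem h']⟩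
theorem dl_yw0 {ε : Fin n → Bool} {i : Fin n} {l : List (Fin n)} (h : i ∉ l) : dl (K := K) i (yw ε l) = 0 := by
  induction l with
  | nil => exact dl_one i
  | cons k l ih =>
    simp only [List.mem_cons, not_or] at h
    rw [yw_cons, dl_mul, ih h.2, ys, map_add, map_smul, dl_iota, dl_iota]
    simp [Ne.symm h.1]
variable [CharP K 3]
theorem dl_ys {ε : Fin n → Bool} (i k : Fin n) : dl (K := K) k (ys ε i) = if i = k then (if ε i then 0 else -1) else 0 := by
  rw [ys, map_add, map_smul, dl_iota, dl_iota]
  by_cases h : i = k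
  · cases ε i
    · simp [h]; exact eq_neg_of_add_eq_zero_left (add3 _)
    · simp [h]
  · simp [h]
theorem dl_WS {ε : Fin n → Bool} (i : Fin n) {M} {U : FA K n} (hU : U ∈ WS K ε M) : dl i U ∈ WS K ε (M.erase i) := by
  have : WS K ε M ≤ (WS K ε (M.erase i)).comap (dl (K := K) i) := WS_le fun l hl => by
    subst hl
    clear hU
    show dl i (yw ε l) ∈ WS K ε ((l : Multiset (Fin n)).erase i)
    induction l with
    | nil => rw [yw_nil, dl_one]; exact zero_mem _
    | cons k l ih =>
      rw [yw_cons, dl_mul, dl_ys, ← Multiset.cons_coe]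
      by_cases h : k = i
      · subst h
        rw [Multiset.erase_cons_head]
        refine add_mem ?_ ?_
        · by_cases hk : k ∈ l
          · have := WS_cons k ih
            rwa [Multiset.cons_erase (by exact_mod_cast hk)] at this
          · rw [dl_yw0 hk, mul_zero]; exact zero_mem _
        · simp only [if_true]
          split
          · rw [zero_mul]; exact zero_mem _
          · rw [neg_mul, one_mul]; exact neg_mem (WS_yw ε l)
      · rw [if_neg h, zero_mul, add_zero, Multiset.erase_cons_tail _ h]
        exact WS_cons k ih
  exact this hU
theorem caseA {ε : Fin n → Bool} {i : Fin n} {M} (h : 4 ≤ M.count i) : WS K ε M ≤ IA K n := WS_le fun l hl => by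
  subst hl
  rw [Multiset.coe_count] at h
  obtain ⟨a, l, rfl, -, h1⟩ := splt (count_pos_iff.1 (by omega : 0 < l.count i))
  obtain ⟨b, l, rfl, -, h2⟩ := splt (count_pos_iff.1 (by omega : 0 < l.count i))
  obtain ⟨c, l, rfl, -, h3⟩ := splt (count_pos_iff.1 (by omega : 0 < l.count i))
  obtain ⟨e, l, rfl, -, h3⟩ := splt (count_pos_iff.1 (by omega : 0 < l.count i))
  have := IA_4 (MF_ys (K := K) ε i) (yw ε a) (yw ε b) (yw ε c) (yw ε e) (yw ε l)
  convert this using 1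
  simp only [yw_append, yw_cons, mul_assoc]
theorem caseB {ε : Fin n → Bool} {i : Fin n} {M} (h : M.count i = 3) (hi : ε i = false) {U : FA K n} (hU : U ∈ WS K ε M) :
    U - ys ε i * dl i U ∈ IA K n := by
  have : WS K ε M ≤ (IA K n).comap (LinearMap.id - LinearMap.mulLeft K (ys ε i) ∘ₗ dl i) := WS_le fun l hl => by
    subst hl
    rw [Multiset.coe_count] at h
    obtain ⟨a, l, rfl, ha, h1⟩ := splt (count_pos_iff.1 (by omega : 0 < l.count i))
    obtain ⟨b, l, rfl, hb, h2⟩ := splt (count_pos_iff.1 (by omega : 0 < l.count i))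
    obtain ⟨c, l, rfl, hc, h3⟩ := splt (count_pos_iff.1 (by omega : 0 < l.count i))
    have he : i ∉ l := List.count_eq_zero.1 (by omega)
    have := IA_3 (MF_ys (K := K) ε i) (yw ε a) (yw ε b) (yw ε c) (yw ε l)
    show yw ε _ - ys ε i * dl i (yw ε _) ∈ IA K n
    convert this using 1
    simp only [yw_append, yw_cons, dl_mul, dl_yw0 ha, dl_yw0 hb, dl_yw0 hc, dl_yw0 he, dl_ys, hi, if_true, Bool.false_eq_true, if_false, neg_mul, one_mul, mul_neg, mul_zero, zero_mul]
    noncomm_ring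
  exact this hU
theorem caseD {ε : Fin n → Bool} {i : Fin n} {M} (h : M.count i = 2) {U : FA K n} (hU : U ∈ WS K ε M) (hH : U ∈ Hs K n)
    (IH : ∀ V ∈ WS K (Fin.cons (ε i) ε : Fin (n+1) → Bool) (0 ::ₘ (M.erase i).map Fin.succ), V ∈ Hs K (n+1) → V ∈ IA K (n+1)) : U ∈ IA K n := by
  let o : Fin n → FA K (n+1) := fun k => ι K (k.succ, false)
  let f2 : Fin n → FA K (n+1) := fun k => if k = i then ι K (0, false) else o k
  let f1 : Fin n → FA K (n+1) := fun k => if k = i then o i + ι K (0, false) else o k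
  let g : Fin (n+1) → FA K n := Fin.cons (ι K (i, false)) fun k => ι K (k, false)
  let ε' : Fin (n+1) → Bool := Fin.cons (ε i) ε
  have ho : ∀ k, o k ∈ MFsub K (n+1) := fun k => MF_iota _
  have hf2 : ∀ k, f2 k ∈ MFsub K (n+1) := fun k => by dsimp only [f2]; split; exacts [MF_iota _, ho k]
  have hf1 : ∀ k, f1 k ∈ MFsub K (n+1) := fun k => by dsimp only [f1]; split; exacts [Submodule.add_mem _ (ho i) (MF_iota _), ho k]
  have hg : ∀ k, g k ∈ MFsub K n := fun k => by refine Fin.cases ?_ (fun k => ?_) k <;> exact MF_iota _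
  let T : FA K n →ₗ[K] FA K (n+1) := (Sh f1).toLinearMap - (Sh o).toLinearMap - (Sh f2).toLinearMap
  have key : WS K ε M ≤ (WS K ε' (0 ::ₘ (M.erase i).map Fin.succ)).comap T ⊓ LinearMap.eqLocus ((Sh g).toLinearMap ∘ₗ T) (2 • LinearMap.id) := WS_le fun l hl => by
    subst hl
    rw [Multiset.coe_count] at h
    obtain ⟨a, l, rfl, ha, h1⟩ := splt (count_pos_iff.1 (by omega : 0 < l.count i))
    obtain ⟨b, l, rfl, hb, h2⟩ := splt (count_pos_iff.1 (by omega : 0 < l.count i))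
    have hc : i ∉ l := List.count_eq_zero.1 (by omega)
    have so : ∀ x, Sh o (yw ε x) = yw ε' (x.map Fin.succ) := fun x => Sh_yw fun k _ => ⟨rfl, rfl⟩
    have s2 : ∀ x, i ∉ x → Sh f2 (yw ε x) = yw ε' (x.map Fin.succ) := fun x hx => Sh_yw fun k hk => ⟨if_neg (fun h' : k = i => hx (h' ▸ hk)), rfl⟩
    have s1 : ∀ x, i ∉ x → Sh f1 (yw ε x) = yw ε' (x.map Fin.succ) := fun x hx => Sh_yw fun k hk => ⟨if_neg (fun h' : k = i => hx (h' ▸ hk)), rfl⟩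
    have t0 : Sh o (ys ε i) = ys ε' i.succ := by rw [ys, ys, map_add, map_smul, Sh_iota, Sh_iota]; simp [o, tp_iota, flp, ε']
    have t2 : Sh f2 (ys ε i) = ys ε' 0 := by rw [ys, ys, map_add, map_smul, Sh_iota, Sh_iota]; simp [f2, tp_iota, flp, ε']
    have t1 : Sh f1 (ys ε i) = ys ε' i.succ + ys ε' 0 := by
      simp only [ys, Sh_iota, f1, o, tp_iota, flp, ε', map_add, map_smul, tp_add, if_true, Fin.cons_zero, Fin.cons_succ, smul_add, Bool.not_false, Bool.false_eq_true, if_false]; abel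
    have e : T (yw ε (a ++ i :: (b ++ i :: l))) = yw ε' (a.map Fin.succ ++ i.succ :: (b.map Fin.succ ++ 0 :: l.map Fin.succ))
        + yw ε' (a.map Fin.succ ++ 0 :: (b.map Fin.succ ++ i.succ :: l.map Fin.succ)) := by
      simp only [T, LinearMap.sub_apply, AlgHom.toLinearMap_apply, yw_append, yw_cons, map_mul, so, s1 _ ha, s1 _ hb, s1 _ hc, s2 _ ha, s2 _ hb, s2 _ hc, t0, t1, t2]
      noncomm_ring
    have er : (((a ++ i :: (b ++ i :: l) : List (Fin n)) : Multiset (Fin n)).erase i) = ((a ++ (b ++ i :: l) : List (Fin n)) : Multiset (Fin n)) := by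
      rw [Multiset.coe_erase, List.erase_append_right _ ha]; simp
    constructor
    · rw [er]; refine Submodule.mem_comap.2 ?_
      rw [e]
      refine add_mem (WS_yw' ?_) (WS_yw' ?_) <;>
      · simp only [← Multiset.coe_add, ← Multiset.cons_coe, Multiset.map_add, Multiset.map_cons, Multiset.map_coe, ← Multiset.singleton_add, Multiset.map_singleton]; abel
    · show Sh g (T _) = 2 • yw ε _
      have hgg : ∀ x, Sh g (yw ε' x) = yw ε (x.map (Fin.cons i id : Fin (n+1) → Fin n)) := fun x => Sh_yw fun k _ => by
        refine Fin.cases ?_ (fun k => ?_) k <;> exact ⟨rfl, rfl⟩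
      have hm : ∀ x : List (Fin n), (x.map Fin.succ).map (Fin.cons i id : Fin (n+1) → Fin n) = x := fun x => by
        rw [List.map_map]; convert List.map_id x; funext k; rfl
      rw [e, map_add, hgg, hgg]
      simp only [List.map_append, List.map_cons, hm, Fin.cons_zero, Fin.cons_succ, id, two_smul]
  obtain ⟨k1, k2⟩ := key hU
  have h3 := Sh_IA hg (IH _ k1 (sub_mem (sub_mem (Sh_H hf1 hH) (Sh_H ho hH)) (Sh_H hf2 hH)))
  have k3 : Sh g (T U) = 2 • U := k2
  rw [k3, two_smul] at h3
  exact IA_half h3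
end YW
section CASEC
variable {K : Type} [Field K] {n : ℕ} [CharP K 3] {ε : Fin n → Bool} {κ : Fin n} (hκ : ε κ = true) {M : Multiset (Fin n)}
theorem sup_qt {S : Submodule K (FA K n)} {x y : FA K n} (hy : y ∈ S ⊔ IA K n) (h : qt x = qt y) : x ∈ S ⊔ IA K n := by
  have := add_mem (Submodule.mem_sup_right (S := S) (qt_eq.1 h)) hy
  rwa [sub_add_cancel] at this
def EW (K : Type) [Field K] (ε : Fin n → Bool) (κ : Fin n) (M : Multiset (Fin n)) : Submodule K (FA K n) :=
  span K {w | ∃ b d : List (Fin n), (b : Multiset (Fin n)) + d = M ∧ w = yw ε (κ :: κ :: (b ++ κ :: d))}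
def NW (K : Type) [Field K] (ε : Fin n → Bool) (κ : Fin n) (M : Multiset (Fin n)) (J : Fin n → Prop) : Submodule K (FA K n) :=
  span K {w | ∃ i, ∃ r : List (Fin n), J i ∧ i ::ₘ (r : Multiset (Fin n)) = M ∧ w = yw ε (κ :: κ :: i :: κ :: r)}
theorem tp_sky {i : Fin n} (h : ε i = true) : tp K n (ys ε i) = -ys ε i := by rw [tp_ys, h]; simp
theorem tp_sy {i : Fin n} (h : ε i = false) : tp K n (ys ε i) = ys ε i := by rw [tp_ys, h]; simp
include hκ
theorem C1a (a b e : List (Fin n)) (h : (a : Multiset (Fin n)) + b + e = M) :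
    yw ε a * (ys ε κ * ys ε κ * yw ε b * ys ε κ) * yw ε e ∈ EW K ε κ M ⊔ IA K n := by
  have g : ∀ b d : List (Fin n), (b : Multiset (Fin n)) + d = M → yw ε (κ :: κ :: (b ++ κ :: d)) ∈ EW K ε κ M ⊔ IA K n :=
    fun b d h => Submodule.mem_sup_left (subset_span ⟨b, d, h, rfl⟩)
  refine sup_qt (sub_mem (sub_mem (g a (b ++ e) ?_) (g b (a ++ e) ?_)) (g (b ++ a) e ?_)) ?_
  · rw [← h, ← Multiset.coe_add, add_assoc]
  · rw [← h, ← Multiset.coe_add]; abel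
  · rw [← h, ← Multiset.coe_add]; abel
  · have := e_R (MF_ys ε κ) (tp_sky (K := K) hκ) (yw ε a) (yw ε b)
    simp only [yw_cons, yw_append, map_sub, map_mul]
    linear_combination (norm := noncomm_ring) this * qt (yw ε e)
theorem C1 : WS K ε (κ ::ₘ κ ::ₘ κ ::ₘ M) ≤ EW K ε κ M ⊔ IA K n := WS_le fun l hl => by
  have h : 3 ≤ l.count κ := by rw [← Multiset.coe_count, hl]; simp
  obtain ⟨a, l, rfl, -, h1⟩ := splt (count_pos_iff.1 (by omega : 0 < l.count κ))
  obtain ⟨b, l, rfl, -, h2⟩ := splt (count_pos_iff.1 (by omega : 0 < l.count κ))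
  obtain ⟨c, e, rfl, -, h3⟩ := splt (count_pos_iff.1 (by omega : 0 < l.count κ))
  have hm : (a : Multiset (Fin n)) + b + c + e = M := by
    simp only [← Multiset.coe_add, ← Multiset.cons_coe, ← Multiset.singleton_add] at hl
    refine add_left_cancel (a := {κ} + ({κ} + {κ})) (Eq.trans ?_ (hl.trans ?_)) <;> abel
  refine sup_qt (sub_mem (neg_mem (C1a hκ a (b ++ c) e ?_)) (C1a hκ (a ++ b) c e ?_)) ?_
  · rw [← hm, ← Multiset.coe_add, ← add_assoc]
  · rw [← hm, ← Multiset.coe_add]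
  · have := QN (MF_ys (K := K) ε κ) (qt (yw ε b))
    simp only [yw_cons, yw_append, map_mul, map_sub, map_neg]
    linear_combination (norm := noncomm_ring) qt (yw ε a) * this * qt (yw ε c) * qt (ys ε κ) * qt (yw ε e)
omit hκ in
theorem C2 (hκ : ε κ = true) {k : Fin n} (hk : ε k = true) (hM : k ∈ M) : EW K ε κ M ≤ IA K n := by
  refine span_le.2 ?_
  rintro _ ⟨b, e, rfl, rfl⟩
  refine qt_zero.1 ?_
  rw [Multiset.mem_add] at hM
  rcases hM with h | h
  · obtain ⟨p, q, rfl, -⟩ := splt (Multiset.mem_coe.1 h)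
    have := e_xly (MF_ys ε κ) (tp_sky (K := K) hκ) (MF_ys ε k) (tp_sky hk) (yw ε p) (yw ε q)
    simp only [yw_cons, yw_append, map_mul]
    linear_combination (norm := noncomm_ring) this * qt (yw ε e)
  · obtain ⟨p, q, rfl, -⟩ := splt (Multiset.mem_coe.1 h)
    have := e_yl (MF_ys ε κ) (tp_sky (K := K) hκ) (MF_ys ε k) (tp_sky hk) (yw ε b) (yw ε p)
    simp only [yw_cons, yw_append, map_mul]
    linear_combination (norm := noncomm_ring) this * qt (yw ε q)
theorem C3 (hM : ∀ i ∈ M, ε i = false) : EW K ε κ M ≤ NW K ε κ M (fun _ => True) ⊔ IA K n := by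
  refine span_le.2 ?_
  rintro _ ⟨b, e, h, rfl⟩
  show _ ∈ NW K ε κ M (fun _ => True) ⊔ IA K n
  induction b using List.reverseRecOn generalizing e with
  | nil =>
    refine Submodule.mem_sup_right (qt_zero.1 ?_)
    have := QZ (MF_ys (K := K) ε κ)
    simp only [yw_cons, List.nil_append, map_mul]
    linear_combination (norm := noncomm_ring) this * qt (yw ε e)
  | append_singleton b t ih =>
    have ht : t ∈ M := by rw [← h]; simp
    have := e_bt (MF_ys ε κ) (tp_sky (K := K) hκ) (tp_sy (hM t ht)) (yw ε b)
    refine sup_qt (add_mem (ih (t :: e) ?_) (Submodule.mem_sup_left (subset_span ⟨t, b ++ e, trivial, ?_, rfl⟩))) ?_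
    · rw [← h, ← Multiset.coe_add, ← Multiset.cons_coe, ← Multiset.singleton_add]; simp only [Multiset.coe_singleton]; abel
    · rw [← h, ← Multiset.coe_add, ← Multiset.coe_add, ← Multiset.singleton_add]; simp only [Multiset.coe_singleton]; abel
    · simp only [yw_cons, yw_append, yw_nil, mul_one, map_mul, map_add]
      linear_combination (norm := noncomm_ring) this * qt (yw ε e)
theorem Ccomm {j i : Fin n} (hj : ε j = false) (r : List (Fin n)) (hr : ∀ i ∈ r, ε i = false) (w : FA K n) :
    qt (ys ε κ * ys ε κ * ys ε i * ys ε κ * w * ys ε j * yw ε r) = qt (ys ε κ * ys ε κ * ys ε i * ys ε κ * w * yw ε r * ys ε j) := by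
  induction r generalizing w with
  | nil => simp [yw_nil]
  | cons k r ih =>
    have h1 := ih (fun i hi => hr i (by simp [hi])) (w * ys ε k)
    have h2 := e_yl (MF_ys ε κ) (tp_sky (K := K) hκ) (l := ys ε j * ys ε k - ys ε k * ys ε j)
      (Submodule.sub_mem _ (MF_mul_left _ (MF_ys ε k)) (MF_mul_left _ (MF_ys ε j)))
      (by rw [tp_sub, tp_mul, tp_mul, tp_sy hj, tp_sy (hr k (by simp))]; abel) (ys ε i) w
    simp only [yw_cons, map_mul, map_sub] at h1 h2 ⊢
    linear_combination (norm := noncomm_ring) h1 + h2 * qt (yw ε r)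
theorem Cstep (hM : ∀ i ∈ M, ε i = false) (hn : M.Nodup) {j : Fin n} (hj : j ∈ M) {J} {V : FA K n} (hV : V ∈ NW K ε κ M J) :
    V + dl j V * ys ε j ∈ NW K ε κ M (fun i => J i ∧ i = j) ⊔ IA K n := by
  have : NW K ε κ M J ≤ (NW K ε κ M (fun i => J i ∧ i = j) ⊔ IA K n).comap (LinearMap.id + LinearMap.mulRight K (ys ε j) ∘ₗ dl j) := by
    refine span_le.2 ?_
    rintro _ ⟨i, r, hi, rfl, rfl⟩
    show yw ε _ + dl j (yw ε _) * ys ε j ∈ NW K ε κ _ (fun i => J i ∧ i = j) ⊔ IA K n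
    simp only [Multiset.nodup_cons, Multiset.mem_coe, Multiset.coe_nodup, Multiset.mem_cons] at hn hj hM
    by_cases h : i = j
    · subst h
      refine sup_qt (Submodule.mem_sup_left (subset_span ⟨i, r, ⟨hi, rfl⟩, rfl, rfl⟩)) ?_
      have := QZ (MF_ys (K := K) ε κ)
      simp only [yw_cons, dl_mul, dl_ys, hκ, dl_yw0 hn.1, hM i (Or.inl rfl), if_true, ite_self, Bool.false_eq_true, if_false, mul_zero, zero_mul, zero_add, add_zero, neg_mul, one_mul, mul_neg, map_add, map_mul, map_neg]
      linear_combination (norm := noncomm_ring) - this * qt (yw ε r) * qt (ys ε i)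
    · obtain ⟨p, q, rfl, hp, hc⟩ := splt (hj.resolve_left (Ne.symm h))
      have hq : j ∉ q := fun hq => by
        have := List.nodup_iff_count_le_one.1 hn.2 j
        have := count_pos_iff.2 hq
        omega
      refine Submodule.mem_sup_right (qt_zero.1 ?_)
      have := Ccomm (K := K) (i := i) hκ (hM j (by simp)) q (fun i hi => hM i (by simp [hi])) (yw ε p)
      simp only [yw_append, yw_cons, dl_mul, dl_ys, hκ, h, dl_yw0 hp, dl_yw0 hq, hM j (by simp), if_true, ite_self, Bool.false_eq_true, if_false, mul_zero, zero_mul, zero_add, add_zero, neg_mul, one_mul, mul_neg, map_add, map_mul, map_neg] at this ⊢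
      linear_combination (norm := noncomm_ring) this
  exact this hV
theorem Cred (hM : ∀ i ∈ M, ε i = false) (hn : M.Nodup) {j : Fin n} (hj : j ∈ M)
    (IH : ∀ V ∈ WS K ε ((κ ::ₘ κ ::ₘ κ ::ₘ M).erase j), V ∈ Hs K n → V ∈ IA K n) {J} {V : FA K n} (hV : V ∈ NW K ε κ M J ⊔ IA K n) (hH : V ∈ Hs K n) :
    V ∈ NW K ε κ M (fun i => J i ∧ i = j) ⊔ IA K n := by
  obtain ⟨v, hv, w, hw, rfl⟩ := Submodule.mem_sup.1 hV
  have hv' : v ∈ Hs K n := by have := sub_mem hH (IA_H hw); rwa [add_sub_cancel_right] at this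
  have h1 : NW K ε κ M J ≤ WS K ε (κ ::ₘ κ ::ₘ κ ::ₘ M) := by
    refine span_le.2 ?_
    rintro _ ⟨i, r, hi, rfl, rfl⟩
    refine WS_yw' ?_
    simp only [← Multiset.cons_coe, ← Multiset.singleton_add]; abel
  have h2 := IH _ (dl_WS j (h1 hv)) (dl_H j hv')
  have h3 := Cstep hκ hM hn hj hv
  have := add_mem (sub_mem h3 (Submodule.mem_sup_right (IA_r h2 (ys ε j)))) (Submodule.mem_sup_right hw)
  rwa [add_sub_cancel_right] at this
theorem caseC (hn : ∀ i ∈ M, ε i = false → M.count i ≤ 1)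
    (IH : ∀ j ∈ M, ∀ V ∈ WS K ε ((κ ::ₘ κ ::ₘ κ ::ₘ M).erase j), V ∈ Hs K n → V ∈ IA K n)
    (base : ∀ s, ε s = false → yw (K := K) ε [κ, κ, s, κ] ∉ Hs K n)
    {U : FA K n} (hU : U ∈ WS K ε (κ ::ₘ κ ::ₘ κ ::ₘ M)) (hH : U ∈ Hs K n) : U ∈ IA K n := by
  have hU := C1 hκ hU
  by_cases hk : ∃ k ∈ M, ε k = true
  · obtain ⟨k, hk, h⟩ := hk
    exact (sup_le (C2 hκ h hk) le_rfl) hU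
  have hM : ∀ i ∈ M, ε i = false := fun i hi => by
    by_contra h; exact hk ⟨i, hi, by simpa using h⟩
  have hn : M.Nodup := Multiset.nodup_iff_count_le_one.2 fun i => by
    by_cases hi : i ∈ M
    · exact hn i hi (hM i hi)
    · rw [Multiset.count_eq_zero_of_notMem hi]; omega
  have hU := (sup_le (C3 hκ hM) le_sup_right) hU
  rcases M.empty_or_exists_mem with rfl | ⟨j, hj⟩
  · refine (sup_le (a := NW K ε κ 0 (fun _ => True)) (c := IA K n) (span_le.2 ?_) le_rfl) hU
    rintro _ ⟨i, r, -, h, rfl⟩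
    simp at h
  obtain ⟨M, rfl⟩ := Multiset.exists_cons_of_mem hj
  rcases M.empty_or_exists_mem with rfl | ⟨k, hk⟩
  · obtain ⟨v, hv, w, hw, rfl⟩ := Submodule.mem_sup.1 hU
    have hv' : v ∈ Hs K n := by have := sub_mem hH (IA_H hw); rwa [add_sub_cancel_right] at this
    have : NW K ε κ {j} (fun _ => True) ≤ span K {yw ε [κ, κ, j, κ]} := by
      refine span_le.2 ?_
      rintro _ ⟨i, r, -, h, rfl⟩
      have : i ::ₘ (r : Multiset (Fin n)) = j ::ₘ 0 := h
      have h' := congrArg Multiset.card this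
      simp at h'; subst h'
      simp at this; subst this
      exact Submodule.mem_span_singleton_self _
    obtain ⟨c, rfl⟩ := Submodule.mem_span_singleton.1 (this hv)
    by_cases hc : c = 0
    · rw [hc, zero_smul, zero_add]; exact hw
    · exact absurd ((Submodule.smul_mem_iff _ hc).1 hv') (base j (hM j hj))
  · have hk' : k ∈ j ::ₘ M := Multiset.mem_cons_of_mem hk
    have h1 := Cred hκ hM hn hk' (IH k hk') (Cred hκ hM hn hj (IH j hj) hU hH) hH
    refine (sup_le (a := NW K ε κ (j ::ₘ M) _) (c := IA K n) (span_le.2 ?_) le_rfl) h1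
    rintro _ ⟨i, r, ⟨⟨-, h1⟩, h2⟩, -, rfl⟩
    exact absurd hk (by rw [← h2, h1]; exact (Multiset.nodup_cons.1 hn).1)
end CASEC
section BASE
open Matrix
variable {K : Type} [Field K] {d : ℕ}
theorem bil0 [CharP K 3] (b : M3 K →ₗ[K] M3 K →ₗ[K] K) (hb : ∀ g A B A' B' : M3 K, gᵀ * g = 1 ∧ gᵀ * A * g = A' ∧ gᵀ * B * g = B' → b A' B' = b A B)
    (p q r t u v : K) : b !![0,1,-1;-1,0,1;1,-1,0] !![p,q,r;q,t,u;r,u,v] = 0 := by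
  have e0 : ∀ p q r t u v : K, b !![0,1,0;-1,0,0;0,0,0] !![p,q,r;q,t,u;r,u,v] = 0 := by
    intro p q r t u v
    have h1 := hb !![-1,0,0;0,1,0;0,0,1] !![0,1,0;-1,0,0;0,0,0] !![p,q,r;q,t,u;r,u,v] (-!![0,1,0;-1,0,0;0,0,0]) !![p,-q,-r;-q,t,u;-r,u,v]
      (by refine ⟨?_, ?_, ?_⟩ <;> ext i j <;> fin_cases i <;> fin_cases j <;> simp [mul_apply, sum_univ_three])
    have h2 := hb !![1,0,0;0,-1,0;0,0,1] !![0,1,0;-1,0,0;0,0,0] !![p,q,r;q,t,u;r,u,v] (-!![0,1,0;-1,0,0;0,0,0]) !![p,-q,r;-q,t,-u;r,-u,v]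
      (by refine ⟨?_, ?_, ?_⟩ <;> ext i j <;> fin_cases i <;> fin_cases j <;> simp [mul_apply, sum_univ_three])
    have h3 := hb !![1,0,0;0,1,0;0,0,-1] !![0,1,0;-1,0,0;0,0,0] !![p,q,r;q,t,u;r,u,v] !![0,1,0;-1,0,0;0,0,0] !![p,q,-r;q,t,-u;-r,-u,v]
      (by refine ⟨?_, ?_, ?_⟩ <;> ext i j <;> fin_cases i <;> fin_cases j <;> simp [mul_apply, sum_univ_three])
    have h4 := hb !![0,1,0;1,0,0;0,0,1] !![0,1,0;-1,0,0;0,0,0] !![0,q,0;q,0,0;0,0,0] (-!![0,1,0;-1,0,0;0,0,0]) !![0,q,0;q,0,0;0,0,0]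
      (by refine ⟨?_, ?_, ?_⟩ <;> ext i j <;> fin_cases i <;> fin_cases j <;> simp [mul_apply, sum_univ_three])
    have h5 : (4 : K) • !![0,q,0;q,0,0;0,0,0] = !![p,q,r;q,t,u;r,u,v] - !![p,-q,-r;-q,t,u;-r,u,v] - !![p,-q,r;-q,t,-u;r,-u,v] + !![p,q,-r;q,t,-u;-r,-u,v] := by
      ext i j; fin_cases i <;> fin_cases j <;> simp <;> ring
    have h6 := congrArg (b !![0,1,0;-1,0,0;0,0,0]) h5
    have h7 : (3 : K) = 0 := by exact_mod_cast CharP.cast_eq_zero K 3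
    simp only [map_add, map_sub, map_smul, map_neg, LinearMap.neg_apply, smul_eq_mul] at h1 h2 h3 h4 h6
    generalize b !![0,1,0;-1,0,0;0,0,0] = β at *
    linear_combination -h6 - h1 - h2 - h3 - 2 * h4 + β !![p,q,r;q,t,u;r,u,v] * (-1) * h7
  have c1 := hb !![0,1,0;0,0,1;1,0,0] !![0,1,0;-1,0,0;0,0,0] !![t,u,q;u,v,r;q,r,p] !![0,0,0;0,0,1;0,-1,0] !![p,q,r;q,t,u;r,u,v]
      (by refine ⟨?_, ?_, ?_⟩ <;> ext i j <;> fin_cases i <;> fin_cases j <;> simp [mul_apply, sum_univ_three])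
  have c2 := hb !![0,0,1;1,0,0;0,1,0] !![0,1,0;-1,0,0;0,0,0] !![v,r,u;r,p,q;u,q,t] !![0,0,-1;0,0,0;1,0,0] !![p,q,r;q,t,u;r,u,v]
      (by refine ⟨?_, ?_, ?_⟩ <;> ext i j <;> fin_cases i <;> fin_cases j <;> simp [mul_apply, sum_univ_three])
  have hE : (!![0,1,-1;-1,0,1;1,-1,0] : M3 K) = !![0,1,0;-1,0,0;0,0,0] + !![0,0,0;0,0,1;0,-1,0] + !![0,0,-1;0,0,0;1,0,0] := by
    ext i j; fin_cases i <;> fin_cases j <;> simp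
  rw [hE, map_add, map_add, LinearMap.add_apply, LinearMap.add_apply, c1, c2, e0, e0, e0, add_zero, add_zero]
noncomputable def DA (k : Fin d) : M3 K →ₗ[K] Derivation K (Rpoly K d) (Rpoly K d) where
  toFun := fun A => MvPolynomial.mkDerivation K fun p => if p.2.2 = k then MvPolynomial.C (A p.1 p.2.1) else 0
  map_add' := fun A B => by
    apply MvPolynomial.derivation_ext; intro p
    rw [Derivation.add_apply]; simp only [MvPolynomial.mkDerivation_X]; split <;> simp
  map_smul' := fun c A => by
    apply MvPolynomial.derivation_ext; intro p
    rw [Derivation.smul_apply]; simp only [MvPolynomial.mkDerivation_X]; split <;> simp [MvPolynomial.smul_eq_C_mul]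
theorem DA_X (k : Fin d) (A : M3 K) (p) : DA k A (MvPolynomial.X p) = if p.2.2 = k then MvPolynomial.C (A p.1 p.2.1) else 0 :=
  MvPolynomial.mkDerivation_X _ _ _
theorem DA_gen (k l : Fin d) (A : M3 K) : (genMat K d l).map (DA k A) = if l = k then cg A else 0 := by
  refine Matrix.ext fun i j => ?_
  rw [Matrix.map_apply, genMat, Matrix.of_apply, DA_X]; split <;> rfl
theorem D_mul (D : Derivation K (Rpoly K d) (Rpoly K d)) (P Q : M3 (Rpoly K d)) : (P * Q).map D = P * Q.map D + P.map D * Q := by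
  refine Matrix.ext fun i j => ?_
  simp only [Matrix.map_apply, mul_apply, Matrix.add_apply, map_sum, Derivation.leibniz, smul_eq_mul, ← Finset.sum_add_distrib]
  exact Finset.sum_congr rfl fun x _ => by ring
theorem D_cg (D : Derivation K (Rpoly K d) (Rpoly K d)) (g : M3 K) : (cg g : M3 (Rpoly K d)).map D = 0 := by
  exact Matrix.ext fun i j => D.map_algebraMap (g i j)
theorem cg_mul (g h : M3 K) : (cg (g * h) : M3 (Rpoly K d)) = cg g * cg h := (Matrix.map_mul (f := algebraMap K (Rpoly K d)))
theorem DA_act (g A : M3 K) (k : Fin d) (f : Rpoly K d) :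
    DA k A (actHom K d g f) = actHom K d g (DA k (gᵀ * A * g) f) := by
  induction f using MvPolynomial.induction_on with
  | C a =>
    have : actHom K d g (MvPolynomial.C a) = MvPolynomial.C a := (actHom K d g).commutes a
    rw [this]
    have h : ∀ B, DA k B (MvPolynomial.C a : Rpoly K d) = 0 := fun B => (DA k B).map_algebraMap a
    rw [h, h, map_zero]
  | add p q hp hq => simp only [map_add, hp, hq]
  | mul_X p i hp =>
    rw [map_mul, Derivation.leibniz, Derivation.leibniz, hp, map_add, smul_eq_mul, smul_eq_mul, smul_eq_mul, smul_eq_mul, map_mul (actHom K d g), map_mul (actHom K d g)]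
    congr 2
    obtain ⟨i, j, l⟩ := i
    have h1 : actHom K d g (MvPolynomial.X (i, j, l)) = ((cg g)ᵀ * genMat K d l * cg g : M3 (Rpoly K d)) i j := congrFun (congrFun (act_gen (d := d) g l) i) j
    have h2 : ((cg g)ᵀ * genMat K d l * cg g : M3 (Rpoly K d)).map (DA k A) = if l = k then cg (gᵀ * A * g) else 0 := by
      have : ((cg g)ᵀ : M3 (Rpoly K d)).map (DA k A) = 0 := D_cg _ gᵀ
      rw [D_mul, D_mul, D_cg, this, DA_gen, mul_zero, zero_mul, zero_add, add_zero, cg_mul, cg_mul]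
      split
      · rfl
      · simp
    rw [h1, DA_X]
    have h3 := congrFun (congrFun h2 i) j
    rw [Matrix.map_apply] at h3
    rw [h3]
    dsimp only
    split
    · exact ((actHom K d g).commutes _).symm
    · simp
noncomputable def phi (k : Fin d) (E : M3 K) : Rpoly K d →ₐ[K] Polynomial K :=
  MvPolynomial.aeval fun p => if p.2.2 = k then Polynomial.C (E p.1 p.2.1) * Polynomial.X else 0
theorem phi_gen (k l : Fin d) (E : M3 K) : (phi k E).mapMatrix (genMat K d l) = if l = k then (Polynomial.X : Polynomial K) • E.map Polynomial.C else 0 := by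
  ext i j : 1
  simp only [AlgHom.mapMatrix_apply, Matrix.map_apply, genMat, Matrix.of_apply, phi, MvPolynomial.aeval_X]
  split
  · exact mul_comm _ _
  · rfl
theorem phi_cg (k : Fin d) (E g : M3 K) : (phi k E).mapMatrix (cg g) = g.map Polynomial.C := by
  ext i j : 1; exact (phi k E).commutes _
theorem phi_act (k : Fin d) (E g : M3 K) (f) : phi k E (actHom K d g f) = phi k (gᵀ * E * g) f := by
  have : (phi k E).comp (actHom K d g) = phi k (gᵀ * E * g) := by
    apply MvPolynomial.algHom_ext
    rintro ⟨i, j, l⟩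
    have h1 := congrArg (phi k E).mapMatrix (act_gen (d := d) g l)
    have h4 : ((cg g : M3 (Rpoly K d))ᵀ) = cg gᵀ := rfl
    rw [h4, map_mul, map_mul, phi_cg, phi_cg, phi_gen] at h1
    have h2 : _ = (phi k (gᵀ * E * g)).mapMatrix (genMat K d l) := phi_gen (d := d) k l (gᵀ * E * g) |>.symm
    have h3 : (phi k E).mapMatrix ((actHom K d g).mapMatrix (genMat K d l)) = (phi k (gᵀ * E * g)).mapMatrix (genMat K d l) := by
      rw [h1, ← h2]; split
      · rw [Matrix.map_mul, Matrix.map_mul]; simp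
      · simp
    exact congrFun (congrFun h3 i) j
  exact DFunLike.congr_fun this f
theorem phi_smul (k : Fin d) (E : M3 K) (a : K) (f) (i : ℕ) : (phi k (a • E) f).coeff i = (phi k E f).coeff i * a ^ i := by
  have : phi (d := d) k (a • E) = (Polynomial.aeval (Polynomial.C a * Polynomial.X)).comp (phi k E) := by
    apply MvPolynomial.algHom_ext
    intro p
    simp only [phi, AlgHom.comp_apply, MvPolynomial.aeval_X]
    split
    · simp [Matrix.smul_apply]; ring
    · simp
  rw [this, AlgHom.comp_apply, ← Polynomial.comp_eq_aeval, Polynomial.comp_C_mul_X_coeff]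
theorem phi_der (k : Fin d) (E : M3 K) (f) : Polynomial.derivative (phi k E f) = phi k E (DA k E f) := by
  induction f using MvPolynomial.induction_on with
  | C a =>
    have h : DA k E (MvPolynomial.C a : Rpoly K d) = 0 := (DA k E).map_algebraMap a
    have h' : phi k E (MvPolynomial.C a : Rpoly K d) = Polynomial.C a := (phi k E).commutes a
    rw [h, h', map_zero, Polynomial.derivative_C]
  | add p q hp hq => simp only [map_add, hp, hq]
  | mul_X p i hp =>
    rw [map_mul, Derivation.leibniz, Polynomial.derivative_mul, hp, map_add, smul_eq_mul, smul_eq_mul, map_mul, map_mul, DA_X, add_comm, mul_comm (phi k E (DA k E p))]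
    congr 2
    simp only [phi, MvPolynomial.aeval_X]
    split
    · have := (phi k E).commutes (E i.1 i.2.1)
      rw [Polynomial.derivative_mul]; simp [← MvPolynomial.algebraMap_eq]
    · simp
theorem phi_c0 (k : Fin d) (E : M3 K) (f) : (phi k E f).coeff 0 = constantCoeff f := by
  have : (Polynomial.aeval (0 : K)).comp (phi (d := d) k E) = MvPolynomial.aeval 0 := by
    apply MvPolynomial.algHom_ext
    intro p
    simp [phi]; split <;> simp
  have := DFunLike.congr_fun this f
  rw [Polynomial.coeff_zero_eq_eval_zero]
  rw [AlgHom.comp_apply, Polynomial.coe_aeval_eq_eval] at this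
  rw [this]; simp
end BASE
section BASE2
open Matrix
variable {K : Type} [Field K] {d : ℕ}
def mE : M3 K := !![0,1,-1;-1,0,1;1,-1,0]
def mS : M3 K := !![-1,0,-1;0,1,1;-1,1,0]
def mX : M3 K := !![1,1,-1;1,1,-1;-1,-1,1]
theorem torus [CharP K 3] (a : K) (ha : a ≠ 0) : ∃ g : M3 K, gᵀ * g = 1 ∧ gᵀ * mE * g = a • mE ∧ a • (gᵀ * mS * g) = mS := by
  have h7 : (3 : K) = 0 := by exact_mod_cast CharP.cast_eq_zero K 3
  obtain ⟨b, hb⟩ : ∃ b, a * b = 1 := ⟨a⁻¹, mul_inv_cancel₀ ha⟩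
  refine ⟨!![a+b-1,a+b+1,a-b;a+b+1,a+b-1,a-b;b-a,b-a,-a-b], ?_, ?_, ?_⟩
  · ext i j; fin_cases i <;> fin_cases j <;> simp [mul_apply, sum_univ_three] <;> grind
  · ext i j; fin_cases i <;> fin_cases j <;> simp [mul_apply, sum_univ_three, mE] <;> grind
  · ext i j; fin_cases i <;> fin_cases j <;> simp [mul_apply, sum_univ_three, mS] <;> grind
theorem ex_pow [Infinite K] {i j : ℕ} (h : i ≠ j) : ∃ a : K, a ≠ 0 ∧ a ^ i ≠ a ^ j := by
  by_contra! hc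
  have h0 : (Polynomial.X * (Polynomial.X ^ i - Polynomial.X ^ j) : Polynomial K) = 0 := by
    refine Polynomial.funext fun a => ?_
    by_cases ha : a = 0
    · simp [ha]
    · simp [hc a ha]
  rcases mul_eq_zero.1 h0 with h1 | h1
  · exact Polynomial.X_ne_zero h1
  · have := congrArg (fun p => Polynomial.coeff p i) h1
    simp [Polynomial.coeff_X_pow, h] at this
theorem phi0 [Infinite K] [CharP K 3] (k : Fin d) {f : Rpoly K d} (hf : IPl f) : phi k mE f = 0 := by
  ext i
  rcases eq_or_ne i 0 with rfl | hi
  · rw [phi_c0, hf.2]; rfl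
  obtain ⟨a, ha, hi'⟩ := ex_pow (K := K) hi
  obtain ⟨g, hg, hE, -⟩ := torus a ha
  have h := phi_act k mE g f
  rw [hf.1 g hg, hE] at h
  have h2 := phi_smul k mE a f i
  rw [← h] at h2
  rw [pow_zero] at hi'
  rw [Polynomial.coeff_zero]
  by_contra h3
  exact hi' (mul_left_cancel₀ h3 (by rw [← h2, mul_one]))
theorem phi1 [Infinite K] [CharP K 3] (k s : Fin d) {f : Rpoly K d} (hf : IPl f) : phi k mE (DA s mS f) = 0 := by
  ext i
  rw [Polynomial.coeff_zero]
  rcases eq_or_ne i 1 with rfl | hi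
  · have h1 := phi_der k mE (DA s mS f)
    have h2 := congrArg (fun p => Polynomial.coeff p 0) h1
    simp only [Polynomial.coeff_derivative, phi_c0] at h2
    let b : M3 K →ₗ[K] M3 K →ₗ[K] K := LinearMap.mk₂ K (fun A B => constantCoeff (DA k A (DA s B f)))
      (fun A A' B => by simp) (fun c A B => by simp [MvPolynomial.smul_eq_C_mul]) (fun A B B' => by simp) (fun c A B => by simp [MvPolynomial.smul_eq_C_mul])
    have h3 := bil0 b (fun g A B A' B' ⟨hg, hA, hB⟩ => by
      subst hA hB
      show constantCoeff (DA k (gᵀ * A * g) (DA s (gᵀ * B * g) f)) = constantCoeff (DA k A (DA s B f))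
      rw [← act_const (g := g), ← DA_act, ← DA_act, hf.1 g hg]) (-1) 0 (-1) 1 1 0
    have h4 : constantCoeff (DA k mE (DA s mS f)) = 0 := h3
    rw [h4] at h2
    simpa using h2
  · obtain ⟨a, ha, hi'⟩ := ex_pow (K := K) hi
    obtain ⟨g, hg, hE, hS⟩ := torus a ha
    have h := phi_act k mE g (DA s (gᵀ * mS * g) f)
    rw [← DA_act, hf.1 g hg, hE] at h
    have h1 : DA s mS f = a • DA s (gᵀ * mS * g) f := by
      conv_lhs => rw [← hS]
      rw [map_smul]; rfl
    have h5 := congrArg (fun p => Polynomial.coeff (a • p) i) h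
    simp only [← map_smul] at h5
    rw [← h1, phi_smul, map_smul, Polynomial.coeff_smul, smul_eq_mul, mul_comm] at h5
    by_contra h3
    exact hi' ((mul_left_cancel₀ h3 h5).symm.trans (pow_one a).symm)
theorem phiD [Infinite K] [CharP K 3] (k s z : Fin d) {h : Rpoly K d} (hh : h ∈ Dec K d) : phi k mE (DA z mX (DA s mS h)) = 0 := by
  have : Dec K d ≤ LinearMap.ker ((phi (d := d) k mE).toLinearMap ∘ₗ (DA z mX).toLinearMap ∘ₗ (DA s mS).toLinearMap) := by
    refine span_le.2 ?_
    rintro _ ⟨f, g, hf, hg, rfl⟩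
    show phi k mE (DA z mX (DA s mS (f * g))) = 0
    simp only [Derivation.leibniz, map_add, smul_eq_mul, map_mul, phi0 k hf, phi0 k hg, phi1 k s hf, phi1 k s hg, zero_mul, mul_zero, add_zero]
  exact this hh
theorem base [Infinite K] [CharP K 3] {n : ℕ} {ε : Fin n → Bool} {κ s : Fin n} (hκ : ε κ = true) (hs : ε s = false) : yw ε [κ,κ,s,κ] ∉ Hs K n := by
  intro hH
  have hne : s ≠ κ := by rintro rfl; rw [hκ] at hs; cases hs
  rw [mem_Hs] at hH
  have h1 := phiD κ.succ s.succ 0 hH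
  have hA : evMat K (n+1) (emb (ys ε κ)) = genMat K (n+1) κ.succ - (genMat K (n+1) κ.succ)ᵀ := by
    rw [ys, hκ, emb, map_add, map_smul, Sh_iota, Sh_iota, if_pos rfl, map_add, map_smul, if_pos rfl, if_neg (by simp), ev_tp, ← gen_ev, neg_one_smul, sub_eq_add_neg]
  have hB : evMat K (n+1) (emb (ys ε s)) = genMat K (n+1) s.succ + (genMat K (n+1) s.succ)ᵀ := by
    rw [ys, hs, emb, map_add, map_smul, Sh_iota, Sh_iota, if_pos rfl, map_add, map_smul, if_neg (by simp), if_neg (by simp), ev_tp, ← gen_ev, one_smul]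
  have dt : ∀ (D : Derivation K (Rpoly K (n+1)) (Rpoly K (n+1))) (P : M3 (Rpoly K (n+1))), D P.trace = (P.map D).trace := fun D P => by
    simp [trace]
  have ds : ∀ (k l : Fin (n+1)) (A : M3 K), (genMat K (n+1) l - (genMat K (n+1) l)ᵀ).map (DA k A) = if l = k then cg (A - Aᵀ) else 0 := fun k l A => by
    have h := DA_gen k l A
    rw [Matrix.map_sub _ (fun a b => map_sub _ a b), Matrix.transpose_map, h]
    split
    · refine Matrix.ext fun i j => ?_
      simp [cg]
    · simp
  have da : ∀ (k l : Fin (n+1)) (A : M3 K), (genMat K (n+1) l + (genMat K (n+1) l)ᵀ).map (DA k A) = if l = k then cg (A + Aᵀ) else 0 := fun k l A => by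
    have h := DA_gen k l A
    rw [Matrix.map_add _ (fun a b => map_add _ a b), Matrix.transpose_map, h]
    split
    · refine Matrix.ext fun i j => ?_
      simp [cg]
    · simp
  have n1 : κ.succ ≠ s.succ := fun h => hne (Fin.succ_injective _ h).symm
  have n2 : ∀ l : Fin n, l.succ ≠ 0 := Fin.succ_ne_zero
  have n3 : ∀ l : Fin n, (0 : Fin (n+1)) ≠ l.succ := fun l => (Fin.succ_ne_zero l).symm
  have e1 : (evMat K (n+1) (emb (yw ε [κ,κ,s,κ])) * genMat K (n+1) 0) =
    (genMat K (n+1) κ.succ - (genMat K (n+1) κ.succ)ᵀ) * ((genMat K (n+1) κ.succ - (genMat K (n+1) κ.succ)ᵀ) * ((genMat K (n+1) s.succ + (genMat K (n+1) s.succ)ᵀ) * ((genMat K (n+1) κ.succ - (genMat K (n+1) κ.succ)ᵀ) * genMat K (n+1) 0))) := by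
    simp only [yw_cons, yw_nil, mul_one, map_mul, hA, hB, mul_assoc]
  rw [e1, dt, dt] at h1
  simp only [D_mul, ds, da, DA_gen, D_cg, n1, n2, n3, if_true, if_false, zero_mul, mul_zero, zero_add, add_zero] at h1
  have pt : ∀ (P : M3 (Rpoly K (n+1))), phi κ.succ mE P.trace = ((phi κ.succ mE).mapMatrix P).trace := fun P => by
    simp [trace]
  have hG : (phi κ.succ mE).mapMatrix (genMat K (n+1) κ.succ - (genMat K (n+1) κ.succ)ᵀ) = (Polynomial.X : Polynomial K) • ((mE - mEᵀ : M3 K)).map Polynomial.C := by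
    have h := phi_gen (d := n+1) κ.succ κ.succ (mE : M3 K)
    rw [if_pos rfl] at h
    have h' : (phi κ.succ mE).mapMatrix ((genMat K (n+1) κ.succ)ᵀ) = ((phi κ.succ mE).mapMatrix (genMat K (n+1) κ.succ))ᵀ := rfl
    rw [map_sub, h', h]
    refine Matrix.ext fun i j => ?_
    simp [mul_sub]
  rw [pt] at h1
  simp only [map_mul, hG, phi_cg, smul_mul_assoc, mul_smul_comm, ← Matrix.map_mul, smul_smul, Matrix.trace_smul] at h1
  have h2 := congrArg (fun p => Polynomial.coeff p 3) h1
  have h7 : (3 : K) = 0 := by exact_mod_cast CharP.cast_eq_zero K 3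
  have : ∀ P : M3 K, (P.map Polynomial.C).trace = Polynomial.C P.trace := fun P => by simp [trace]
  rw [this, show (Polynomial.X * Polynomial.X * Polynomial.X : Polynomial K) = Polynomial.X ^ 3 by ring, smul_eq_mul, Polynomial.coeff_X_pow_mul', Polynomial.coeff_zero, if_pos le_rfl, Nat.sub_self, Polynomial.coeff_C_zero] at h2
  simp [mE, mS, mX, trace, sum_univ_three, mul_apply] at h2
  exact one_ne_zero (α := K) (by grind)
end BASE2
section MAIN
variable {K : Type} [Field K]
theorem yw_words {n : ℕ} (ε : Fin n → Bool) (l : List (Fin n)) : yw ε l ∈ span K {w : FA K n | ∃ p, p.map Prod.fst = l ∧ w = wordOf K n p} := by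
  induction l with
  | nil => exact subset_span ⟨[], rfl, by rw [yw_nil, wordOf_nil]⟩
  | cons i l ih =>
    have key : ∀ b, span K {w : FA K n | ∃ p, p.map Prod.fst = l ∧ w = wordOf K n p} ≤
      (span K {w : FA K n | ∃ p, p.map Prod.fst = i :: l ∧ w = wordOf K n p}).comap (LinearMap.mulLeft K (ι K (i, b))) := by
      intro b
      refine span_le.2 ?_
      rintro _ ⟨p, hp, rfl⟩
      exact subset_span ⟨(i, b) :: p, by simp [hp], by rw [wordOf_cons]; rfl⟩
    rw [yw_cons, ys, add_mul, smul_mul_assoc]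
    exact add_mem (key _ ih) (smul_mem _ _ (key _ ih))
theorem caseML [Infinite K] [CharP K 3] {n : ℕ} {ε : Fin n → Bool} {M : Multiset (Fin n)} (hM : M.Nodup) {U : FA K n} (hU : U ∈ WS K ε M)
    (hH : U ∈ Hs K n) : U ∈ IA K n := by
  obtain ⟨L, rfl⟩ := Quot.exists_rep M
  change List.Nodup L at hM
  change U ∈ WS K ε (L : Multiset (Fin n)) at hU
  let m := L.length
  let a : Fin n → FA K m := fun k => if h : k ∈ L then ι K (⟨L.idxOf k, List.idxOf_lt_length_iff.2 h⟩, false) else 0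
  let q : Fin n → Fin (m+1) := fun k => if h : k ∈ L then Fin.succ ⟨L.idxOf k, List.idxOf_lt_length_iff.2 h⟩ else 0
  let ε' : Fin (m+1) → Bool := Fin.cases false fun i => ε (L.get i)
  let c : Fin (m+1) → FA K n := Fin.cases 0 fun i => ι K (L.get i, false)
  have ha : ∀ k, a k ∈ MFsub K m := fun k => by
    simp only [a]; split
    · exact MF_iota _
    · exact zero_mem _
  have hc : ∀ k, c k ∈ MFsub K n := Fin.cases (zero_mem _) fun i => MF_iota _
  have hq : ∀ k ∈ L, (emb (a k) : FA K (m+1)) = ι K (q k, false) ∧ ε' (q k) = ε k := fun k hk => by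
    simp only [a, q, dif_pos hk]
    refine ⟨by rw [emb, Sh_iota]; rfl, ?_⟩
    simp [ε']
  have hr : ∀ k ∈ L, Sh c (emb (a k)) = ι K (k, false) ∧ ε k = ε k := fun k hk => by
    refine ⟨?_, rfl⟩
    rw [(hq k hk).1, Sh_iota]
    simp [q, dif_pos hk, c]
  have hf : (L.map q : Multiset (Fin (m+1))) = (Finset.univ.erase 0).val := by
    have hn : (L.map q).Nodup := (List.nodup_map_iff_inj_on hM).2 fun x hx y hy h => by
      simp only [q, dif_pos hx, dif_pos hy, Fin.succ_inj, Fin.mk.injEq] at h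
      exact (List.idxOf_inj hx).1 h
    refine (Multiset.Nodup.ext (Multiset.coe_nodup.2 hn) (Finset.nodup _)).2 fun x => ?_
    simp only [Multiset.mem_coe, List.mem_map, Finset.mem_val, Finset.mem_erase, Finset.mem_univ, and_true]
    constructor
    · rintro ⟨k, hk, rfl⟩
      simp [q, dif_pos hk]
    · refine Fin.cases (fun h => absurd rfl h) (fun i _ => ⟨L.get i, L.get_mem i, ?_⟩) x
      simp only [q, dif_pos (L.get_mem i), Fin.succ_inj]
      exact Fin.ext (hM.idxOf_getElem i.1 i.2)
  have e1 : ∀ V, emb (Sh a V) = Sh (fun k => emb (a k)) V := fun V => Sh_comp _ _ _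
  have h1 : emb (Sh a U) ∈ span K {w | ∃ l, Full 0 l ∧ w = wordOf K (m+1) l} := by
    have : WS K ε (L : Multiset (Fin n)) ≤ (span K {w | ∃ l, Full 0 l ∧ w = wordOf K (m+1) l}).comap (Sh fun k => (emb (a k) : FA K (m+1))).toLinearMap := WS_le fun l hl => by
      show Sh (fun k => (emb (a k) : FA K (m+1))) (yw ε l) ∈ span K {w | ∃ l, Full 0 l ∧ w = wordOf K (m+1) l}
      have hl' : ∀ k ∈ l, k ∈ L := fun k hk => by
        rw [← Multiset.mem_coe, ← hl]; exact hk
      rw [Sh_yw (ε' := ε') (q := q) fun k hk => hq k (hl' k hk)]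
      refine Submodule.span_mono ?_ (yw_words ε' (l.map q))
      rintro _ ⟨p, hp, rfl⟩
      refine ⟨p, ?_, rfl⟩
      rw [Full, hp, ← hf, ← Multiset.map_coe, ← Multiset.map_coe, hl]
    rw [e1]; exact this hU
  have h2 := multilin h1 (mem_Hs.1 (Sh_H ha hH))
  have h3 := Sh_IA hc h2
  have h4 : Sh c (emb (Sh a U)) = U := by
    have : WS K ε (L : Multiset (Fin n)) ≤ LinearMap.eqLocus (Sh fun k => Sh c (emb (a k))).toLinearMap LinearMap.id := WS_le fun l hl => by
      show Sh _ (yw ε l) = yw ε l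
      have hl' : ∀ k ∈ l, k ∈ L := fun k hk => by
        rw [← Multiset.mem_coe, ← hl]; exact hk
      rw [Sh_yw (ε' := ε) (q := id) fun k hk => hr k (hl' k hk), List.map_id]
    rw [e1, Sh_comp]
    exact this hU
  rwa [h4] at h3
theorem tfc {n : ℕ} (M : Multiset (Fin n)) (i) : M.toFinset.card ≤ (M.erase i).toFinset.card + 1 := by
  have : M.toFinset ⊆ insert i (M.erase i).toFinset := fun x hx => by
    rw [mem_insert, Multiset.mem_toFinset]
    by_cases h : x = i
    · exact Or.inl h
    · exact Or.inr ((Multiset.mem_erase_of_ne h).2 (Multiset.mem_toFinset.1 hx))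
  exact (Finset.card_le_card this).trans (Finset.card_insert_le _ _)
theorem tfc2 {n : ℕ} (M : Multiset (Fin n)) (i) (h : 2 ≤ M.count i) : (M.erase i).toFinset = M.toFinset := by
  ext x
  rw [Multiset.mem_toFinset, Multiset.mem_toFinset, ← Multiset.count_pos, ← Multiset.count_pos]
  by_cases hx : x = i
  · subst hx; rw [Multiset.count_erase_self]; omega
  · rw [Multiset.count_erase_of_ne hx]
theorem mainW [Infinite K] [CharP K 3] (N : ℕ) : ∀ (n : ℕ) (ε : Fin n → Bool) (M : Multiset (Fin n)), 2 * M.card < N + M.toFinset.card →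
    ∀ U ∈ WS K ε M, U ∈ Hs K n → U ∈ IA K n := by
  induction N with
  | zero =>
    intro n ε M h
    have := Multiset.toFinset_card_le M
    omega
  | succ N IH =>
    intro n ε M hN U hU hH
    by_cases hA : ∃ i, 4 ≤ M.count i
    · obtain ⟨i, hi⟩ := hA; exact caseA hi hU
    by_cases hD : ∃ i, M.count i = 2
    · obtain ⟨i, hi⟩ := hD
      refine caseD hi hU hH (IH _ _ _ ?_)
      have h1 : (0 ::ₘ (M.erase i).map Fin.succ).toFinset.card = (M.erase i).toFinset.card + 1 := by
        rw [Multiset.toFinset_cons, Finset.card_insert_of_notMem (by simp [Fin.succ_ne_zero]), Multiset.toFinset_map, Finset.card_image_of_injective _ (Fin.succ_injective _)]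
      have h2 := Multiset.card_erase_of_mem (Multiset.count_pos.1 (by omega : 0 < M.count i))
      have h3 := Multiset.card_pos_iff_exists_mem.2 ⟨i, Multiset.count_pos.1 (by omega : 0 < M.count i)⟩
      rw [h1, tfc2 M i hi.ge, Multiset.card_cons, Multiset.card_map, h2, Nat.pred_eq_sub_one]
      omega
    by_cases hB : ∃ i, M.count i = 3 ∧ ε i = false
    · obtain ⟨i, hi, hε⟩ := hB
      have hm := Multiset.count_pos.1 (by omega : 0 < M.count i)
      have h2 := Multiset.card_erase_of_mem hm
      have h3 := Multiset.card_pos_iff_exists_mem.2 ⟨i, hm⟩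
      rw [Nat.pred_eq_sub_one] at h2
      have hb := caseB hi hε hU
      have h4 := IH _ _ _ (by rw [tfc2 M i (by omega)]; omega) _ (dl_WS i hU) (dl_H i hH)
      have := add_mem hb (IA_l (ys ε i) h4)
      rwa [sub_add_cancel] at this
    by_cases hC : ∃ i, M.count i = 3 ∧ ε i = true
    · obtain ⟨i, hi, hε⟩ := hC
      obtain ⟨M', rfl⟩ : ∃ M', M = i ::ₘ i ::ₘ i ::ₘ M' := by
        have := Multiset.le_count_iff_replicate_le.1 hi.ge
        obtain ⟨M', hM'⟩ := Multiset.le_iff_exists_add.1 this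
        exact ⟨M', by rw [hM']; simp [Multiset.replicate_succ]⟩
      refine caseC hε (fun j hj hj' => ?_) (fun j hj => IH _ _ _ ?_) (fun s hs => base hε hs) hU hH
      · have h5 : (i ::ₘ i ::ₘ i ::ₘ M').count j = M'.count j := by
          have : j ≠ i := by rintro rfl; rw [hε] at hj'; cases hj'
          simp [Multiset.count_cons_of_ne this]
        have h6 := Multiset.count_pos.2 hj
        push Not at hA hD hB
        have := hA j; have := hD j; have := hB j
        by_contra h8
        exact this (by omega) hj'
      · have hm' : j ∈ (i ::ₘ i ::ₘ i ::ₘ M') := by simp [hj]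
        have h2 := Multiset.card_erase_of_mem hm'
        have h3 := Multiset.card_pos_iff_exists_mem.2 ⟨j, hm'⟩
        have h4 := tfc (i ::ₘ i ::ₘ i ::ₘ M') j
        rw [Nat.pred_eq_sub_one] at h2
        omega
    refine caseML (Multiset.nodup_iff_count_le_one.2 fun i => ?_) hU hH
    push Not at hA hB hC hD
    have := hA i; have h1 := hB i; have := hD i; have h2 := hC i
    by_contra h3
    cases h : ε i
    · exact h1 (by omega) h
    · exact h2 (by omega) h
end MAIN
section FIN
open Matrix
variable {K : Type} [Field K]
theorem scl {n : ℕ} {ε : Fin n → Bool} (i : Fin n) (t : K) {M : Multiset (Fin n)} {U : FA K n} (hU : U ∈ WS K ε M) :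
    Sh (fun k => (if k = i then t else 1) • ι K ((k, false) : Ltr n)) U = t ^ M.count i • U := by
  have : WS K ε M ≤ LinearMap.eqLocus (Sh (fun k => (if k = i then t else 1) • ι K ((k, false) : Ltr n))).toLinearMap (t ^ M.count i • LinearMap.id) := WS_le fun l hl => by
    subst hl
    clear hU
    show Sh (fun k => (if k = i then t else 1) • ι K ((k, false) : Ltr n)) (yw ε l) = t ^ _ • yw ε l
    rw [Multiset.coe_count]
    induction l with
    | nil => simp [yw_nil]
    | cons k l ih =>
      have h : Sh (fun k => (if k = i then t else 1) • ι K ((k, false) : Ltr n)) (ys ε k) = (if k = i then t else 1 : K) • ys ε k := by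
        rw [ys, map_add, map_smul, Sh_iota, Sh_iota, if_pos rfl, if_neg (by simp), tp_smul, tp_iota, smul_add]
        congr 1
        exact smul_comm _ _ _
      rw [yw_cons, map_mul, ih, h, smul_mul_smul_comm, List.count_cons]
      congr 1
      by_cases hk : k = i
      · simp [hk, pow_succ, mul_comm]
      · simp [hk]
  exact this hU
theorem homog [Infinite K] [CharP K 3] {n : ℕ} {ε : Fin n → Bool} (N : ℕ) : ∀ (T : Finset (Multiset (Fin n))) (v : Multiset (Fin n) → FA K n), T.card < N →
    (∀ w, v w ∈ WS K ε w) → ∑ w ∈ T, v w ∈ Hs K n → ∀ w ∈ T, v w ∈ IA K n := by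
  induction N with
  | zero => intro T v h; omega
  | succ N IH =>
    intro T v hT hv hH w1 h1
    by_cases h : ∃ w0 ∈ T, w0 ≠ w1
    · obtain ⟨w0, h0, hne⟩ := h
      obtain ⟨i, hi⟩ : ∃ i, w1.count i ≠ w0.count i := by
        by_contra! hc
        exact hne (Multiset.ext.2 hc).symm
      obtain ⟨t, -, ht⟩ := ex_pow (K := K) hi
      have hS := Sh_H (a := fun k => (if k = i then t else 1) • ι K ((k, false) : Ltr n)) (fun k => smul_mem _ _ (MF_iota _)) hH
      have h2 := sub_mem hS (smul_mem _ (t ^ w0.count i) hH)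
      rw [map_sum, Finset.smul_sum, ← Finset.sum_sub_distrib] at h2
      simp only [fun w => scl i t (hv w), ← sub_smul] at h2
      rw [← Finset.add_sum_erase _ _ h0, sub_self, zero_smul, zero_add] at h2
      have h3 := IH (T.erase w0) _ (by rw [Finset.card_erase_of_mem h0]; have := Finset.card_pos.2 ⟨w0, h0⟩; omega)
        (fun w => smul_mem _ _ (hv w)) h2 w1 (Finset.mem_erase.2 ⟨hne.symm, h1⟩)
      exact (Submodule.smul_mem_iff _ (sub_ne_zero.2 ht)).1 h3
    · push Not at h
      have : T = {w1} := Finset.eq_singleton_iff_unique_mem.2 ⟨h1, h⟩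
      rw [this, Finset.sum_singleton] at hH
      exact mainW (2 * w1.card + 1) _ _ _ (by omega) _ (hv w1) hH
theorem Sh_id {n : ℕ} (u : FA K n) : Sh (fun k => ι K ((k, false) : Ltr n)) u = u := by
  have : Sh (fun k => ι K ((k, false) : Ltr n)) = AlgHom.id K (FA K n) := by
    apply FreeAlgebra.hom_ext
    funext p
    obtain ⟨k, b⟩ := p
    rw [Function.comp_apply, Sh_iota]
    cases b
    · rfl
    · rw [if_pos rfl, tp_iota]; rfl
  rw [this]; rfl
theorem H_IA [Infinite K] [CharP K 3] {n : ℕ} {u : FA K n} (hu : u ∈ Hs K n) : u ∈ IA K n := by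
  let ε : Fin (n+n) → Bool := Fin.append (fun _ : Fin n => false) (fun _ : Fin n => true)
  let a : Fin n → FA K (n+n) := fun k => ys ε (Fin.castAdd n k) + ys ε (Fin.natAdd n k)
  have e0 : ∀ k : Fin n, ε (Fin.castAdd n k) = false := fun k => Fin.append_left _ _ k
  have e1 : ∀ k : Fin n, ε (Fin.natAdd n k) = true := fun k => Fin.append_right _ _ k
  have ha : ∀ k, a k ∈ MFsub K (n+n) := fun k => add_mem (MF_ys _ _) (MF_ys _ _)
  have h1 : Sh a u ∈ span K (Set.range (yw (K := K) ε)) := by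
    have hy : ∀ j, span K (Set.range (yw (K := K) ε)) ≤ (span K (Set.range (yw (K := K) ε))).comap (LinearMap.mulLeft K (ys ε j)) := fun j => by
      refine span_le.2 ?_
      rintro _ ⟨l, rfl⟩
      exact subset_span ⟨j :: l, yw_cons ε j l⟩
    have hw : ∀ l, Sh a (wordOf K n l) ∈ span K (Set.range (yw (K := K) ε)) := fun l => by
      induction l with
      | nil => rw [wordOf_nil, map_one]; exact subset_span ⟨[], rfl⟩
      | cons p l ih =>
        rw [wordOf_cons, map_mul, Sh_iota]
        have : ∀ j, ys ε j * Sh a (wordOf K n l) ∈ span K (Set.range (yw (K := K) ε)) := fun j => hy j ih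
        have hh := fun j => smul_mem _ (if ε j then -1 else 1 : K) (this j)
        split
        · change tp K (n+n) (ys ε _ + ys ε _) * _ ∈ _
          simp only [tp_add, tp_ys, add_mul, smul_mul_assoc]
          exact add_mem (hh _) (hh _)
        · change (ys ε _ + ys ε _) * _ ∈ _
          simp only [add_mul]
          exact add_mem (this _) (this _)
    have hs : (⊤ : Submodule K (FA K n)) ≤ (span K (Set.range (yw (K := K) ε))).comap (Sh a).toLinearMap := by
      rw [← span_words]
      refine span_le.2 ?_
      rintro _ ⟨l, rfl⟩
      exact hw l
    exact hs Submodule.mem_top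
  have h2 : span K (Set.range (yw (K := K) ε)) ≤ ⨆ M, WS K ε M := by
    refine span_le.2 ?_
    rintro _ ⟨l, rfl⟩
    exact Submodule.mem_iSup_of_mem _ (WS_yw ε l)
  obtain ⟨v, hv, hs⟩ := (Submodule.mem_iSup_iff_exists_finsupp _ _).1 (h2 h1)
  have h3 : Sh a u ∈ Hs K (n+n) := Sh_H ha hu
  rw [← hs] at h3
  have h4 := homog _ v.support v (Nat.lt_succ_self _) hv h3
  have h5 : Sh a u ∈ IA K (n+n) := by rw [← hs]; exact Submodule.sum_mem _ h4
  let c : Fin (n+n) → FA K n := Fin.append (fun k => -ι K (k, false)) (fun k => -ι K (k, false))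
  have hc : ∀ j, c j ∈ MFsub K n := fun j => by
    refine Fin.addCases (fun k => ?_) (fun k => ?_) j
    · simp only [c, Fin.append_left]; exact neg_mem (MF_iota _)
    · simp only [c, Fin.append_right]; exact neg_mem (MF_iota _)
  have h6 := Sh_IA hc h5
  have h7 : ∀ k, Sh c (a k) = ι K (k, false) := fun k => by
    have h3 : (3 : K) = 0 := by exact_mod_cast CharP.cast_eq_zero K 3
    simp only [a, ys, map_add, map_smul, Sh_iota, e0, e1, c, Fin.append_left, Fin.append_right, if_true, Bool.false_eq_true, if_false]
    have h8 : (3 : K) • ι K ((k, false) : Ltr n) = 0 := by rw [h3, zero_smul]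
    have h9 : (3 : K) • ι K ((k, false) : Ltr n) = ι K ((k, false) : Ltr n) + ι K ((k, false) : Ltr n) + ι K ((k, false) : Ltr n) := by
      rw [show (3 : K) = 1 + 1 + 1 by norm_num, add_smul, add_smul, one_smul]
    rw [h9] at h8
    rw [neg_one_smul, one_smul, eq_comm, ← sub_eq_zero, ← h8]
    abel
  rw [Sh_comp] at h6
  simp only [h7, Sh_id] at h6
  exact h6
theorem fin_thm [Infinite K] [CharP K 3] {n : ℕ} (u : FA K (n+1))
    (hu : u ∈ span K {y : FA K (n+1) | ∃ l : List (Ltr (n+1)), l ≠ [] ∧ (∀ p ∈ l, p.1 ≠ (0 : Fin (n+1))) ∧ y = wordOf K (n+1) l}) :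
    trace (evMat K (n+1) u * genMat K (n+1) 0 ^ 2) ∈ decompSet K (n+1) ↔ u ∈ idealA K (n+1) := by
  rw [decomp_iff, ← mem_IA]
  constructor
  · intro h
    have h1 := Dk_Dec 0 h
    have hg : ∀ k, (genMat K (n+1) k).map (Dk 0) = if k = 0 then 1 else 0 := fun k => by
      refine Matrix.ext fun i j => ?_
      rw [Matrix.map_apply, Dk_gen]; split <;> rfl
    have hD : (evMat K (n+1) u).map (Dk 0) = 0 := by
      have : ∀ l : List (Ltr (n+1)), (∀ p ∈ l, p.1 ≠ (0 : Fin (n+1))) → (evMat K (n+1) (wordOf K (n+1) l)).map (Dk 0) = 0 := fun l => by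
        induction l with
        | nil => intro _; rw [wordOf_nil, map_one]; refine Matrix.ext fun i j => ?_; simp [Matrix.one_apply]; split <;> simp
        | cons p l ih =>
          intro hp
          have h0 : (evMat K (n+1) (ι K p)).map (Dk 0) = 0 := by
            have := hg p.1
            rw [if_neg (hp p (by simp))] at this
            simp only [evMat, FreeAlgebra.lift_ι_apply]
            split
            · rw [Matrix.transpose_map, this]; rfl
            · exact this
          rw [wordOf_cons, map_mul, D_mul, ih fun q hq => hp q (by simp [hq]), h0, mul_zero, zero_mul, zero_add]
      have h2 : span K {y : FA K (n+1) | ∃ l : List (Ltr (n+1)), l ≠ [] ∧ (∀ p ∈ l, p.1 ≠ (0 : Fin (n+1))) ∧ y = wordOf K (n+1) l} ≤ LinearMap.ker ((Dk (K := K) (0 : Fin (n+1))).toLinearMap.mapMatrix ∘ₗ (evMat K (n+1)).toLinearMap) := by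
        refine span_le.2 ?_
        rintro _ ⟨l, -, hl, rfl⟩
        exact this l hl
      exact h2 hu
    have h2 : Dk 0 (trace (evMat K (n+1) u * genMat K (n+1) 0 ^ 2)) = 2 * trace (evMat K (n+1) u * genMat K (n+1) 0) := by
      have dt : ∀ (P : M3 (Rpoly K (n+1))), Dk 0 P.trace = (P.map (Dk 0)).trace := fun P => by
        simp [trace]
      rw [dt, D_mul, hD, pow_two, D_mul, hg, if_pos rfl, zero_mul, add_zero, mul_one, one_mul, mul_add, Matrix.trace_add, two_mul]
    rw [h2] at h1
    have h3 := half_Dec two_ne h1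
    let b : Fin (n+1) → FA K n := Fin.cases 0 fun k => ι K (k, false)
    have h4 : emb (Sh b u) = u := by
      have : ∀ l : List (Ltr (n+1)), (∀ p ∈ l, p.1 ≠ (0 : Fin (n+1))) → emb (Sh b (wordOf K (n+1) l)) = wordOf K (n+1) l := fun l => by
        induction l with
        | nil => intro _; rw [wordOf_nil, map_one, map_one]
        | cons p l ih =>
          intro hp
          rw [wordOf_cons, map_mul, map_mul, ih fun q hq => hp q (by simp [hq])]
          congr 1
          obtain ⟨k, c⟩ := p
          obtain ⟨k, rfl⟩ := Fin.exists_succ_eq.2 (hp (k, c) (by simp))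
          rw [Sh_iota]
          cases c
          · simp [b, emb, Sh_iota]
          · simp only [b, if_true, Fin.cases_succ, tp_iota, flp]; simp [emb, Sh_iota, tp_iota, flp]
      have h2 : span K {y : FA K (n+1) | ∃ l : List (Ltr (n+1)), l ≠ [] ∧ (∀ p ∈ l, p.1 ≠ (0 : Fin (n+1))) ∧ y = wordOf K (n+1) l} ≤ LinearMap.eqLocus ((emb (K := K)).toLinearMap ∘ₗ (Sh b).toLinearMap) LinearMap.id := by
        refine span_le.2 ?_
        rintro _ ⟨l, -, hl, rfl⟩
        exact this l hl
      exact h2 hu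
    have h5 : Sh b u ∈ Hs K n := by rw [mem_Hs, h4]; exact h3
    rw [← h4]
    exact Sh_IA (fun k => MF_iota _) (H_IA h5)
  · intro h
    rw [gen_ev, ← map_pow, ← map_mul]
    exact IA_Dec two_ne h (by rw [pow_two]; exact MF_mul_left _ (MF_iota _))
end FIN

/-- for `char F = 3` and `u ∈ M_F` a linear combination of words containing no
`x₁, x₁ᵀ`, the invariant `tr(U X₁²)` is decomposable iff `u = 0` in `A_{3,d}`. -/
theorem stmt18 (F : Type) [Field F] [Infinite F] [CharP F 3] (d : ℕ) (hd : 1 ≤ d)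
    (u : FA F d)
    (hu : u ∈ Submodule.span F {y : FA F d | ∃ l : List (Ltr d), l ≠ [] ∧
        (∀ p ∈ l, p.1 ≠ (⟨0, hd⟩ : Fin d)) ∧ y = wordOf F d l}) :
    Matrix.trace (evMat F d u * genMat F d ⟨0, hd⟩ ^ 2) ∈ decompSet F d ↔ u ∈ idealA F d := by
  obtain ⟨n, rfl⟩ : ∃ n, d = n + 1 := ⟨d - 1, by omega⟩
  exact fin_thm u hu
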